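/- arXiv:1503.06686 — 2 statements merged into one kernel-verified Lean document; each statement's English description precedes it below -/
import Mathlib

section
/- Let f₃(x) = (x² − x − 1)⁵·(x² − x − 1/16) − (2·3⁶/5³)·x³·(x − 1)³·(x³ − 2) ∈ ℚ[x]. Then f₃ is irreducible over ℚ, the Galois group of its splitting field over ℚ is a simple group of cardinality 7920 (i.e., isomorphic to the Mathieu group M₁₁), the root field K = ℚ[x]/(f₃) is a degree-12 number field with discriminant 45513961⁴, and 45513961 is prime; in particular K/ℚ is ramified only above the single prime 45513961. -/
open Polynomial

/-- `f₃(x) = (x² − x − 1)⁵ (x² − x − 1/16) − (2·3⁶/5³) · x³ (x − 1)³ (x³ − 2)` over `ℚ`. -/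
noncomputable def f3 : Polynomial ℚ :=
  (X ^ 2 - X - 1) ^ 5 * (X ^ 2 - X - C (1 / 16 : ℚ)) -
    C (2 * 3 ^ 6 / 5 ^ 3 : ℚ) * (X ^ 3 * (X - 1) ^ 3 * (X ^ 3 - 2))

namespace M11
section lists

/-- evaluation of a coefficient list -/
def ev {R : Type*} [CommRing R] (x : R) : List ℤ → R
  | [] => 0
  | a :: l => (a : R) + x * ev x l

def ladd : List ℤ → List ℤ → List ℤ
  | [], m => m
  | a :: l, [] => a :: l
  | a :: l, b :: m => (a + b) :: ladd l m

def lsm (c : ℤ) (l : List ℤ) : List ℤ := l.map (c * ·)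

def lmul : List ℤ → List ℤ → List ℤ
  | [], _ => []
  | a :: l, m => ladd (lsm a m) (0 :: lmul l m)

def xstep (n : ℕ) (G : List ℤ) (a : ℤ) (l : List ℤ) : List ℤ :=
  if l.length = n then ladd (a :: l.dropLast) (lsm (l.getLastD 0) G) else a :: l

def lred (n : ℕ) (G : List ℤ) (l : List ℤ) : List ℤ := l.foldr (xstep n G) []

def lmod (p : ℤ) (l : List ℤ) : List ℤ := l.map (· % p)

def lmm (p : ℤ) (n : ℕ) (G a b : List ℤ) : List ℤ := lmod p (lred n G (lmul a b))

/-- `a ^ b` by repeated squaring, fuel first -/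
def lpow (p : ℤ) (n : ℕ) (G a : List ℤ) : ℕ → ℕ → List ℤ
  | 0, _ => [1]
  | f + 1, b =>
    if b = 0 then [1] else
      let h := lpow p n G a f (b / 2)
      let h2 := lmm p n G h h
      if b % 2 = 1 then lmm p n G h2 a else h2

variable {R : Type*} [CommRing R] (x : R)

@[simp] theorem ev_nil : ev x [] = 0 := rfl
@[simp] theorem ev_cons (a : ℤ) (l : List ℤ) : ev x (a :: l) = a + x * ev x l := rfl

@[simp] theorem ev_ladd (l m : List ℤ) : ev x (ladd l m) = ev x l + ev x m := by
  induction l generalizing m with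
  | nil => simp [ladd]
  | cons a l ih =>
    cases m with
    | nil => simp [ladd]
    | cons b m => simp [ladd, ih]; ring

@[simp] theorem ev_lsm (c : ℤ) (l : List ℤ) : ev x (lsm c l) = c * ev x l := by
  induction l with
  | nil => simp [lsm]
  | cons a l ih => simp only [lsm, List.map_cons, ev_cons] at *; rw [ih]; push_cast; ring

@[simp] theorem ev_lmul (l m : List ℤ) : ev x (lmul l m) = ev x l * ev x m := by
  induction l with
  | nil => simp [lmul]
  | cons a l ih => simp [lmul, ih]; ring

theorem ev_concat (l : List ℤ) (t : ℤ) : ev x (l ++ [t]) = ev x l + x ^ l.length * t := by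
  induction l with
  | nil => simp
  | cons a l ih => simp [ih]; ring

theorem ev_xstep {n : ℕ} {G : List ℤ} (h0 : n ≠ 0) (h : x ^ n = ev x G) (a : ℤ) (l : List ℤ) :
    ev x (xstep n G a l) = a + x * ev x l := by
  unfold xstep
  split_ifs with hl
  · have hne : l ≠ [] := by rintro rfl; simp at hl; omega
    conv_rhs => rw [← List.dropLast_append_getLast hne]
    rw [ev_concat, ev_ladd, ev_cons, ev_lsm, ← h, List.getLastD_eq_getLast?,
      List.getLast?_eq_some_getLast hne, Option.getD_some, List.length_dropLast, hl]
    obtain ⟨k, rfl⟩ := Nat.exists_eq_succ_of_ne_zero h0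
    simp; ring
  · rfl

theorem ev_lred {n : ℕ} {G : List ℤ} (h0 : n ≠ 0) (h : x ^ n = ev x G) (l : List ℤ) :
    ev x (lred n G l) = ev x l := by
  induction l with
  | nil => rfl
  | cons a l ih => rw [lred, List.foldr_cons, ev_xstep x h0 h, ← lred, ih, ev_cons]

theorem cast_mod {p : ℤ} (hp : (p : R) = 0) (a : ℤ) : ((a % p : ℤ) : R) = a := by
  conv_rhs => rw [← Int.emod_add_mul_ediv a p]
  push_cast; rw [hp]; simp

theorem ev_lmod {p : ℤ} (hp : (p : R) = 0) (l : List ℤ) : ev x (lmod p l) = ev x l := by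
  induction l with
  | nil => rfl
  | cons a l ih =>
    rw [lmod, List.map_cons, ev_cons, ← lmod, ih, ev_cons, cast_mod hp]

theorem ev_lmm {p : ℤ} (hp : (p : R) = 0) {n : ℕ} {G : List ℤ} (h0 : n ≠ 0) (h : x ^ n = ev x G)
    (a b : List ℤ) : ev x (lmm p n G a b) = ev x a * ev x b := by
  rw [lmm, ev_lmod x hp, ev_lred x h0 h, ev_lmul]

theorem ev_lpow {p : ℤ} (hp : (p : R) = 0) {n : ℕ} {G : List ℤ} (h0 : n ≠ 0) (h : x ^ n = ev x G)
    (a : List ℤ) (f b : ℕ) (hb : b < 2 ^ f) : ev x (lpow p n G a f b) = ev x a ^ b := by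
  induction f generalizing b with
  | zero => simp at hb; subst hb; simp [lpow]
  | succ f ih =>
    rw [lpow]
    by_cases h1 : b = 0
    · subst h1; simp
    · have hb2 : b / 2 < 2 ^ f := by rw [pow_succ] at hb; omega
      simp only [if_neg h1]
      split_ifs with h2
      · rw [ev_lmm x hp h0 h, ev_lmm x hp h0 h, ih _ hb2]
        conv_rhs => rw [← Nat.div_add_mod b 2, h2, pow_add, pow_mul']
        ring
      · rw [ev_lmm x hp h0 h, ih _ hb2]
        conv_rhs => rw [← Nat.div_add_mod b 2, show b % 2 = 0 by omega, pow_add, pow_mul']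
        ring

theorem map_ev {S : Type*} [CommRing S] (φ : R →+* S) (l : List ℤ) :
    φ (ev x l) = ev (φ x) l := by
  induction l with
  | nil => simp
  | cons a l ih => simp [ih]

/-- the list as a polynomial -/
noncomputable def lpol (R : Type*) [CommRing R] (l : List ℤ) : Polynomial R :=
  ev (Polynomial.X : Polynomial R) l

theorem eval_lpol (l : List ℤ) : (lpol R l).eval x = ev x l := by
  have := map_ev (Polynomial.X : Polynomial R) (Polynomial.evalRingHom x) l
  simpa [lpol] using this

theorem coeff_lpol (l : List ℤ) (i : ℕ) : (lpol R l).coeff i = ((l.getD i 0 : ℤ) : R) := by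
  induction l generalizing i with
  | nil => simp [lpol]
  | cons a l ih =>
    rw [lpol, ev_cons, ← lpol, ← Polynomial.C_eq_intCast]
    cases i with
    | zero => rw [Polynomial.coeff_add, Polynomial.coeff_C]; simp
    | succ i => rw [Polynomial.coeff_add, Polynomial.coeff_C, Polynomial.coeff_X_mul, ih]; simp

theorem natDegree_lpol (l : List ℤ) (n : ℕ) (hl : l.length ≤ n + 1) : (lpol R l).natDegree ≤ n := by
  rw [Polynomial.natDegree_le_iff_coeff_eq_zero]
  intro N hN
  rw [coeff_lpol, List.getD_eq_default _ _ (by omega)]; simp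

/-- a short list vanishing at many points is zero -/
theorem ev_many {K ι : Type*} [Field K] [Finite ι] (r : ι → K) (hr : Function.Injective r)
    (l : List ℤ) (hl : l.length ≤ Nat.card ι) (h : ∀ i, ev (r i) l = 0) (k : ℕ) :
    ((l.getD k 0 : ℤ) : K) = 0 := by
  have := Fintype.ofFinite ι
  by_cases h0 : l = []
  · subst h0; simp
  have hpos : 0 < l.length := List.length_pos_iff.mpr h0
  have : lpol K l = 0 := by
    apply Polynomial.eq_zero_of_natDegree_lt_card_of_eval_eq_zero _ hr
    · intro i; rw [eval_lpol, h]
    · have := natDegree_lpol (R := K) l (l.length - 1) (by omega)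
      rw [Nat.card_eq_fintype_card] at hl
      omega
  rw [← coeff_lpol, this, Polynomial.coeff_zero]

end lists
end M11

namespace M11
section grp

theorem perm11 {X : Type*} [Finite X] (hX : Nat.card X = 12) (σ : Equiv.Perm X)
    (h : orderOf σ = 11) :
    ∃ a, σ a = a ∧ (∀ x, σ x = x → x = a) ∧
      ∀ x y, x ≠ a → y ≠ a → ∃ k : ℤ, (σ ^ k) x = y := by
  classical
  have := Fintype.ofFinite X
  rw [Nat.card_eq_fintype_card] at hX
  have hc : σ.IsCycle := Equiv.Perm.isCycle_of_prime_order' (by rw [h]; norm_num) (by omega)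
  have h1 := hc.orderOf
  have h2 : (σ.supportᶜ).card = 1 := by rw [Finset.card_compl]; omega
  obtain ⟨a, ha⟩ := Finset.card_eq_one.mp h2
  have key : ∀ x, σ x = x ↔ x = a := by
    intro x
    have : x ∈ σ.supportᶜ ↔ x = a := by rw [ha]; simp
    rw [← this]; simp
  refine ⟨a, (key a).2 rfl, fun x hx => (key x).1 hx, fun x y hx hy => ?_⟩
  exact hc.exists_zpow_eq (fun h => hx ((key x).1 h)) (fun h => hy ((key y).1 h))

variable {H X : Type*} [Group H] [Finite H] [Finite X] [MulAction H X] [FaithfulSMul H X]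

theorem act11 (hX : Nat.card X = 12) (c : H) (h : orderOf c = 11) :
    ∃ a : X, c • a = a ∧ (∀ x : X, c • x = x → x = a) ∧
      ∀ x y : X, x ≠ a → y ≠ a → ∃ k : ℤ, c ^ k • x = y := by
  have h' : orderOf (MulAction.toPermHom H X c) = 11 := by
    rw [orderOf_injective _ MulAction.toPerm_injective]; exact h
  obtain ⟨a, h1, h2, h3⟩ := perm11 hX _ h'
  refine ⟨a, h1, h2, fun x y hx hy => ?_⟩
  obtain ⟨k, hk⟩ := h3 x y hx hy
  refine ⟨k, ?_⟩
  rw [← map_zpow] at hk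
  exact hk

theorem cent11 (hX : Nat.card X = 12) (c g : H) (h : orderOf c = 11) (hg : g * c = c * g) :
    g ∈ Subgroup.zpowers c := by
  obtain ⟨a, h1, h2, h3⟩ := act11 hX c h
  have hcomm : Commute g c := hg
  have hga : g • a = a := h2 _ (by rw [← mul_smul, ← hg, mul_smul, h1])
  have : ∃ x : X, x ≠ a := by
    by_contra! hc
    have : Subsingleton X := ⟨fun x y => (hc x).trans (hc y).symm⟩
    have := Finite.card_le_one_iff_subsingleton.mpr this
    omega
  obtain ⟨x, hx⟩ := this
  have hgx : g • x ≠ a := by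
    intro hh
    exact hx (smul_left_cancel g (hh.trans hga.symm))
  obtain ⟨k, hk⟩ := h3 x (g • x) hx hgx
  refine ⟨k, ?_⟩
  refine FaithfulSMul.eq_of_smul_eq_smul (α := X) fun y => ?_
  by_cases hy : y = a
  · subst hy
    rw [hga]
    have : c ∈ MulAction.stabilizer H y := h1
    exact (MulAction.stabilizer H y).zpow_mem this k
  · obtain ⟨l, hl⟩ := h3 x y hx hy
    rw [← hl]
    show c ^ k • _ = _
    rw [← mul_smul, ← mul_smul, ← zpow_add, add_comm, zpow_add, mul_smul, hk, ← mul_smul,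
      (hcomm.zpow_right l).eq]

/-- no subgroup of order 12 normalised by an element of order 11 -/
theorem no12 (hX : Nat.card X = 12) (c : H) (h : orderOf c = 11) (A : Subgroup H)
    (hA : Nat.card A = 12) (hn : ∀ k : ℤ, ∀ x ∈ A, c ^ k * x * (c ^ k)⁻¹ ∈ A) : False := by
  have f1 : Fact (Nat.Prime 2) := ⟨Nat.prime_two⟩
  have f2 : Fact (Nat.Prime 3) := ⟨Nat.prime_three⟩
  obtain ⟨u, hu⟩ := exists_prime_orderOf_dvd_card' (G := A) 2 (by rw [hA]; norm_num)
  obtain ⟨v, hv⟩ := exists_prime_orderOf_dvd_card' (G := A) 3 (by rw [hA]; norm_num)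
  have hn1 : ∀ x ∈ A, c * x * c⁻¹ ∈ A := fun x hx => by simpa using hn 1 x hx
  have hn2 : ∀ x ∈ A, c⁻¹ * x * c ∈ A := fun x hx => by simpa using hn (-1) x hx
  let σ : Equiv.Perm A :=
    { toFun := fun x => ⟨c * x * c⁻¹, hn1 x x.2⟩
      invFun := fun x => ⟨c⁻¹ * x * c, hn2 x x.2⟩
      left_inv := fun x => by ext; simp [mul_assoc]
      right_inv := fun x => by ext; simp [mul_assoc] }
  have hσ : ∀ (n : ℕ) (x : A), (((σ ^ n) x : A) : H) = c ^ n * x * (c ^ n)⁻¹ := by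
    intro n
    induction n with
    | zero => intro x; simp
    | succ n ih =>
      intro x
      rw [pow_succ', Equiv.Perm.mul_apply]
      show c * ((σ ^ n) x : A) * c⁻¹ = _
      rw [ih, pow_succ']; group
  by_cases h1 : σ = 1
  · have hcard : A ≤ Subgroup.zpowers c := by
      intro x hx
      have : ((σ ⟨x, hx⟩ : A) : H) = x := by rw [h1]; rfl
      have this : c * x * c⁻¹ = x := this
      apply cent11 hX c x h
      rw [mul_inv_eq_iff_eq_mul] at this
      exact this.symm
    have := Subgroup.card_dvd_of_le hcard
    rw [hA, Nat.card_zpowers, h] at this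
    omega
  · have hp : σ ^ 11 = 1 := by
      ext x
      rw [hσ, ← h, pow_orderOf_eq_one]; simp
    have f3 : Fact (Nat.Prime 11) := ⟨by norm_num⟩
    have ho := orderOf_eq_prime hp h1
    obtain ⟨a, ha, hu', h3⟩ := perm11 hA σ ho
    have ha1 : (1 : A) = a := hu' 1 (by ext; show c * 1 * c⁻¹ = 1; simp)
    subst ha1
    obtain ⟨k, hk⟩ := h3 u v (by rintro rfl; simp at hu) (by rintro rfl; simp at hv)
    obtain ⟨n, hn⟩ : ∃ n : ℕ, σ ^ n = σ ^ k := by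
      have : σ ^ k ∈ Subgroup.zpowers σ := ⟨k, rfl⟩
      have := mem_powers_iff_mem_zpowers.mpr this
      exact this
    rw [← hn] at hk
    have e : (v : H) = c ^ n * u * (c ^ n)⁻¹ := by rw [← hk, hσ]
    have hu2 : u ^ 2 = 1 := by rw [← hu]; exact pow_orderOf_eq_one u
    have e2 : (v : H) ^ 2 = 1 := by
      rw [e, conj_pow]
      have : (u : H) ^ 2 = 1 := by exact_mod_cast congrArg Subtype.val hu2
      rw [this]; simp
    have e3 : v ^ 2 = 1 := by ext; exact e2
    have := orderOf_dvd_of_pow_eq_one e3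
    rw [hv] at this
    omega

/-- transitive normal subgroup lemma -/
theorem normal11 (hX : Nat.card X = 12) [MulAction.IsPretransitive H X]
    (c : H) (h : orderOf c = 11) (M : Subgroup H) [M.Normal] (hM : M ≠ ⊥) :
    MulAction.IsPretransitive M X ∧ 11 ∣ Nat.card M := by
  classical
  have hn := ‹M.Normal›
  obtain ⟨a, h1, h2, h3⟩ := act11 (X := X) hX c h
  have hc1 : ∀ k : ℤ, c ^ k • a = a := fun k =>
    (MulAction.stabilizer H a).zpow_mem (show c ∈ MulAction.stabilizer H a from h1) k
  -- some element of M moves a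
  have hmove : ∃ m ∈ M, m • a ≠ a := by
    by_contra! hc
    apply hM
    rw [Subgroup.eq_bot_iff_forall]
    intro m hm
    refine FaithfulSMul.eq_of_smul_eq_smul (α := X) fun y => ?_
    obtain ⟨g, rfl⟩ := MulAction.exists_smul_eq H a y
    have := hc _ (hn.conj_mem m hm g⁻¹)
    rw [one_smul]
    rw [inv_inv, mul_smul, mul_smul, inv_smul_eq_iff] at this
    exact this
  obtain ⟨m, hm, hma⟩ := hmove
  have hfrom : ∀ y, ∃ n ∈ M, n • a = y := by
    intro y
    by_cases hy : y = a
    · exact ⟨1, M.one_mem, by simp [hy]⟩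
    · obtain ⟨k, hk⟩ := h3 _ y hma hy
      refine ⟨c ^ k * m * (c ^ k)⁻¹, hn.conj_mem m hm _, ?_⟩
      rw [mul_smul, mul_smul, ← zpow_neg, hc1, hk]
  have htr : MulAction.IsPretransitive M X := by
    refine ⟨fun x y => ?_⟩
    obtain ⟨n, hn, rfl⟩ := hfrom x
    obtain ⟨n', hn', rfl⟩ := hfrom y
    exact ⟨⟨n' * n⁻¹, M.mul_mem hn' (M.inv_mem hn)⟩, by
      show (n' * n⁻¹) • n • a = n' • a
      rw [mul_smul, inv_smul_smul]⟩
  refine ⟨htr, ?_⟩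
  have hcard : Nat.card (MulAction.stabilizer M a) * 12 = Nat.card M := by
    rw [← hX, ← MulAction.index_stabilizer_of_transitive M a]
    exact Subgroup.card_mul_index _
  let S : Subgroup H := M ⊓ MulAction.stabilizer H a
  have hS : ∀ k : ℤ, ∀ x ∈ S, c ^ k * x * (c ^ k)⁻¹ ∈ S := by
    rintro k x ⟨hx1, hx2⟩
    refine ⟨hn.conj_mem x hx1 _, ?_⟩
    show (c ^ k * x * (c ^ k)⁻¹) • a = a
    rw [mul_smul, mul_smul, ← zpow_neg, hc1, show x • a = a from hx2, hc1]
  by_cases hfix : ∃ s ∈ S, ∃ y : X, s • y ≠ y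
  · obtain ⟨s, hs, y, hy⟩ := hfix
    have hya : y ≠ a := by
      rintro rfl
      exact hy hs.2
    by_contra h11
    -- all S-orbits on X \ {a} have the same size
    have hsa : ∀ s ∈ S, ∀ y, s • y = a → y = a := by
      intro s hs y h
      have := hs.2
      rw [← show s • a = a from this] at h
      exact smul_left_cancel _ h
    have horb : ∀ z : X, z ≠ a → (MulAction.orbit S z).ncard = (MulAction.orbit S y).ncard := by
      intro z hz
      obtain ⟨k, hk⟩ := h3 y z hya hz
      have : MulAction.orbit S z = (fun w => c ^ k • w) '' MulAction.orbit S y := by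
        ext w
        constructor
        · rintro ⟨⟨t, ht⟩, rfl⟩
          refine ⟨(c ^ k)⁻¹ • t • z, ⟨⟨_, hS (-k) t ht⟩, ?_⟩, ?_⟩
          · show (c ^ (-k) * t * (c ^ (-k))⁻¹) • y = (c ^ k)⁻¹ • t • z
            rw [← hk]; simp [mul_smul]
          · show c ^ k • (c ^ k)⁻¹ • t • z = t • z
            simp
        · rintro ⟨_, ⟨⟨t, ht⟩, rfl⟩, rfl⟩
          refine ⟨⟨_, hS k t ht⟩, ?_⟩
          show (c ^ k * t * (c ^ k)⁻¹) • z = c ^ k • t • y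
          rw [← hk]; simp [mul_smul]
      rw [this, Set.ncard_image_of_injective _ (MulAction.injective _)]
    have hda : (MulAction.orbit S a).ncard = 1 := by
      rw [Set.ncard_eq_one]
      refine ⟨a, ?_⟩
      ext w
      constructor
      · rintro ⟨⟨t, ht⟩, rfl⟩
        exact ht.2
      · rintro rfl
        exact MulAction.mem_orbit_self _
    have hsum : 11 = (MulAction.orbit S y).ncard *
        (Nat.card (Quotient (MulAction.orbitRel S X)) - 1) := by
      have := Fintype.ofFinite (Quotient (MulAction.orbitRel S X))
      have e := Nat.card_congr (MulAction.selfEquivSigmaOrbits S X)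
      rw [Nat.card_sigma, hX] at e
      let q : Quotient (MulAction.orbitRel S X) := Quotient.mk _ a
      have hq : (MulAction.orbit S q.out).ncard = 1 := by
        have : q.out ∈ MulAction.orbit S a := by
          have := Quotient.mk_out (s := MulAction.orbitRel S X) a
          exact this
        rw [MulAction.orbit_eq_iff.mpr this, hda]
      have hq' : ∀ w ∈ Finset.univ.erase q, Nat.card (MulAction.orbit S w.out) =
          (MulAction.orbit S y).ncard := by
        intro w hw
        apply horb
        intro hwa
        apply (Finset.mem_erase.mp hw).1
        rw [← Quotient.out_eq w, hwa]
      rw [← Finset.add_sum_erase _ _ (Finset.mem_univ q), Finset.sum_congr rfl hq',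
        Finset.sum_const, Finset.card_erase_of_mem (Finset.mem_univ q), Finset.card_univ,
        smul_eq_mul, ← Nat.card_eq_fintype_card] at e
      have hq2 : Nat.card (MulAction.orbit S q.out) = 1 := hq
      rw [hq2] at e
      rw [mul_comm]; omega
    have hd : (MulAction.orbit S y).ncard ∣ Nat.card S := by
      rw [← MulAction.index_stabilizer]
      exact Subgroup.index_dvd_card _
    have hSM : Nat.card S ∣ Nat.card M := Subgroup.card_dvd_of_le inf_le_left
    rcases (Nat.dvd_prime (by norm_num : Nat.Prime 11)).mp (Dvd.intro _ hsum.symm) with hd1 | hd1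
    · rw [Set.ncard_eq_one] at hd1
      obtain ⟨b, hb⟩ := hd1
      have e1 : y ∈ MulAction.orbit S y := MulAction.mem_orbit_self _
      have e2 : s • y ∈ MulAction.orbit S y := ⟨⟨s, hs⟩, rfl⟩
      rw [hb] at e1 e2
      exact hy (e2.trans e1.symm)
    · rw [hd1] at hd
      exact h11 (hd.trans hSM)
  · push Not at hfix
    exfalso
    have : S = ⊥ := by
      rw [Subgroup.eq_bot_iff_forall]
      intro s hs
      exact FaithfulSMul.eq_of_smul_eq_smul (α := X) fun y => by rw [hfix s hs y, one_smul]
    have h1' : Nat.card (MulAction.stabilizer M a) = 1 := by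
      rw [Nat.card_eq_one_iff_unique]
      refine ⟨⟨fun x y => ?_⟩, ⟨1⟩⟩
      have : ∀ x : MulAction.stabilizer M a, ((x : M) : H) = 1 := by
        intro x
        have : ((x : M) : H) ∈ S := ⟨x.1.2, x.2⟩
        rw [‹S = ⊥›] at this
        exact this
      ext
      rw [this x, this y]
    refine no12 hX c h M (by omega) fun k x hx => hn.conj_mem x hx _

omit [Finite H] [Finite X] [MulAction H X] [FaithfulSMul H X] [Group H] in
theorem dvd10 {m : ℕ} (hm : m ∣ 10) : m = 1 ∨ m = 2 ∨ m = 5 ∨ m = 10 := by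
  have : m ≤ 10 := Nat.le_of_dvd (by norm_num) hm
  interval_cases m <;> omega

theorem num1 {k m n : ℕ} (hm : m ∣ 10) (hc : k = 3960 ∨ k = 7920) (h : k = 11 * m * n)
    (hn : n % 11 = 1) : k = 7920 ∧ m = 5 := by
  rcases dvd10 hm with rfl | rfl | rfl | rfl <;> omega

theorem num2 {m n : ℕ} (hm : m ∣ 10) (h : 1584 = 11 * m * n)
    (hn : n % 11 = 1) : m = 1 := by
  rcases dvd10 hm with rfl | rfl | rfl | rfl <;> omega

theorem num3 {k a : ℕ} (hle : k ≤ 7920) (hpos : 0 < k) (h5 : 5 ∣ k) (h8 : 8 ∣ k) (h3 : 3 ∣ a)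
    (h : a * 11 * 12 = k) : k = 3960 ∨ k = 7920 := by
  obtain ⟨b, rfl⟩ := h3
  have h396 : 396 ∣ k := ⟨b, by omega⟩
  obtain ⟨j, hj⟩ : 3960 ∣ k := by
    have := Nat.lcm_dvd h396 (Nat.lcm_dvd h5 h8)
    have e : Nat.lcm 396 (Nat.lcm 5 8) = 3960 := by decide +kernel
    rwa [e] at this
  omega

theorem num4 {i c : ℕ} (hi : i ∣ 55) (h : c * i = 7920) (hc : 11 ∣ c) : i = 1 ∨ i = 5 := by
  obtain ⟨w, rfl⟩ := hc
  have : i ∣ 720 := ⟨w, by nlinarith⟩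
  have h5 : i ∣ 5 := by
    have := Nat.dvd_gcd hi this
    simpa using this
  exact (Nat.dvd_prime (by norm_num)).mp h5

/-- structure of the Sylow 11-normaliser -/
theorem syl11 (hX : Nat.card X = 12) (h11 : 11 ∣ Nat.card H) (h121 : ¬ 121 ∣ Nat.card H)
    [Fact (Nat.Prime 11)] (P : Sylow 11 H) :
    Nat.card P = 11 ∧ Subgroup.centralizer (P : Set H) ≤ P ∧
    ∃ m n, m ∣ 10 ∧ Nat.card (Subgroup.normalizer (P : Set H)) = 11 * m ∧
      Nat.card H = 11 * m * n ∧ n % 11 = 1 := by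
  have hcard : Nat.card P = 11 := by
    have h0 : Nat.card H ≠ 0 := Nat.card_pos.ne'
    have hp : Nat.Prime 11 := Fact.out
    rw [P.card_eq_multiplicity]
    have a1 : 1 ≤ (Nat.card H).factorization 11 :=
      (hp.pow_dvd_iff_le_factorization h0).mp (by simpa using h11)
    have a2 : ¬ 2 ≤ (Nat.card H).factorization 11 := fun h =>
      h121 (by simpa using (hp.pow_dvd_iff_le_factorization h0).mpr h)
    rw [show (Nat.card H).factorization 11 = 1 by omega]; norm_num
  have hcent : Subgroup.centralizer (P : Set H) ≤ P := by
    obtain ⟨c, hc⟩ := exists_prime_orderOf_dvd_card' (G := P) 11 (by rw [hcard])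
    have hc' : orderOf (c : H) = 11 := by simpa using hc
    intro g hg
    have := cent11 (X := X) hX (c : H) g hc' (by
      have := Subgroup.mem_centralizer_iff.mp hg c c.2
      exact this.symm)
    exact (Subgroup.zpowers_le.mpr c.2) this
  have hPc : IsCyclic P := isCyclic_of_prime_card hcard
  refine ⟨hcard, hcent, ?_⟩
  have key := Subgroup.card_dvd_of_injective _
    (QuotientGroup.kerLift_injective (P : Subgroup H).normalizerMonoidHom)
  rw [Subgroup.normalizerMonoidHom_ker, ← Subgroup.index, ← Subgroup.relIndex, hPc.card_mulAut,
    hcard, Nat.totient_prime Fact.out] at key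
  have hle : (P : Subgroup H) ≤ Subgroup.centralizer (P : Set H) := by
    exact Subgroup.le_centralizer (P : Subgroup H)
  have heq : Subgroup.centralizer ((P : Subgroup H) : Set H) = P := le_antisymm hcent hle
  rw [heq] at key
  have hN : Nat.card (Subgroup.normalizer (P : Set H)) =
      11 * (P : Subgroup H).relIndex (Subgroup.normalizer (P : Set H)) := by
    have := Subgroup.relIndex_mul_relIndex ⊥ _ _ bot_le P.le_normalizer
    rw [Subgroup.relIndex_bot_left, Subgroup.relIndex_bot_left, hcard] at this
    exact this.symm
  refine ⟨_, Nat.card (Sylow 11 H), key, hN, ?_, card_sylow_modEq_one 11 H⟩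
  refine Eq.trans ?_ (congrArg (· * Nat.card (Sylow 11 H)) hN)
  show _ = _ * _
  rw [P.card_eq_index_normalizer, Subgroup.card_mul_index]

theorem m11_abstract (hX : Nat.card X = 12) [MulAction.IsPretransitive H X]
    (hle : Nat.card H ≤ 7920)
    (c : H) (hc : orderOf c = 11) (h5 : 5 ∣ Nat.card H) (h8 : 8 ∣ Nat.card H)
    (t : H) (ht : orderOf t = 3) (x y : X) (hxy : x ≠ y) (htx : t • x = x) (hty : t • y = y) :
    Nat.card H = 7920 ∧ IsSimpleGroup H := by
  have f11 : Fact (Nat.Prime 11) := ⟨by norm_num⟩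
  have h11 : 11 ∣ Nat.card H := hc ▸ orderOf_dvd_natCard c
  have hx : Nat.card (MulAction.stabilizer H x) * 12 = Nat.card H := by
    rw [← hX, ← MulAction.index_stabilizer_of_transitive H x]
    exact Subgroup.card_mul_index _
  have hxx : Nat.card (MulAction.stabilizer (MulAction.stabilizer H x) y) * 11 =
      Nat.card (MulAction.stabilizer H x) := by
    have : (MulAction.orbit (MulAction.stabilizer H x) y).ncard = 11 := by
      have : MulAction.orbit (MulAction.stabilizer H x) y = {x}ᶜ := by
        ext z
        constructor
        · rintro ⟨⟨g, hg⟩, rfl⟩ hh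
          have hh : g • y = x := hh
          rw [← show g • x = x from hg] at hh
          exact hxy (smul_left_cancel _ hh).symm
        · intro hz
          obtain ⟨a, h1, h2, h3⟩ := act11 (X := X) hX c hc
          obtain ⟨g, rfl⟩ := MulAction.exists_smul_eq H a x
          obtain ⟨k, hk⟩ := h3 (g⁻¹ • y) (g⁻¹ • z)
            (fun h => hxy (by rw [← h, smul_inv_smul]))
            (fun h => hz (by rw [← h, smul_inv_smul]; rfl))
          refine ⟨⟨g * c ^ k * g⁻¹, ?_⟩, ?_⟩
          · show (g * c ^ k * g⁻¹) • g • a = g • a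
            rw [mul_smul, mul_smul, inv_smul_smul]
            congr 1
            exact (MulAction.stabilizer H a).zpow_mem
              (show c ∈ MulAction.stabilizer H a from h1) k
          · show (g * c ^ k * g⁻¹) • y = z
            rw [mul_smul, mul_smul, hk, smul_inv_smul]
      rw [this, Set.ncard_compl, hX, Set.ncard_singleton]
    rw [← this, ← MulAction.index_stabilizer]
    exact Subgroup.card_mul_index _
  have h3 : 3 ∣ Nat.card (MulAction.stabilizer (MulAction.stabilizer H x) y) := by
    have : orderOf (⟨⟨t, htx⟩, hty⟩ : MulAction.stabilizer (MulAction.stabilizer H x) y) = 3 := by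
      rw [← ht, ← Subgroup.orderOf_coe, ← Subgroup.orderOf_coe]
    rw [← this]
    exact orderOf_dvd_natCard _
  have hpos : 0 < Nat.card H := Nat.card_pos
  have hcases : Nat.card H = 3960 ∨ Nat.card H = 7920 :=
    num3 hle hpos h5 h8 h3 (by rw [hxx, hx])
  obtain ⟨P⟩ : Nonempty (Sylow 11 H) := inferInstance
  have h121 : ¬ 121 ∣ Nat.card H := by
    rcases hcases with h | h <;> rw [h] <;> norm_num
  obtain ⟨hP, hcent, m, n, hm, hN, hH, hn⟩ := syl11 (X := X) hX h11 h121 P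
  have hH2 : Nat.card H = 7920 ∧ m = 5 := num1 hm hcases hH hn
  obtain ⟨hH3, rfl⟩ := hH2
  refine ⟨hH3, ?_⟩
  have hnt : Nontrivial H := by
    rw [← Finite.one_lt_card_iff_nontrivial, hH3]; norm_num
  refine ⟨fun N hNn => ?_⟩
  by_cases hNb : N = ⊥
  · exact Or.inl hNb
  right
  obtain ⟨htr, hN11⟩ := normal11 (X := X) hX c hc N hNb
  have hPN : (P : Subgroup H) ≤ N := by
    obtain ⟨d, hd⟩ := exists_prime_orderOf_dvd_card' (G := N) 11 hN11
    have hd' : orderOf (d : H) = 11 := by simpa using hd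
    have hz : Nat.card (Subgroup.zpowers (d : H)) = 11 := by rw [Nat.card_zpowers, hd']
    obtain ⟨Q, hQ⟩ := IsPGroup.exists_le_sylow (p := 11) (P := Subgroup.zpowers (d : H))
      (IsPGroup.of_card (n := 1) (by rw [hz]; norm_num))
    have hQ11 := (syl11 (X := X) hX h11 h121 Q).1
    have hQe : Subgroup.zpowers (d : H) = Q :=
      Subgroup.eq_of_le_of_card_ge hQ (by rw [hz]; exact hQ11.le)
    have hQN : (Q : Subgroup H) ≤ N := by
      rw [← hQe]; exact Subgroup.zpowers_le.mpr d.2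
    obtain ⟨g, rfl⟩ := MulAction.exists_smul_eq H Q P
    intro z hz
    rw [Sylow.coe_subgroup_smul, Subgroup.mem_pointwise_smul_iff_inv_smul_mem] at hz
    have hz2 := hNn.conj_mem _ (hQN hz) g
    have : g * ((MulAut.conj g)⁻¹ • z) * g⁻¹ = z := by
      rw [← map_inv, MulAut.smul_def, MulAut.conj_apply]; group
    rwa [this] at hz2
  have hfr := Sylow.normalizer_sup_eq_top' P hPN
  have hidx : N.index ∣ 55 := by
    have := Subgroup.relIndex_dvd_card N (Subgroup.normalizer (P : Set H))
    rw [← Subgroup.relIndex_sup_right, hfr, Subgroup.relIndex_top_right, hN] at this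
    exact this
  have hci := N.card_mul_index
  have hidx' : N.index = 1 ∨ N.index = 5 := num4 hidx (hci.trans hH3) hN11
  rcases hidx' with hi | hi
  · exact Subgroup.index_eq_one.mp hi
  exfalso
  rw [hi, hH3] at hci
  have hNc : Nat.card N = 1584 := Nat.eq_of_mul_eq_mul_right (by norm_num : 0 < 5) (hci.trans (by norm_num))
  obtain ⟨d, hd⟩ := exists_prime_orderOf_dvd_card' (G := N) 11 hN11
  obtain ⟨R⟩ : Nonempty (Sylow 11 N) := inferInstance
  obtain ⟨hR, hRc, m', n', hm1, hRN, hN', hn'⟩ := syl11 (X := X) (H := N) hX hN11 (by rw [hNc]; norm_num) R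
  have hm3 : m' = 1 := num2 hm1 (hNc.symm.trans hN') hn'
  subst hm3
  have hRe : (R : Subgroup N) = Subgroup.normalizer (R : Set N) :=
    Subgroup.eq_of_le_of_card_ge R.le_normalizer (by rw [hRN, mul_one]; exact hR.ge)
  have hRcyc : IsCyclic R := isCyclic_of_prime_card hR
  have hle2 : Subgroup.normalizer (R : Set N) ≤ Subgroup.centralizer (R : Set N) := by
    rw [← hRe]
    exact Subgroup.le_centralizer (R : Subgroup N)
  have hcomp := MonoidHom.ker_transferSylow_isComplement' R hle2
  have hcc := hcomp.card_mul_card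
  have hMn : (MonoidHom.transferSylow R hle2).ker.Normal := inferInstance
  generalize (MonoidHom.transferSylow R hle2).ker = M at hcc hMn
  have hM144 : Nat.card M = 144 := by
    refine Nat.eq_of_mul_eq_mul_right (by norm_num : 0 < 11) ?_
    rw [← hR, hcc, hNc, hR]
  have hMb : M ≠ ⊥ := by
    rintro rfl
    rw [Subgroup.card_bot] at hM144
    norm_num at hM144
  have hlast := (normal11 (X := X) (H := N) hX d hd M hMb).2
  rw [hM144] at hlast
  norm_num at hlast

end grp
end M11

namespace M11
section red

def lder : List ℤ → List ℤ
  | [] => []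
  | _ :: l => ladd l (0 :: lder l)

theorem derivative_lpol {R : Type*} [CommRing R] (l : List ℤ) :
    Polynomial.derivative (lpol R l) = lpol R (lder l) := by
  induction l with
  | nil => simp [lpol, lder]
  | cons a l ih =>
    simp only [lpol, lder, ev_cons, ev_ladd] at *
    simp [ih]

theorem map_lpol {R S : Type*} [CommRing R] [CommRing S] (φ : R →+* S) (l : List ℤ) :
    (lpol R l).map φ = lpol S l := by
  have := map_ev (Polynomial.X : Polynomial R) (Polynomial.mapRingHom φ) l
  simpa [lpol] using this

theorem red_inj {O κ : Type*} [CommRing O] [IsDomain O] [Field κ] (φ : O →+* κ) (l : List ℤ)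
    (a b : O) (ha : ev a l = 0) (hb : ev b l = 0) (hab : φ a = φ b)
    (hd : ev (φ a) (lder l) ≠ 0) : a = b := by
  by_contra hne
  rw [← eval_lpol] at ha hb
  obtain ⟨h, hh⟩ := Polynomial.dvd_iff_isRoot.mpr ha
  have h1 : h.eval b = 0 := by
    rw [hh, Polynomial.eval_mul] at hb
    rcases mul_eq_zero.mp hb with h | h
    · simp at h
      exact absurd (sub_eq_zero.mp h).symm hne
    · exact h
  apply hd
  rw [← eval_lpol, ← derivative_lpol, ← map_lpol φ, hh]
  have : (h.map φ).eval (φ a) = 0 := by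
    rw [hab, Polynomial.eval_map_apply, h1, map_zero]
  simp [this]

theorem exists_red (F : Type*) [Field F] [CharZero F] (p : ℕ) (hp : p.Prime) :
    ∃ Q : Ideal (integralClosure ℤ F), Q.IsMaximal ∧ (p : integralClosure ℤ F) ∈ Q := by
  have h : Ideal.span {(p : integralClosure ℤ F)} ≠ ⊤ := by
    rw [Ne, Ideal.span_singleton_eq_top]
    intro hu
    obtain ⟨u, hu⟩ := isUnit_iff_exists_inv.mp hu
    have hu' : (p : F) * (u : F) = 1 := by
      have := congrArg Subtype.val hu
      simpa using this
    have hi : IsIntegral ℤ (u : F) := u.2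
    have hpz : (p : ℚ) ≠ 0 := by exact_mod_cast hp.ne_zero
    have hpF : (p : F) ≠ 0 := by exact_mod_cast hp.ne_zero
    have e : (u : F) = algebraMap ℚ F (1 / p) := by
      rw [map_div₀, map_one, map_natCast]; field_simp; rw [mul_comm]; exact hu'
    rw [e] at hi
    have hi2 : IsIntegral ℤ (1 / p : ℚ) := by
      rwa [isIntegral_algebraMap_iff (algebraMap ℚ F).injective] at hi
    obtain ⟨n, hn⟩ := IsIntegrallyClosed.isIntegral_iff.mp hi2
    have : (n * p : ℚ) = 1 := by
      have hn : (n : ℚ) = 1 / p := hn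
      rw [hn]; field_simp
    have h2 : n * (p : ℤ) = 1 := by exact_mod_cast this
    have := Int.isUnit_iff.mp (IsUnit.of_mul_eq_one n (by rw [mul_comm]; exact h2) : IsUnit (p : ℤ))
    have := hp.two_le
    omega
  obtain ⟨Q, hQ, hle⟩ := Ideal.exists_le_maximal _ h
  exact ⟨Q, hQ, hle (Ideal.mem_span_singleton_self _)⟩

theorem exists_red' (F : Type) [Field F] [CharZero F] (p : ℕ) (hp : p.Prime) :
    ∃ (κ : Type) (_ : Field κ) (_ : integralClosure ℤ F →+* κ), CharP κ p := by
  obtain ⟨Q, hQ, hpQ⟩ := exists_red F p hp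
  refine ⟨integralClosure ℤ F ⧸ Q, Ideal.Quotient.field Q, Ideal.Quotient.mk Q, ?_⟩
  have : Fact p.Prime := ⟨hp⟩
  let _ := Ideal.Quotient.field Q
  refine (CharP.charP_iff_prime_eq_zero hp).mpr ?_
  rw [← map_natCast (Ideal.Quotient.mk Q)]
  exact Ideal.Quotient.eq_zero_iff_mem.mpr hpQ

theorem exists_frob (F : Type) [Field F] [NumberField F] [IsGalois ℚ F] (p : ℕ) (hp : p.Prime) :
    ∃ (κ : Type) (_ : Field κ) (φ : integralClosure ℤ F →+* κ) (_ : CharP κ p) (σ : F ≃ₐ[ℚ] F),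
      ∀ x y : integralClosure ℤ F, (y : F) = σ x → φ y = φ x ^ p := by
  obtain ⟨Q, hQ, hpQ⟩ := exists_red F p hp
  have i1 : Module.Free ℤ (integralClosure ℤ F) :=
    inferInstanceAs (Module.Free ℤ (NumberField.RingOfIntegers F))
  have i2 : Module.Finite ℤ (integralClosure ℤ F) :=
    inferInstanceAs (Module.Finite ℤ (NumberField.RingOfIntegers F))
  have i3 : IsFractionRing (integralClosure ℤ F) F :=
    integralClosure.isFractionRing_of_finite_extension ℚ F
  have hQp : Q.IsPrime := hQ.isPrime
  have hp0 : (p : integralClosure ℤ F) ≠ 0 := by exact_mod_cast hp.ne_zero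
  have hQb : Q ≠ ⊥ := by
    intro h
    rw [h] at hpQ
    exact hp0 hpQ
  have hfin : Finite (integralClosure ℤ F ⧸ Q) := Ideal.finiteQuotientOfFreeOfNeBot Q hQb
  let _ := IsIntegralClosure.MulSemiringAction ℤ ℚ F (integralClosure ℤ F)
  have hinv : Algebra.IsInvariant ℤ (integralClosure ℤ F) (F ≃ₐ[ℚ] F) :=
    Algebra.isInvariant_of_isGalois ℤ ℚ F (integralClosure ℤ F)
  obtain ⟨σ, hσ⟩ := IsArithFrobAt.exists_of_isInvariant ℤ (F ≃ₐ[ℚ] F) Q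
  refine ⟨integralClosure ℤ F ⧸ Q, Ideal.Quotient.field Q, Ideal.Quotient.mk Q, ?_, σ, ?_⟩
  · let _ := Ideal.Quotient.field Q
    refine (CharP.charP_iff_prime_eq_zero hp).mpr ?_
    rw [← map_natCast (Ideal.Quotient.mk Q)]
    exact Ideal.Quotient.eq_zero_iff_mem.mpr hpQ
  · intro x y hxy
    have h1 := hσ x
    have hu : Q.under ℤ = Ideal.span {(p : ℤ)} := by
      have hmax : (Ideal.span {(p : ℤ)}).IsMaximal :=
        PrincipalIdealRing.isMaximal_of_irreducible
          (Int.prime_iff_natAbs_prime.mpr (by simpa using hp)).irreducible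
      refine (hmax.eq_of_le (Ideal.IsPrime.under ℤ Q).ne_top ?_).symm
      rw [Ideal.span_singleton_le_iff_mem, Ideal.mem_comap]
      simpa using hpQ
    have hy : (MulSemiringAction.toAlgHom ℤ (integralClosure ℤ F) σ) x = y := by
      apply Subtype.ext
      rw [hxy]
      exact algebraMap_galRestrict_apply ℤ σ x
    rw [hu, Int.card_ideal_quot, hy] at h1
    have := Ideal.Quotient.eq.mpr h1
    rw [this, map_pow]

theorem card_roots_lpol (F : Type*) [Field F] (l : List ℤ) (n : ℕ) (hn : (lpol F l).natDegree = n)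
    (h0 : lpol F l ≠ 0)
    (hs : (lpol F l).Splits) (hd : ∀ x : F, ev x l = 0 → ev x (lder l) ≠ 0) :
    Nat.card {x : F // ev x l = 0} = n := by
  classical
  have hsep : (lpol F l).roots.Nodup := by
    rw [Multiset.nodup_iff_count_le_one]
    intro a
    rw [Polynomial.count_roots]
    by_contra! h
    have := (Polynomial.one_lt_rootMultiplicity_iff_isRoot h0).mp h
    rw [derivative_lpol, Polynomial.IsRoot, Polynomial.IsRoot, eval_lpol, eval_lpol] at this
    exact hd a this.1 this.2
  have : {x : F | ev x l = 0} = ((lpol F l).roots.toFinset : Set F) := by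
    ext x
    simp [h0, eval_lpol]
  show Nat.card {x : F | ev x l = 0} = n
  rw [this, Nat.card_coe_set_eq, Set.ncard_coe_finset, Multiset.toFinset_card_of_nodup hsep, ← hn]
  exact hs.natDegree_eq_card_roots.symm
end red
end M11


namespace M11
section frobs

def gL : List ℤ := [256000000000000, 268800000000000, 44160000000000, -12263936000000,
  1383590400000, -95099520000, 3963488000, -101174400, 1548720, -50812, 3975, -120, 1]
def gN : List ℤ := [-256000000000000, -268800000000000, -44160000000000, 12263936000000,
  -1383590400000, 95099520000, -3963488000, 101174400, -1548720, 50812, -3975, 120]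

theorem gN_of_gL {R : Type*} [CommRing R] {x : R} (h : ev x gL = 0) : x ^ 12 = ev x gN := by
  have : x ^ 12 - ev x gN = ev x gL := by
    simp only [gL, gN, ev_cons, ev_nil]; push_cast; ring
  rw [h] at this; exact sub_eq_zero.mp this

theorem f3_lpol : C (20 ^ 12 : ℚ) * f3 = (lpol ℚ gL).comp (C 20 * X) := by
  have h1 : (lpol ℚ gL).comp (C 20 * X) = ev (C 20 * X : ℚ[X]) gL := by
    have := map_ev (X : ℚ[X]) (Polynomial.compRingHom (C 20 * X : ℚ[X])) gL
    simpa [lpol] using this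
  rw [h1]
  have e1 : (C (1 / 16 : ℚ) : ℚ[X]) * 16 = 1 := by
    rw [show (16 : ℚ[X]) = C 16 from rfl, ← C_mul]; norm_num
  have e2 : (C (2 * 3 ^ 6 / 5 ^ 3 : ℚ) : ℚ[X]) * 125 = 1458 := by
    rw [show (125 : ℚ[X]) = C 125 from rfl, show (1458 : ℚ[X]) = C 1458 from rfl, ← C_mul]
    norm_num
  have e3 : (C (20 ^ 12 : ℚ) : ℚ[X]) = 20 ^ 12 := by rw [C_pow]; rfl
  have e4 : (C (20 : ℚ) : ℚ[X]) = 20 := rfl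
  rw [e3, e4, f3]
  generalize C (1 / 16 : ℚ) = a at *
  generalize C (2 * 3 ^ 6 / 5 ^ 3 : ℚ) = b at *
  simp only [gL, ev_cons, ev_nil]; push_cast
  linear_combination (-(X ^ 2 - X - 1) ^ 5 * 256000000000000) * e1 -
    (X ^ 3 * (X - 1) ^ 3 * (X ^ 3 - 2) * 32768000000000) * e2

theorem deg_gL (R : Type*) [CommRing R] [Nontrivial R] : (lpol R gL).natDegree = 12 := by
  apply le_antisymm (natDegree_lpol gL 12 (by decide))
  apply le_natDegree_of_ne_zero
  rw [coeff_lpol]; simp [gL]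

theorem gL_ne (R : Type*) [CommRing R] [Nontrivial R] : lpol R gL ≠ 0 := by
  intro h
  have := deg_gL R
  rw [h] at this; simp at this

theorem monic_gL (R : Type*) [CommRing R] [Nontrivial R] : (lpol R gL).Monic := by
  rw [Monic, leadingCoeff, deg_gL, coeff_lpol]; simp [gL]

theorem integral_gL {R : Type*} [CommRing R] {y : R} (h : ev y gL = 0) : IsIntegral ℤ y := by
  refine ⟨lpol ℤ gL, monic_gL ℤ, ?_⟩
  rw [eval₂_eq_eval_map, map_lpol, eval_lpol, h]

theorem deriv_ne {p : ℕ} {F : Type*} [Field F] [CharP F p] {y : F} (h : ev y gL = 0) (v : List ℤ)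
    (hv : lmm p 12 gN (lder gL) v = [1, 0, 0, 0, 0, 0, 0, 0, 0, 0, 0, 0]) :
    ev y (lder gL) ≠ 0 := by
  intro h0
  have h1 := ev_lmm y (p := p) (by simp) (by norm_num : 12 ≠ 0) (gN_of_gL h) (lder gL) v
  rw [hv, h0] at h1
  simp at h1

abbrev YY (E : Type*) [Field E] := {y : E // ev y gL = 0}

theorem ev_apply {E : Type*} [Field E] [Algebra ℚ E] (σ : E ≃ₐ[ℚ] E) (y : E) (l : List ℤ) :
    σ (ev y l) = ev (σ y) l := map_ev y (σ : E →+* E) l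

instance actY (E : Type*) [Field E] [Algebra ℚ E] : MulAction (E ≃ₐ[ℚ] E) (YY E) where
  smul σ y := ⟨σ y.1, by rw [← ev_apply, y.2, map_zero]⟩
  one_smul _ := rfl
  mul_smul _ _ _ := rfl

theorem coe_act {E : Type*} [Field E] [Algebra ℚ E] (σ : E ≃ₐ[ℚ] E) (y : YY E) :
    (σ • y).1 = σ y.1 := rfl

theorem v7 : lmm (7 : ℕ) 12 gN (lder gL) [0,2,0,1,1,0,2,1,3,2,2,3] =
    [1, 0, 0, 0, 0, 0, 0, 0, 0, 0, 0, 0] := by decide +kernel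
theorem v11 : lmm (11 : ℕ) 12 gN (lder gL) [3,9,4,8,7,3,5,10,7,10,8,9] =
    [1, 0, 0, 0, 0, 0, 0, 0, 0, 0, 0, 0] := by decide +kernel
theorem v13 : lmm (13 : ℕ) 12 gN (lder gL) [5,3,2,0,7,9,5,10,2,2,5,7] =
    [1, 0, 0, 0, 0, 0, 0, 0, 0, 0, 0, 0] := by decide +kernel
theorem v23 : lmm (23 : ℕ) 12 gN (lder gL) [4,0,13,16,4,16,6,7,20,12,9,10] =
    [1, 0, 0, 0, 0, 0, 0, 0, 0, 0, 0, 0] := by decide +kernel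
theorem v18671 : lmm (18671 : ℕ) 12 gN (lder gL)
    [858,12056,14299,15995,12179,3966,14406,7124,15680,2748,8488,3939] =
    [1, 0, 0, 0, 0, 0, 0, 0, 0, 0, 0, 0] := by decide +kernel

theorem deriv_ne0 {E : Type} [Field E] [CharZero E] {y : E} (h : ev y gL = 0) :
    ev y (lder gL) ≠ 0 := by
  obtain ⟨κ, _, φ, _⟩ := exists_red' E 7 (by norm_num)
  intro h0
  let Y : integralClosure ℤ E := ⟨y, integral_gL h⟩
  have hY (l) : ((ev Y l : integralClosure ℤ E) : E) = ev y l :=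
    map_ev Y (algebraMap (integralClosure ℤ E) E) l
  have e1 : ev Y gL = 0 := Subtype.ext (by rw [hY, h]; rfl)
  have e2 : ev Y (lder gL) = 0 := Subtype.ext (by rw [hY, h0]; rfl)
  refine deriv_ne (p := 7) (y := φ Y) (by rw [← map_ev, e1, map_zero]) _ v7 ?_
  rw [← map_ev, e2, map_zero]

theorem cardY {E : Type} [Field E] [CharZero E] (hs : (lpol E gL).Splits) :
    Nat.card (YY E) = 12 :=
  card_roots_lpol E gL 12 (deg_gL E) (gL_ne E) hs (fun _ h => deriv_ne0 h)

theorem frobY (E : Type) [Field E] [NumberField E] [IsGalois ℚ E] (p : ℕ) (hp : p.Prime)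
    (v : List ℤ) (hv : lmm p 12 gN (lder gL) v = [1, 0, 0, 0, 0, 0, 0, 0, 0, 0, 0, 0]) :
    ∃ (κ : Type) (_ : Field κ) (_ : CharP κ p) (r : YY E → κ) (σ : E ≃ₐ[ℚ] E),
      Function.Injective r ∧ (∀ y, ev (r y) gL = 0) ∧ ∀ y, r (σ • y) = r y ^ p := by
  obtain ⟨κ, _, φ, _, σ, hσ⟩ := exists_frob E p hp
  let L (y : YY E) : integralClosure ℤ E := ⟨y.1, integral_gL y.2⟩
  have hL (y) : ev (L y) gL = 0 := Subtype.ext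
    ((map_ev (L y) (algebraMap (integralClosure ℤ E) E) gL).trans y.2)
  have hL' (y) : ev (φ (L y)) gL = 0 := by rw [← map_ev, hL, map_zero]
  refine ⟨κ, _, inferInstance, fun y => φ (L y), σ, ?_, hL', fun y => hσ _ _ rfl⟩
  intro a b hab
  have := red_inj φ gL (L a) (L b) (hL a) (hL b) hab (deriv_ne (p := p) (hL' a) v hv)
  exact Subtype.ext (congrArg (fun z : integralClosure ℤ E => (z : E)) this)

end frobs
end M11

namespace M11
section orders

theorem castp {κ : Type*} [Field κ] (p : ℕ) [CharP κ p] : (((p : ℕ) : ℤ) : κ) = 0 := by simp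

variable {E κ : Type} [Field E] [Algebra ℚ E] [Field κ] {p : ℕ} [CharP κ p]
  {r : YY E → κ} {σ : E ≃ₐ[ℚ] E}

theorem frob_pow (hσ : ∀ y, r (σ • y) = r y ^ p) (k : ℕ) (y : YY E) :
    r ((σ ^ k) • y) = r y ^ (p ^ k) := by
  induction k generalizing y with
  | zero => simp
  | succ k ih => rw [pow_succ, mul_smul, ih, hσ, ← pow_mul, pow_succ, mul_comm]

theorem frob_list (hg : ∀ y, ev (r y) gL = 0) (hσ : ∀ y, r (σ • y) = r y ^ p) (k f : ℕ)
    (hf : p ^ k < 2 ^ f) (y : YY E) (l : List ℤ)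
    (hl : lpow p 12 (lmod p gN) [0, 1] f (p ^ k) = l) : r ((σ ^ k) • y) = ev (r y) l := by
  have h12 : r y ^ 12 = ev (r y) (lmod p gN) := by
    rw [ev_lmod _ (by simp), gN_of_gL (hg y)]
  rw [frob_pow hσ, ← hl, ev_lpow (r y) (by simp) (by norm_num) h12 _ _ _ hf]
  simp

theorem frob_one (hE : ∀ τ : E ≃ₐ[ℚ] E, (∀ y : YY E, τ • y = y) → τ = 1)
    (hr : Function.Injective r) (hg : ∀ y, ev (r y) gL = 0) (hσ : ∀ y, r (σ • y) = r y ^ p)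
    (k f : ℕ) (hf : p ^ k < 2 ^ f)
    (hl : lpow p 12 (lmod p gN) [0, 1] f (p ^ k) = [0, 1, 0, 0, 0, 0, 0, 0, 0, 0, 0, 0]) :
    σ ^ k = 1 := by
  apply hE
  intro y
  apply hr
  rw [frob_list hg hσ k f hf y _ hl]; simp

theorem frob_ne (hc : Nat.card (YY E) = 12) (hr : Function.Injective r)
    (hg : ∀ y, ev (r y) gL = 0) (hσ : ∀ y, r (σ • y) = r y ^ p)
    (k f : ℕ) (hf : p ^ k < 2 ^ f) (l : List ℤ)
    (hl : lpow p 12 (lmod p gN) [0, 1] f (p ^ k) = l)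
    (hlen : (ladd l [0, -1]).length ≤ 12) (i : ℕ)
    (hi : ¬ ((p : ℤ) ∣ (ladd l [0, -1]).getD i 0)) :
    σ ^ k ≠ 1 := by
  intro h1
  apply hi
  have : Finite (YY E) := Nat.finite_of_card_ne_zero (by omega)
  rw [← CharP.intCast_eq_zero_iff κ p]
  apply ev_many r hr
  · omega
  · intro y
    have := frob_list hg hσ k f hf y _ hl
    rw [h1, one_smul] at this
    rw [ev_ladd, ← this]; simp
end orders

section elems
variable (E : Type) [Field E] [NumberField E] [IsGalois ℚ E]
    (hE : ∀ τ : E ≃ₐ[ℚ] E, (∀ y : YY E, τ • y = y) → τ = 1)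
    (hc : Nat.card (YY E) = 12)
include hE hc

theorem el23 : ∃ σ : E ≃ₐ[ℚ] E, orderOf σ = 11 := by
  obtain ⟨κ, _, _, r, σ, hr, hg, hσ⟩ := frobY E 23 (by norm_num) _ v23
  refine ⟨σ, orderOf_eq_prime (hp := ⟨by norm_num⟩) ?_ ?_⟩
  · exact frob_one hE hr hg hσ 11 60 (by norm_num) (by decide +kernel)
  · rw [← pow_one σ]
    exact frob_ne hc hr hg hσ 1 10 (by norm_num) _ (by decide +kernel :
      lpow (23 : ℕ) 12 (lmod (23 : ℕ) gN) [0, 1] 10 (23 ^ 1) = [13,11,22,6,7,20,13,11,8,19,14,21])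
      (by decide) 0 (by decide)

theorem el11 : ∃ σ : E ≃ₐ[ℚ] E, orderOf σ = 5 := by
  obtain ⟨κ, _, _, r, σ, hr, hg, hσ⟩ := frobY E 11 (by norm_num) _ v11
  refine ⟨σ, orderOf_eq_prime (hp := ⟨by norm_num⟩) ?_ ?_⟩
  · exact frob_one hE hr hg hσ 5 30 (by norm_num) (by decide +kernel)
  · rw [← pow_one σ]
    exact frob_ne hc hr hg hσ 1 10 (by norm_num) _ (by decide +kernel :
      lpow (11 : ℕ) 12 (lmod (11 : ℕ) gN) [0, 1] 10 (11 ^ 1) = [0,0,0,0,0,0,0,0,0,0,0,1])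
      (by decide) 11 (by decide)

theorem el7 : ∃ σ : E ≃ₐ[ℚ] E, orderOf σ = 8 ∧ ∀ y : YY E, σ • y ≠ y := by
  obtain ⟨κ, _, _, r, σ, hr, hg, hσ⟩ := frobY E 7 (by norm_num) _ v7
  refine ⟨σ, ?_, ?_⟩
  · have := orderOf_eq_prime_pow (x := σ) (p := 2) (n := 2) (hp := ⟨by norm_num⟩)
      (frob_ne hc hr hg hσ 4 20 (by norm_num) _ (by decide +kernel :
      lpow (7 : ℕ) 12 (lmod (7 : ℕ) gN) [0, 1] 20 (7 ^ 4) = [1,5,3,4,6,4,3,1,5,6,1,2])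
      (by decide) 0 (by decide))
      (frob_one hE hr hg hσ 8 30 (by norm_num) (by decide +kernel))
    simpa using this
  · intro y hy
    have h := hσ y
    rw [hy] at h
    have h1 := ev_lmm (r y) (p := (7 : ℕ)) (castp 7) (by norm_num : 12 ≠ 0) (gN_of_gL (hg y))
      [0, -1, 0, 0, 0, 0, 0, 1] [1,5,3,0,5,1,4,5,0,2,2,2]
    have h2 : lmm (7 : ℕ) 12 gN [0, -1, 0, 0, 0, 0, 0, 1] [1,5,3,0,5,1,4,5,0,2,2,2] =
      [1, 0, 0, 0, 0, 0, 0, 0, 0, 0, 0, 0] := by decide +kernel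
    have h3 : ev (r y) [0, -1, 0, 0, 0, 0, 0, 1] = 0 := by
      simp only [ev_cons, ev_nil]; push_cast; linear_combination -h
    rw [h2, h3] at h1
    simp at h1

theorem el13 : ∃ (σ : E ≃ₐ[ℚ] E) (x y : YY E), orderOf σ = 3 ∧ x ≠ y ∧ σ • x = x ∧ σ • y = y := by
  obtain ⟨κ, _, _, r, σ, hr, hg, hσ⟩ := frobY E 13 (by norm_num) _ v13
  have : Finite (YY E) := Nat.finite_of_card_ne_zero (by omega)
  have hz := castp (κ := κ) 13
  have l2 : lpow (13 : ℕ) 12 (lmod (13 : ℕ) gN) [0, 1] 20 (13 ^ 2) = 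
    [1,12,7,7,7,4,9,8,2,0,0,9] := by decide +kernel
  have e2 (y : YY E) := frob_list hg hσ 2 20 (by norm_num) y _ l2
  have hfix (y : YY E) (h : ev (r y) [5,12,2,1] = 0) : (σ ^ 2) • y = y := by
    apply hr
    rw [e2 y]
    have h1 : ladd [1,12,7,7,7,4,9,8,2,0,0,9] [0, -1] = [1,11,7,7,7,4,9,8,2,0,0,9] := by decide
    have h2 : lmod (13 : ℕ) (lmul [5,12,2,1] [8,9,0,4,3,5,6,8,9]) = [1,11,7,7,7,4,9,8,2,0,0,9] := by
      decide +kernel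
    have h3 := ev_ladd (r y) [1,12,7,7,7,4,9,8,2,0,0,9] [0, -1]
    rw [h1, ← h2, ev_lmod _ hz, ev_lmul, h] at h3
    have h4 : ev (r y) [0, -1] = - r y := by simp
    rw [h4] at h3
    linear_combination -h3
  have hw (y : YY E) (h : ev (r y) [5,12,2,1] ≠ 0) : ev (r y) [7,12,5,6,0,1,5,8,8,1] = 0 := by
    have h2 : lmod (13 : ℕ) (lmul [5,12,2,1] [7,12,5,6,0,1,5,8,8,1]) = lmod (13 : ℕ) gL := by
      decide +kernel
    have h3 := ev_lmul (r y) [5,12,2,1] [7,12,5,6,0,1,5,8,8,1]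
    rw [← ev_lmod (p := (13 : ℕ)) _ hz, h2, ev_lmod _ hz, hg] at h3
    exact (mul_eq_zero.mp h3.symm).resolve_left h
  have key (x : YY E) : ∃ y, y ≠ x ∧ ev (r y) [5,12,2,1] = 0 := by
    by_contra! hcon
    let S := {y : YY E // y ≠ x}
    have hS : Nat.card S = 11 := by
      have := Fintype.ofFinite (YY E)
      classical
      rw [Nat.card_eq_fintype_card] at hc ⊢
      rw [Fintype.card_subtype_compl, hc]; simp
    have := ev_many (fun s : S => r s.1) (fun a b h => Subtype.ext (hr h)) 
      [7,12,5,6,0,1,5,8,8,1] (by rw [hS]; decide) (fun s => hw s.1 (hcon s.1 s.2)) 9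
    simp at this
  obtain ⟨x0⟩ : Nonempty (YY E) := (Nat.card_pos_iff.mp (by omega)).1
  obtain ⟨x, -, hx⟩ := key x0
  obtain ⟨y, hyx, hy⟩ := key x
  refine ⟨σ ^ 2, x, y, orderOf_eq_prime (hp := ⟨by norm_num⟩) ?_ ?_, hyx.symm, hfix x hx, hfix y hy⟩
  · rw [← pow_mul]
    exact frob_one hE hr hg hσ 6 40 (by norm_num) (by decide +kernel)
  · exact frob_ne hc hr hg hσ 2 20 (by norm_num) _ l2 (by decide) 0 (by decide)

theorem trans_of : MulAction.IsPretransitive (E ≃ₐ[ℚ] E) (YY E) := by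
  obtain ⟨c, h11⟩ := el23 E hE hc
  obtain ⟨s, -, hs⟩ := el7 E hE hc
  have : Finite (YY E) := Nat.finite_of_card_ne_zero (by omega)
  have : FaithfulSMul (E ≃ₐ[ℚ] E) (YY E) := ⟨by
    intro a b hab
    have := hE (a⁻¹ * b) (fun y => by rw [mul_smul, ← hab y, inv_smul_smul])
    exact inv_mul_eq_one.mp this⟩
  obtain ⟨a, ha, -, h3⟩ := act11 hc c h11
  have hb : s • a ≠ a := hs a
  have step (x : YY E) : ∃ g : E ≃ₐ[ℚ] E, g • a = x := by
    by_cases hx : x = a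
    · exact ⟨1, by simp [hx]⟩
    · obtain ⟨k, hk⟩ := h3 (s • a) x hb hx
      exact ⟨c ^ k * s, by rw [mul_smul, hk]⟩
  refine ⟨fun x y => ?_⟩
  obtain ⟨g, rfl⟩ := step x
  obtain ⟨h, rfl⟩ := step y
  exact ⟨h * g⁻¹, by rw [mul_smul, inv_smul_smul]⟩

theorem group_of (hle : Nat.card (E ≃ₐ[ℚ] E) ≤ 7920) :
    Nat.card (E ≃ₐ[ℚ] E) = 7920 ∧ IsSimpleGroup (E ≃ₐ[ℚ] E) := by
  have := trans_of E hE hc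
  have : Finite (YY E) := Nat.finite_of_card_ne_zero (by omega)
  have : FaithfulSMul (E ≃ₐ[ℚ] E) (YY E) := ⟨by
    intro a b hab
    have := hE (a⁻¹ * b) (fun y => by rw [mul_smul, ← hab y, inv_smul_smul])
    exact inv_mul_eq_one.mp this⟩
  obtain ⟨c, h11⟩ := el23 E hE hc
  obtain ⟨s, hs, -⟩ := el7 E hE hc
  obtain ⟨s5, hs5⟩ := el11 E hE hc
  obtain ⟨t, x, y, ht, hxy, hx, hy⟩ := el13 E hE hc
  exact m11_abstract hc hle c h11 (hs5 ▸ orderOf_dvd_natCard s5) (hs ▸ orderOf_dvd_natCard s)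
    t ht x y hxy hx hy
end elems
end M11

namespace M11
section split

theorem aeval_f3 {E : Type*} [Field E] [Algebra ℚ E] (x : E) :
    (20 ^ 12 : E) * aeval x f3 = ev (20 * x) gL := by
  have h := congrArg (aeval x) f3_lpol
  rw [map_mul, aeval_C, aeval_comp] at h
  have h2 : (algebraMap ℚ E) (20 ^ 12) = 20 ^ 12 := by
    rw [map_pow]; norm_num
  have h3 : aeval x (C (20 : ℚ) * X) = 20 * x := by
    rw [map_mul, aeval_C, aeval_X, map_ofNat]
  rw [h2, h3] at h
  rw [h, aeval_def, eval₂_eq_eval_map, map_lpol, eval_lpol]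

theorem ev_iff {E : Type*} [Field E] [Algebra ℚ E] (x : E) :
    aeval x f3 = 0 ↔ ev (20 * x) gL = 0 := by
  have : CharZero E := algebraRat.charZero E
  rw [← aeval_f3]; simp

theorem f3_deg : f3.natDegree = 12 := by
  have h := congrArg natDegree f3_lpol
  rw [natDegree_C_mul (by norm_num), natDegree_comp, deg_gL, natDegree_C_mul_X _ (by norm_num)] at h
  simpa using h

theorem f3_ne : f3 ≠ 0 := by
  intro h; have := f3_deg; rw [h] at this; simp at this

theorem gL_splits : (lpol f3.SplittingField gL).Splits := by
  rw [splits_iff_comp_splits_of_natDegree_eq_one (g := C 20 * X)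
    (natDegree_C_mul_X _ (by norm_num))]
  have h := congrArg (Polynomial.map (algebraMap ℚ f3.SplittingField)) f3_lpol
  rw [Polynomial.map_comp, map_lpol, Polynomial.map_mul, Polynomial.map_mul, map_C, map_C, map_X,
    map_ofNat] at h
  rw [← h]
  exact (Splits.C _).mul (SplittingField.splits f3)

theorem f3_faithful (τ : f3.SplittingField ≃ₐ[ℚ] f3.SplittingField)
    (h : ∀ y : YY f3.SplittingField, τ • y = y) : τ = 1 := by
  apply Gal.ext (p := f3)
  intro x hx
  have hx' := (mem_rootSet.mp hx).2
  have h1 := congrArg Subtype.val (h ⟨20 * x, (ev_iff x).mp hx'⟩)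
  rw [coe_act] at h1
  change τ (20 * x) = 20 * x at h1
  rw [map_mul, map_ofNat] at h1
  exact mul_left_cancel₀ (by norm_num) h1

instance : NumberField f3.SplittingField where

theorem card_Y : Nat.card (YY f3.SplittingField) = 12 := cardY gL_splits

instance : IsGalois ℚ f3.SplittingField where
  to_normal := Normal.of_isSplittingField
    (hFEp := Polynomial.IsSplittingField.splittingField f3) f3

theorem f3_irred : Irreducible f3 := by
  have ht := trans_of f3.SplittingField f3_faithful card_Y
  have hf : Finite (YY f3.SplittingField) := Nat.finite_of_card_ne_zero (by rw [card_Y]; norm_num)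
  have := Fintype.ofFinite (YY f3.SplittingField)
  obtain ⟨y⟩ : Nonempty (YY f3.SplittingField) := 
    (Nat.card_pos_iff.mp (by rw [card_Y]; norm_num)).1
  set x := y.1 / 20 with hx
  have h20 : (20 : f3.SplittingField) ≠ 0 := by norm_num
  have hxy : 20 * x = y.1 := by rw [hx]; field_simp
  have h0 : aeval x f3 = 0 := by rw [ev_iff, hxy, y.2]
  have hi : IsIntegral ℚ x := Algebra.IsIntegral.isIntegral x
  have hm := minpoly.irreducible hi
  have hdeg : 12 ≤ (minpoly ℚ x).natDegree := by
    by_contra! hlt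
    have hz : (minpoly ℚ x).map (algebraMap ℚ f3.SplittingField) = 0 := by
      apply eq_zero_of_natDegree_lt_card_of_eval_eq_zero _
        (f := fun z : YY f3.SplittingField => z.1 / 20)
      · intro a b hab
        apply Subtype.ext
        field_simp at hab; exact hab
      · intro z
        obtain ⟨σ, rfl⟩ := ht.exists_smul_eq y z
        have : (σ • y).1 / 20 = σ x := by
          rw [coe_act, hx, map_div₀, map_ofNat]
        rw [this, eval_map_algebraMap, show aeval (σ x) (minpoly ℚ x) = σ (aeval x (minpoly ℚ x)) from
          aeval_algHom_apply σ.toAlgHom x _]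
        rw [minpoly.aeval, map_zero]
      · rw [natDegree_map, ← Nat.card_eq_fintype_card, card_Y]; exact hlt
    exact (minpoly.monic hi).ne_zero ((Polynomial.map_eq_zero _).mp hz)
  obtain ⟨q, hq⟩ := minpoly.dvd ℚ x h0
  have hq0 : q ≠ 0 := by rintro rfl; exact f3_ne (by rw [hq, mul_zero])
  have h2 := congrArg natDegree hq
  rw [f3_deg, natDegree_mul hm.ne_zero hq0] at h2
  have h3 : IsUnit q := by
    rw [isUnit_iff_degree_eq_zero, degree_eq_natDegree hq0]
    norm_cast; omega
  rw [hq]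
  exact (irreducible_mul_isUnit h3).mpr hm
end split
end M11
namespace M11
theorem f3_group (h : Nat.card f3.Gal ≤ 7920) : Nat.card f3.Gal = 7920 ∧ IsSimpleGroup f3.Gal :=
  group_of f3.SplittingField f3_faithful card_Y h
end M11

namespace M11
section comb

def msk : List ℕ := [2047, 211, 1306, 1557, 1736, 333, 188, 880, 902, 1126, 1441, 555]
def eb (i : Fin 11) (j : Fin 12) : Bool := (msk.getD j 0).testBit i
def EE (i : Fin 11) (j k : Fin 12) : Bool := eb i j == eb i k

def SS : Set (Equiv.Perm (Fin 12)) :=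
  {π | ∃ ρ : Equiv.Perm (Fin 11), ∀ i j k, EE (ρ i) (π j) (π k) = EE i j k}

def cnt (a b c k : Fin 12) (v : Bool × Bool × Bool × Bool) : ℕ :=
  (Finset.univ.filter (fun i : Fin 11 => (EE i 0 a, EE i 0 b, EE i 0 c, EE i 0 k) = v)).card

theorem cnt_inv {π : Equiv.Perm (Fin 12)} (h : π ∈ SS) {a b c : Fin 12} (h0 : π 0 = 0)
    (ha : π a = a) (hb : π b = b) (hc : π c = c) (k : Fin 12) (v : Bool × Bool × Bool × Bool) :
    cnt a b c (π k) v = cnt a b c k v := by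
  obtain ⟨ρ, hρ⟩ := h
  unfold cnt
  symm
  apply Finset.card_bijective ρ ρ.bijective
  intro i
  have h1 := hρ i 0 a
  have h2 := hρ i 0 b
  have h3 := hρ i 0 c
  have h4 := hρ i 0 k
  rw [h0] at h1 h2 h3 h4
  rw [ha] at h1; rw [hb] at h2; rw [hc] at h3
  simp [h1, h2, h3, h4]

theorem rig1 : ∀ k k' : Fin 12, (∀ v, cnt 1 2 3 k v = cnt 1 2 3 k' v) →
    k = k' ∨ (k = 6 ∧ k' = 7) ∨ (k = 7 ∧ k' = 6) := by decide +kernel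

theorem rig2 : ∃ v, cnt 1 2 4 6 v ≠ cnt 1 2 4 7 v := by decide +kernel

theorem rigid {π : Equiv.Perm (Fin 12)} (h : π ∈ SS) (h0 : π 0 = 0) (h1 : π 1 = 1) (h2 : π 2 = 2)
    (h3 : π 3 = 3) : π = 1 := by
  have key (k) := rig1 (π k) k (cnt_inv h h0 h1 h2 h3 k)
  have h4 : π 4 = 4 := by
    have := key 4
    simpa using this
  obtain ⟨v, hv⟩ := rig2
  ext1 k
  rw [Equiv.Perm.one_apply]
  have h5 := cnt_inv h h0 h1 h2 h4 k v
  rcases key k with hk | ⟨a, b⟩ | ⟨a, b⟩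
  · exact hk
  · rw [a, b] at h5; exact absurd h5 hv
  · rw [a, b] at h5; exact absurd h5.symm hv

def cd (a b c d : ℕ) : ℕ :=
  bif a == b || (a == c || (a == d || (b == c || (b == d || (c == d ||
    ((a ^^^ b) ||| (a ^^^ c) ||| (a ^^^ d)) == 2047))))) then 0 else 1

def sm (f : ℕ → ℕ) : List ℕ → ℕ
  | [] => 0
  | a :: l => f a + sm f l

theorem sm_card : sm (fun a => sm (fun b => sm (fun c => sm (fun d => cd a b c d) msk) msk) msk) msk
    = 7920 := by decide +kernel

def mk (j : Fin 12) : ℕ := msk.getD j 0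

theorem sum_sm (f : ℕ → ℕ) : ∑ j, f (mk j) = sm f msk := by
  simp [Fin.sum_univ_succ, mk, msk, sm]

theorem mk_inj : ∀ a b, mk a = mk b → a = b := by decide +kernel

def TT : Finset (Fin 12 × Fin 12 × Fin 12 × Fin 12) :=
  Finset.univ.filter fun t => cd (mk t.1) (mk t.2.1) (mk t.2.2.1) (mk t.2.2.2) = 1

theorem cd_01 (a b c d : ℕ) : cd a b c d = if cd a b c d = 1 then 1 else 0 := by
  unfold cd
  generalize (_ || _ : Bool) = t
  cases t <;> simp

theorem TT_card : TT.card = 7920 := by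
  rw [TT, Finset.card_filter, ← sm_card]
  simp only [Fintype.sum_prod_type, ← cd_01]
  exact (Finset.sum_congr rfl fun a _ => (Finset.sum_congr rfl fun b _ =>
    (Finset.sum_congr rfl fun c _ => sum_sm (fun d => cd (mk a) (mk b) (mk c) d)).trans
      (sum_sm (fun c => sm (fun d => cd (mk a) (mk b) c d) msk))).trans
      (sum_sm (fun b => sm (fun c => sm (fun d => cd (mk a) b c d) msk) msk))).trans
      (sum_sm (fun a => sm (fun b => sm (fun c => sm (fun d => cd a b c d) msk) msk) msk))

theorem row0 : ∃ i, EE i 0 1 ∧ EE i 0 2 ∧ EE i 0 3 := by decide +kernel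

theorem full : ∀ i : Fin 11, (2047 : ℕ).testBit i = true := by decide +kernel

theorem mem_TT {a b c d : Fin 12} (h1 : a ≠ b) (h2 : a ≠ c) (h3 : a ≠ d) (h4 : b ≠ c) (h5 : b ≠ d)
    (h6 : c ≠ d) (i : Fin 11) (e1 : EE i a b) (e2 : EE i a c) (e3 : EE i a d) :
    (a, b, c, d) ∈ TT := by
  have g1 := mt (mk_inj a b) h1
  have g2 := mt (mk_inj a c) h2
  have g3 := mt (mk_inj a d) h3
  have g4 := mt (mk_inj b c) h4
  have g5 := mt (mk_inj b d) h5
  have g6 := mt (mk_inj c d) h6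
  have g7 : ((mk a ^^^ mk b) ||| (mk a ^^^ mk c) ||| (mk a ^^^ mk d)) ≠ 2047 := by
    intro h
    have := full i
    rw [← h] at this
    simp only [EE, eb, beq_iff_eq] at e1 e2 e3
    rw [Nat.testBit_or, Nat.testBit_or, Nat.testBit_xor, Nat.testBit_xor, Nat.testBit_xor] at this
    simp only [mk] at this
    rw [← e1, ← e2, ← e3] at this
    simp at this
  rw [TT, Finset.mem_filter]
  refine ⟨Finset.mem_univ _, ?_⟩
  unfold cd
  simp only [beq_eq_false_iff_ne.mpr g1, beq_eq_false_iff_ne.mpr g2, beq_eq_false_iff_ne.mpr g3,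
    beq_eq_false_iff_ne.mpr g4, beq_eq_false_iff_ne.mpr g5, beq_eq_false_iff_ne.mpr g6,
    beq_eq_false_iff_ne.mpr g7]
  rfl

theorem SS_bound (G : Type*) (f : G → Equiv.Perm (Fin 12)) (hf : Function.Injective f)
    (hS : ∀ g, f g ∈ SS) : Nat.card G ≤ 7920 := by
  let F : G → TT := fun g => ⟨(f g 0, f g 1, f g 2, f g 3), by
    obtain ⟨ρ, hρ⟩ := hS g
    obtain ⟨i, r1, r2, r3⟩ := row0
    have inj := (f g).injective
    refine mem_TT ?_ ?_ ?_ ?_ ?_ ?_ (ρ i) ?_ ?_ ?_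
    · exact fun h => absurd (inj h) (by decide)
    · exact fun h => absurd (inj h) (by decide)
    · exact fun h => absurd (inj h) (by decide)
    · exact fun h => absurd (inj h) (by decide)
    · exact fun h => absurd (inj h) (by decide)
    · exact fun h => absurd (inj h) (by decide)
    · rw [hρ]; exact r1
    · rw [hρ]; exact r2
    · rw [hρ]; exact r3⟩
  have hF : Function.Injective F := by
    intro g h hgh
    have e := congrArg Subtype.val hgh
    simp only [F, Prod.mk.injEq] at e
    obtain ⟨e0, e1, e2, e3⟩ := e
    have hmem : (f h)⁻¹ * f g ∈ SS := by
      obtain ⟨ρ, hρ⟩ := hS g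
      obtain ⟨ρ', hρ'⟩ := hS h
      refine ⟨ρ'⁻¹ * ρ, fun i j k => ?_⟩
      rw [← hρ', ← hρ i j k]
      simp [Equiv.Perm.mul_apply]
    have := rigid hmem (by rw [Equiv.Perm.mul_apply, e0]; simp)
      (by rw [Equiv.Perm.mul_apply, e1]; simp)
      (by rw [Equiv.Perm.mul_apply, e2]; simp) (by rw [Equiv.Perm.mul_apply, e3]; simp)
    exact hf (inv_mul_eq_one.mp this).symm
  have := Nat.card_le_card_of_injective F hF
  rwa [Nat.card_eq_fintype_card (α := TT), Fintype.card_coe, TT_card] at this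
end comb
end M11

namespace M11
section bound

def PL : List ℤ := [-291600, -390625, -109594, 40500, 22680, 3888, 0, -450, -108, 0, 0, 1]
def PN : List ℤ := [291600, 390625, 109594, -40500, -22680, -3888, 0, 450, 108, 0, 0]
def vP : List ℤ := [7612, 4960, 9824, 18253, 13639, 155, 1541, 1867, 10797, 5955, 6227]
def cL : List ℤ := [1610, 2011, 2905, 7858, 11357, 11790, 12921, 13607, 15425, 16173, 16533,
  18627]
def dL : List ℤ := [6006, 6484, 10401, 11212, 11239, 11804, 12358, 14056, 14276, 14724, 18137]
def NN : ℤ := 9066455096561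
def DL : List ℤ := [294930041419138500, -138583445821875, -40712745889717785,
  -2850968072953125, -467417401485525, 334560006080685, 295811441632125, -54083713221225,
  9779532117291, -3263359114125, 272189315025]
def AL : List (List ℤ) := [[5633058498470529024000, 9045758430170191609600,
  2816860426955834400000, -220147054430744160000, -140971016416145299200, -67582469762030880000,
  -12812602574312352000, 4046017766008147200, -217086284550240000, 216383923679904000,
  -25624719628038400], [-1267859190576028800000, -525946247415441360000, 17716585708914192000,
  69764921565570000000, 11316733773742800000, 1540976019269616000, -1402433158770000000,
  -310710016854000000, -4873369871664000, -454917870000000, 3045589038000000],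
  [209857279848845280000, 99007971073081614000, -11920749957721033200, -15120205298589150000,
  -2452288038104574000, -261333962013387600, 284870379598830000, 72682900765578000,
  289778802382800, 361150660530000, -691804733562000], [-11720918541139584128,
  -3397046852674641600, 1049584324916219040, 539287381753786656, 106780245327367200,
  162734103876240, -12330411896755296, -1919327144234400, -115934961160800, 26416779508512,
  19485347367600], [308529724063980000, -138583445821875, -40712745889717785, -2850968072953125,
  -467417401485525, 334560006080685, 295811441632125, -54083713221225, 9779532117291,
  -3263359114125, 272189315025], [-4351898446349280, 0, 0, 0, 0, 0, 0, 0, 0, 0, 0],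
  [72531640772488, 0, 0, 0, 0, 0, 0, 0, 0, 0, 0]]
def BL : List (List ℤ) := [[315660144591043200000000, 168600273881223456000000,
  -32153569334537529600000, -27905968626228000000000, -4526693509497120000000,
  -616390407707846400000, 560973263508000000000, 124284006741600000000, 1949347948665600000,
  181967148000000000, -1218235615200000000], [182312845326241632000000, 107546231902229020800000,
  -12674087827599381120000, -15056317954974515328000, -2992889787506409600000,
  -293228125302326400000, 249884241454532736000, 95952460055587200000, -1882986186913920000,
  1099365569831808000, -835724124028800000], [-35643357265203187200000, -17830073093081085360000,
  2889154851555971952000, 2588022077137174857600, 490322861415722160000, 41514931544032080000,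
  -48701735336764310400, -13816171993695120000, 19421144168112000, -82545628615171200,
  126309103638480000], [1969048790571921120000, 781191688655713608000, -177170889581348443200,
  -119127658532508820800, -22246873347752136000, -1245549184791508800, 2496422621508275520,
  532143448264152000, 11844392873860800, -690234339781440, -5131649418408000],
  [-56779926239025108000, -6777463691850658200, 6984698156598572280, 1420690932261948312,
  269650578832997400, -39821732521929720, -60158196789365592, 2651391298078200,
  -1405413776396520, 444436652712024, 6307976932200], [1179720165676554000, -554333783287500,
  -162850983558871140, -11403872291812500, -1869669605942100, 1338240024322740, 1183245766528500,
  -216334852884900, 39118128469164, -13053436456500, 1088757260100]]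
def aT : List (List ℤ) := [[6588, 13826, 3650, 17301, 738, 2622, 10482, 738, 2425, 712, 180,
  14359], [6036, 6970, 7399, 12515, 4369, 10827, 3107, 8004, 9561, 8145, 16644, 12187], [11411,
  1157, 6486, 11282, 11334, 9207, 1933, 7855, 11355, 12036, 749, 2547], [3971, 12094, 10654,
  8692, 11882, 12410, 4019, 10727, 1235, 9847, 2672, 7368], [2266, 4427, 4585, 1739, 8461, 10554,
  15461, 5924, 991, 8162, 9170, 16329], [16201, 14445, 5534, 10433, 4856, 8514, 12458, 5643,
  4495, 16957, 15262, 14611], [967, 12368, 13553, 7318, 18414, 4736, 192, 4520, 16833, 5250,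
  10673, 16147], [1053, 10724, 11210, 13059, 5628, 7893, 11901, 11944, 17843, 14513, 1104,
  14858], [15641, 10490, 17775, 12018, 8951, 16244, 13539, 14188, 11059, 8132, 3024, 10273],
  [9374, 3569, 13089, 16407, 11839, 13782, 17641, 17318, 5567, 12759, 9799, 2803], [12394, 7607,
  16198, 11842, 10557, 16508, 18281, 2240, 9441, 858, 2949, 505]]
def bT : List (List ℤ) := [[11454, 4993, 15862, 4726, 14021, 13333, 12282, 14021, 52, 5836,
  7965, 14575], [6918, 3794, 6717, 1599, 13014, 12665, 6554, 13098, 7042, 10059, 3975, 1737],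
  [7957, 6157, 18265, 6239, 11450, 7986, 5625, 17546, 4027, 1807, 8117, 8632], [6940, 1188, 1016,
  4383, 13036, 2270, 9356, 7757, 75, 2261, 2430, 16107], [18299, 8996, 16567, 15617, 14902,
  16119, 1697, 6163, 7463, 4059, 4208, 10360], [6041, 15335, 16377, 5311, 3365, 17996, 1264,
  5875, 18137, 2272, 16131, 4336], [3771, 5541, 7640, 12183, 17244, 18160, 4310, 18341, 9697,
  2343, 17674, 7912], [15258, 15066, 3744, 13762, 4153, 12976, 16535, 12790, 7152, 7109, 9135,
  10089], [9002, 1834, 11523, 4981, 14195, 17230, 14602, 4162, 4289, 6142, 14789, 15818], [3426,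
  4177, 17584, 2702, 4789, 11929, 6061, 4963, 3, 12275, 15010, 7920], [17293, 3934, 15689, 8632,
  9272, 1974, 3075, 16808, 16762, 6765, 12480, 6790]]
def bev {R : Type*} [CommRing R] (x γ : R) : List (List ℤ) → R
  | [] => 0
  | a :: l => ev γ a + x * bev x γ l

def badd : List (List ℤ) → List (List ℤ) → List (List ℤ)
  | [], m => m
  | a :: l, [] => a :: l
  | a :: l, b :: m => ladd a b :: badd l m

def bsc (d : List ℤ) (M : List (List ℤ)) : List (List ℤ) := M.map fun r => lred 11 PN (lmul d r)

def bmul : List (List ℤ) → List (List ℤ) → List (List ℤ)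
  | [], _ => []
  | a :: l, m => badd (bsc a m) ([] :: bmul l m)

section
variable {R : Type*} [CommRing R] (x γ : R)

theorem bev_badd (l m : List (List ℤ)) : bev x γ (badd l m) = bev x γ l + bev x γ m := by
  induction l generalizing m with
  | nil => simp [badd, bev]
  | cons a l ih =>
    cases m with
    | nil => simp [badd, bev]
    | cons b m => simp [badd, bev, ih]; ring

theorem PN_of_PL (h : ev γ PL = 0) : γ ^ 11 = ev γ PN := by
  have : γ ^ 11 - ev γ PN = ev γ PL := by
    simp only [PL, PN, ev_cons, ev_nil]; push_cast; ring
  rw [h] at this; exact sub_eq_zero.mp this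

theorem bev_bsc (h : ev γ PL = 0) (d : List ℤ) (M : List (List ℤ)) :
    bev x γ (bsc d M) = ev γ d * bev x γ M := by
  induction M with
  | nil => simp [bsc, bev]
  | cons a l ih =>
    simp only [bsc, List.map_cons, bev] at *
    rw [ih, ev_lred γ (by norm_num) (PN_of_PL γ h), ev_lmul]; ring

theorem bev_bmul (h : ev γ PL = 0) (l m : List (List ℤ)) :
    bev x γ (bmul l m) = bev x γ l * bev x γ m := by
  induction l with
  | nil => simp [bmul, bev]
  | cons a l ih => simp [bmul, bev, bev_badd, bev_bsc x γ h, ih]; ring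

theorem bev_const (c : ℤ) (l : List ℤ) : bev x γ (l.map fun t => [c * t]) = c * ev x l := by
  induction l with
  | nil => simp [bev]
  | cons a l ih => simp [bev, ih]; ring

theorem ev_zero (l : List ℤ) (h : l.all (· == 0) = true) : ev x l = 0 := by
  induction l with
  | nil => rfl
  | cons a l ih =>
    simp only [List.all_cons, Bool.and_eq_true, beq_iff_eq] at h
    rw [ev_cons, ih h.2, h.1]; simp

theorem bev_zero (l : List (List ℤ)) (h : l.all (fun r => r.all (· == 0)) = true) :
    bev x γ l = 0 := by
  induction l with
  | nil => rfl
  | cons a l ih =>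
    simp only [List.all_cons, Bool.and_eq_true] at h
    rw [bev, ih h.2, ev_zero γ a h.1]; simp

theorem map_bev {S : Type*} [CommRing S] (φ : R →+* S) (l : List (List ℤ)) :
    φ (bev x γ l) = bev (φ x) (φ γ) l := by
  induction l with
  | nil => simp [bev]
  | cons a l ih => simp [bev, ih, map_ev]

theorem ident_list : (badd (bsc [NN] (bmul BL BL)) (badd (bsc (lsm (-1) DL) (bmul AL AL))
    (bsc DL (gL.map fun t => [64 * NN ^ 2 * t])))).all (fun r => r.all (· == 0)) = true := by
  decide +kernel

theorem ident (hx : ev x gL = 0) (h : ev γ PL = 0) :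
    (NN : R) * bev x γ BL ^ 2 = ev γ DL * bev x γ AL ^ 2 := by
  have := bev_zero x γ _ ident_list
  rw [bev_badd, bev_badd, bev_bsc x γ h, bev_bsc x γ h, bev_bsc x γ h, bev_bmul x γ h,
    bev_bmul x γ h, bev_const, hx, ev_lsm] at this
  simp only [ev_cons, ev_nil] at this
  push_cast at this
  linear_combination this
end

theorem deg_PL (R : Type*) [CommRing R] [Nontrivial R] : (lpol R PL).natDegree = 11 := by
  apply le_antisymm (natDegree_lpol PL 11 (by decide))
  apply le_natDegree_of_ne_zero
  rw [coeff_lpol]; simp [PL]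

theorem PL_ne (R : Type*) [CommRing R] [Nontrivial R] : lpol R PL ≠ 0 := by
  intro h
  have := deg_PL R
  rw [h] at this; simp at this

theorem integral_PL {R : Type*} [CommRing R] {y : R} (h : ev y PL = 0) : IsIntegral ℤ y := by
  refine ⟨lpol ℤ PL, ?_, ?_⟩
  · rw [Monic, leadingCoeff, deg_PL, coeff_lpol]; simp [PL]
  · rw [eval₂_eq_eval_map, map_lpol, eval_lpol, h]

theorem vP_cert : lmm (18671 : ℕ) 11 PN (lder PL) vP = [1, 0, 0, 0, 0, 0, 0, 0, 0, 0, 0] := by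
  decide +kernel

theorem deriv_neP {F : Type*} [Field F] [CharP F 18671] {y : F} (h : ev y PL = 0) :
    ev y (lder PL) ≠ 0 := by
  intro h0
  have h1 := ev_lmm y (p := (18671 : ℕ)) (castp 18671) (by norm_num : 11 ≠ 0) (PN_of_PL y h)
    (lder PL) vP
  rw [vP_cert, h0] at h1
  simp at h1

def lprod (cs : List ℤ) : List ℤ := cs.foldr (fun c acc => lmul [-c, 1] acc) [1]

theorem lprod_zero {F : Type*} [Field F] {z : F} (cs : List ℤ) (h : ev z (lprod cs) = 0) :
    ∃ c ∈ cs, z = (c : ℤ) := by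
  induction cs with
  | nil => simp [lprod] at h
  | cons c cs ih =>
    rw [lprod, List.foldr_cons, ev_lmul, ← lprod] at h
    rcases mul_eq_zero.mp h with h | h
    · refine ⟨c, by simp, ?_⟩
      simp at h
      linear_combination h
    · obtain ⟨c', hc', hz⟩ := ih h
      exact ⟨c', by simp [hc'], hz⟩

theorem root_of_prod {F : Type*} [Field F] {p : ℕ} [CharP F p] {z : F} (l cs : List ℤ)
    (hl : lmod p (lprod cs) = lmod p l) (h : ev z l = 0) :
    ∃ i : Fin cs.length, z = ((cs.getD i 0 : ℤ) : F) := by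
  rw [← ev_lmod (p := p) z (castp p), ← hl, ev_lmod z (castp p)] at h
  obtain ⟨c, hc, hz⟩ := lprod_zero cs h
  obtain ⟨i, hi, rfl⟩ := List.mem_iff_getElem.mp hc
  exact ⟨⟨i, hi⟩, by simp [hi, hz]⟩

theorem prod_c : lmod (18671 : ℕ) (lprod cL) = lmod (18671 : ℕ) gL := by decide +kernel
theorem prod_d : lmod (18671 : ℕ) (lprod dL) = lmod (18671 : ℕ) PL := by decide +kernel

theorem label {Ω κ : Type} [Field Ω] [CharZero Ω] [IsAlgClosed Ω] [Field κ] {p : ℕ} [CharP κ p]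
    (φ : integralClosure ℤ Ω →+* κ) (l cs : List ℤ) (n : ℕ) (hn : cs.length = n)
    (hdeg : (lpol Ω l).natDegree = n) (h0 : lpol Ω l ≠ 0)
    (hint : ∀ y : Ω, ev y l = 0 → IsIntegral ℤ y)
    (hd : ∀ z : κ, ev z l = 0 → ev z (lder l) ≠ 0)
    (hl : lmod p (lprod cs) = lmod p l) :
    ∃ (e : Fin n ≃ {y : Ω // ev y l = 0}) (f : Fin n → integralClosure ℤ Ω),
      (∀ i, ((f i : integralClosure ℤ Ω) : Ω) = (e i).1) ∧ 
      (∀ i, ev (f i) l = 0) ∧ ∀ i, φ (f i) = ((cs.getD i 0 : ℤ) : κ) := by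
  subst hn
  let L (y : {y : Ω // ev y l = 0}) : integralClosure ℤ Ω := ⟨y.1, hint y.1 y.2⟩
  have hmap (y) (m) : ((ev (L y) m : integralClosure ℤ Ω) : Ω) = ev y.1 m :=
    map_ev (L y) (algebraMap (integralClosure ℤ Ω) Ω) m
  have hL (y) : ev (L y) l = 0 := Subtype.ext ((hmap y l).trans y.2)
  have hL' (y) : ev (φ (L y)) l = 0 := by rw [← map_ev, hL, map_zero]
  have hcard : Nat.card {y : Ω // ev y l = 0} = cs.length := by
    apply card_roots_lpol Ω l _ hdeg h0 (IsAlgClosed.splits _)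
    intro x hx hx'
    have : ev (L ⟨x, hx⟩) (lder l) = 0 := Subtype.ext ((hmap ⟨x, hx⟩ _).trans hx')
    apply hd _ (hL' ⟨x, hx⟩)
    rw [← map_ev, this, map_zero]
  choose f hf using fun y => root_of_prod (z := φ (L y)) l cs hl (hL' y)
  have hinj : Function.Injective f := by
    intro a b hab
    have h1 : φ (L a) = φ (L b) := by rw [hf a, hf b, hab]
    have := red_inj φ l (L a) (L b) (hL a) (hL b) h1 (hd _ (hL' a))
    exact Subtype.ext (congrArg (fun z : integralClosure ℤ Ω => (z : Ω)) this)
  have : Finite {y : Ω // ev y l = 0} := Finite.of_injective f hinj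
  have hbij : Function.Bijective f := by
    rw [Nat.bijective_iff_injective_and_card]
    exact ⟨hinj, by rw [hcard]; simp⟩
  let e := Equiv.ofBijective f hbij
  refine ⟨e.symm, fun i => L (e.symm i), fun i => rfl, fun i => hL _, fun i => ?_⟩
  rw [hf (e.symm i)]
  have : f (e.symm i) = i := e.apply_symm_apply i
  rw [this]

def gg (T : List (List ℤ)) (i : Fin 11) (j : Fin 12) : ℤ := (T.getD i []).getD j 0

theorem tabA : ∀ (i : Fin 11) (j : Fin 12),
    bev (cL.getD j 0) (dL.getD i 0) AL % 18671 = gg aT i j := by decide +kernel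
theorem tabB : ∀ (i : Fin 11) (j : Fin 12),
    bev (cL.getD j 0) (dL.getD i 0) BL % 18671 = gg bT i j := by decide +kernel
theorem tabD : ∀ (i : Fin 11), ¬ (18671 ∣ NN * ev (dL.getD i 0) DL) := by decide +kernel
theorem tabE : ∀ (i : Fin 11) (j k : Fin 12),
    ((gg bT i j * gg aT i k - gg bT i k * gg aT i j) % 18671 = 0 ↔ EE i j k = true) := by
  decide +kernel
theorem tab0 : ∀ (i : Fin 11) (j k : Fin 12), ¬ (18671 ∣ 2 * gg bT i j * gg aT i k) := by
  decide +kernel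

theorem cast_dvd {κ : Type*} [Field κ] [CharP κ 18671] (a : ℤ) : (a : κ) = 0 ↔ (18671 : ℤ) ∣ a := by
  simpa using CharP.intCast_eq_zero_iff κ 18671 a

theorem same_iff {O κ : Type*} [CommRing O] [IsDomain O] [Field κ] [CharP κ 18671] (φ : O →+* κ)
    (y : Fin 12 → O) (γ : Fin 11 → O) (hy : ∀ j, ev (y j) gL = 0) (hγ : ∀ i, ev (γ i) PL = 0)
    (hy' : ∀ j, φ (y j) = ((cL.getD j 0 : ℤ) : κ)) (hγ' : ∀ i, φ (γ i) = ((dL.getD i 0 : ℤ) : κ))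
    (i : Fin 11) (j k : Fin 12) :
    bev (y j) (γ i) BL * bev (y k) (γ i) AL = bev (y k) (γ i) BL * bev (y j) (γ i) AL ↔
      EE i j k = true := by
  have hc (M : List (List ℤ)) (j) : φ (bev (y j) (γ i) M) =
      ((bev (cL.getD j 0) (dL.getD i 0) M : ℤ) : κ) := by
    rw [map_bev, hy', hγ']
    exact (map_bev (cL.getD j 0) (dL.getD i 0) (Int.castRingHom κ) M).symm
  have hz : ((18671 : ℤ) : κ) = 0 := by rw [cast_dvd]
  have hA (j) : φ (bev (y j) (γ i) AL) = ((gg aT i j : ℤ) : κ) := by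
    rw [hc, ← tabA, cast_mod hz]
  have hB (j) : φ (bev (y j) (γ i) BL) = ((gg bT i j : ℤ) : κ) := by
    rw [hc, ← tabB, cast_mod hz]
  rw [← tabE, ← Int.dvd_iff_emod_eq_zero, ← cast_dvd (κ := κ)]
  constructor
  · intro h
    have := congrArg φ h
    rw [map_mul, map_mul, hA, hA, hB, hB] at this
    push_cast
    linear_combination this
  · intro h
    have i1 := ident (y j) (γ i) (hy j) (hγ i)
    have i2 := ident (y k) (γ i) (hy k) (hγ i)
    set a := bev (y j) (γ i) AL
    set b := bev (y j) (γ i) BL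
    set a' := bev (y k) (γ i) AL
    set b' := bev (y k) (γ i) BL
    have hprod : ((NN : O) * ev (γ i) DL) * ((b * a' - b' * a) * (b * a' + b' * a)) = 0 := by
      linear_combination ev (γ i) DL * a' ^ 2 * i1 - ev (γ i) DL * a ^ 2 * i2
    rcases mul_eq_zero.mp hprod with h1 | h1
    · exfalso
      have h2 := congrArg φ h1
      rw [map_mul, map_ev, hγ', map_intCast, map_zero] at h2
      apply tabD i
      rw [← cast_dvd (κ := κ)]
      push_cast
      rw [← h2]; congr 1
      exact map_ev (dL.getD i 0) (Int.castRingHom κ) DL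
    · rcases mul_eq_zero.mp h1 with h2 | h2
      · linear_combination h2
      · exfalso
        have h3 := congrArg φ h2
        rw [map_add, map_mul, map_mul, hA, hA, hB, hB, map_zero] at h3
        apply tab0 i j k
        rw [← cast_dvd (κ := κ)]
        push_cast at h ⊢
        linear_combination h + h3

theorem perm_of {Ω : Type} [Field Ω] [CharZero Ω] [IsAlgClosed Ω] :
    ∃ e : Fin 12 ≃ YY Ω, ∀ τ : Ω ≃ₐ[ℚ] Ω, ∃ π ∈ SS, ∀ j, e (π j) = τ • e j := by
  obtain ⟨κ, _, φ, _⟩ := exists_red' Ω 18671 (by norm_num)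
  obtain ⟨e, y, he, hy, hy'⟩ := label φ gL cL 12 rfl (deg_gL Ω) (gL_ne Ω)
    (fun y h => integral_gL h) (fun z h => deriv_ne (p := 18671) h _ v18671) prod_c
  obtain ⟨d, γ, hd, hγ, hγ'⟩ := label φ PL dL 11 rfl (deg_PL Ω) (PL_ne Ω)
    (fun y h => integral_PL h) (fun z h => deriv_neP h) prod_d
  have key := same_iff φ y γ hy hγ hy' hγ'
  have key2 (i j k) : bev (e j).1 (d i).1 BL * bev (e k).1 (d i).1 AL =
      bev (e k).1 (d i).1 BL * bev (e j).1 (d i).1 AL ↔ EE i j k = true := by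
    have hm (j i) (M) : bev (e j).1 (d i).1 M = (algebraMap (integralClosure ℤ Ω) Ω) 
        (bev (y j) (γ i) M) := by
      rw [map_bev]
      have h1 : (algebraMap (integralClosure ℤ Ω) Ω) (y j) = (e j).1 := he j
      have h2 : (algebraMap (integralClosure ℤ Ω) Ω) (γ i) = (d i).1 := hd i
      rw [h1, h2]
    rw [← key, hm, hm, hm, hm, ← map_mul, ← map_mul]
    exact (FaithfulSMul.algebraMap_injective (integralClosure ℤ Ω) Ω).eq_iff
  refine ⟨e, fun τ => ?_⟩
  let aY : Equiv.Perm (YY Ω) := MulAction.toPerm τ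
  let aP : Equiv.Perm {z : Ω // ev z PL = 0} :=
    { toFun := fun z => ⟨τ z.1, by rw [← ev_apply, z.2, map_zero]⟩
      invFun := fun z => ⟨τ.symm z.1, by rw [← ev_apply, z.2, map_zero]⟩
      left_inv := fun z => Subtype.ext (τ.symm_apply_apply z.1)
      right_inv := fun z => Subtype.ext (τ.apply_symm_apply z.1) }
  let π : Equiv.Perm (Fin 12) := (e.trans aY).trans e.symm
  let ρ : Equiv.Perm (Fin 11) := (d.trans aP).trans d.symm
  have hπ (j) : e (π j) = τ • e j := e.apply_symm_apply _
  have hρ (i) : (d (ρ i)).1 = τ (d i).1 := congrArg Subtype.val (d.apply_symm_apply (aP (d i)))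
  refine ⟨π, ⟨ρ, fun i j k => ?_⟩, hπ⟩
  rw [Bool.eq_iff_iff, ← key2, ← key2, hπ, hπ, coe_act, coe_act, hρ]
  have hb (x γ : Ω) (M) : bev (τ x) (τ γ) M = τ (bev x γ M) := (map_bev x γ (τ : Ω →+* Ω) M).symm
  rw [hb, hb, hb, hb, ← map_mul, ← map_mul]
  exact τ.injective.eq_iff

theorem gal_bound : Nat.card f3.Gal ≤ 7920 := by
  let Ω := AlgebraicClosure f3.SplittingField
  have : CharZero Ω := algebraRat.charZero Ω
  have : IsAlgClosed Ω := inferInstanceAs (IsAlgClosed (AlgebraicClosure f3.SplittingField))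
  have : Algebra.IsAlgebraic f3.SplittingField Ω :=
    inferInstanceAs (Algebra.IsAlgebraic f3.SplittingField (AlgebraicClosure f3.SplittingField))
  have : Algebra.IsAlgebraic ℚ Ω := Algebra.IsAlgebraic.trans ℚ f3.SplittingField Ω
  have : IsAlgClosure ℚ Ω := ⟨inferInstance, inferInstance⟩
  have : Normal ℚ Ω := IsAlgClosure.normal ℚ Ω
  obtain ⟨e, he⟩ := perm_of (Ω := Ω)
  choose π hπ hπ' using fun σ : f3.SplittingField ≃ₐ[ℚ] f3.SplittingField => he (σ.liftNormal Ω)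
  refine SS_bound (f3.SplittingField ≃ₐ[ℚ] f3.SplittingField) π ?_ hπ
  intro σ σ' h
  have h1 (y : YY Ω) : σ.liftNormal Ω • y = σ'.liftNormal Ω • y := by
    obtain ⟨j, rfl⟩ := e.surjective y
    rw [← hπ', ← hπ', h]
  have h2 (z : YY f3.SplittingField) : σ • z = σ' • z := by
    have h3 := congrArg Subtype.val (h1 ⟨algebraMap f3.SplittingField Ω z.1, by
      rw [← map_ev, z.2, map_zero]⟩)
    rw [coe_act, coe_act] at h3
    dsimp only at h3
    rw [AlgEquiv.liftNormal_commutes, AlgEquiv.liftNormal_commutes] at h3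
    exact Subtype.ext ((algebraMap f3.SplittingField Ω).injective h3)
  have := f3_faithful (σ'⁻¹ * σ) (fun z => by rw [mul_smul, h2, inv_smul_smul])
  exact (inv_mul_eq_one.mp this).symm
end bound
end M11

namespace M11
section disc

def DD : ℤ := 9953280000000000

def WL : List (List ℤ) :=
  [[9953280000000000], [0, 9953280000000000], [3317760000000000, 1658880000000000,
  1658880000000000], [3317760000000000, 5806080000000000, 0, 829440000000000], [6082560000000000,
  8487936000000000, 1486080000000000, 552960000000000, 6912000000000], [2211840000000000,
  3345408000000000, 203212800000000, 267840000000000, 0, 345600000000], [3962880000000000,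
  608256000000000, 1430092800000000, 71101440000000, 1080000000000, 172800000000, 2880000000],
  [9123840000000000, 87552000000000, 542592000000000, 476824320000000, 315072000000,
  226800000000, 0, 144000000], [4254720000000000, 8381798400000000, 568750080000000,
  172433280000000, 5366169600000, 110685120000, 2010000000, 124800000, 240000],
  [9277440000000000, 1774233600000000, 59005440000000, 46911744000000, 4984838400000,
  133695360000, 2234256000, 23700000, 0, 12000], [6530560000000000, 3490969600000000,
  1287627776000000, 221591910400000, 1817466240000, 184238464000, 1455705600, 7473760, 239500,
  10000, 20], [5972480000000000, 129049600000000, 1388582400000000, 106058188800000,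
  4145121920000, 91661792000, 2384403200, 43141280, 146188, 1975, 0, 1]]

def TL : List (List (List ℤ)) :=
  [[[1], [0, 1], [0, 0, 1], [0, 0, 0, 1], [0, 0, 0, 0, 1], [0, 0, 0, 0, 0, 1], [0, 0, 0, 0, 0, 0,
  1], [0, 0, 0, 0, 0, 0, 0, 1], [0, 0, 0, 0, 0, 0, 0, 0, 1], [0, 0, 0, 0, 0, 0, 0, 0, 0, 1], [0,
  0, 0, 0, 0, 0, 0, 0, 0, 0, 1], [0, 0, 0, 0, 0, 0, 0, 0, 0, 0, 0, 1]], [[-2, -1, 6], [-1, -1, 1,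
  2], [-12, -38, -104, -80, 120], [-11, -29, -69, -58, 80, 20], [-8, 17, -112, -4, 20, -60, 120],
  [-15, 20, -53, -2, 0, -40, 60, 20], [207, -581, 505, 314, -320, 320, -340, -520, 600], [159,
  -499, 513, 290, -320, 300, -340, -440, 520, 20], [33, 526, -1237, -522, 500, -520, 480, 500,
  -500, -500, 600], [-9, 495, -1107, -466, 460, -480, 440, 460, -480, -400, 500, 20], [22, -179,
  318, 176, -200, 180, -220, -200, 200, 80, -100, 120]], [[-4, -13, -35, -26, 40], [-32, -58,
  -66, -141, 20, 400], [-38, 47, -340, -46, -13, 70, 400], [-237, 176, -121, -178, -10, -143, 20,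
  400], [597, -1831, 1937, 1062, -1240, 1060, -1323, -1530, 2000], [-1514, -265, 2388, 814,
  -1240, 320, -1590, -153, 100, 2000], [-726, 481, -968, -274, -120, -950, -390, 460, -513, 70,
  2000], [7, 61, 595, 714, -1090, 580, -1520, -650, 250, -83, 100, 2000], [-80, 1981, -3060,
  -1080, 690, -880, -60, 1210, -1680, -1400, 1417, 2070], [-235, -2504, 6343, 3202, -3580, 3030,
  -3970, -3100, 2700, 2280, -2350, 2087]], [[-763, 5845, -15984, 4225, -3610, -12000, 24000],
  [-2796, 5747, -11573, 1331, -2533, -10255, 16000, 4000], [42944, -113914, 118551, 70442,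
  -76495, 67832, -75930, -104000, 120000], [7332, -59782, 84411, 43878, -49860, 36910, -55298,
  -54655, 60000, 20000], [37627, 532854, -1225858, -525033, 511380, -519680, 461135, 501697,
  -519650, -500000, 600000], [8456, 502135, -1082107, -470391, 455140, -465825, 397135, 466410,
  -492363, -422655, 520000, 20000], [-16774, -57752, 221827, 111950, -127915, 112630, -159720,
  -98375, 66375, 83042, -99650, 120000], [-8792, -132911, 373940, 186026, -202005, 186520,
  -226410, -177065, 143720, 133100, -169708, 137345], [-17454, 34381, 17356, 19406, -34290,
  19305, -66795, -5450, -26550, 9380, -6725, 100737]], [[3783, -14074, 11800, 11515, -14408,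
  3269, -2575, -12000, 20000], [13869, -77798, 102680, 55664, -62915, 46390, -66031, -70975,
  80000, 20000], [1048, 55376, -143407, -58897, 51555, -65233, 36124, 53199, -54875, -60000,
  100000], [2194, 421984, -847259, -355203, 333559, -349316, 267692, 359053, -406155, -334875,
  400000, 100000], [-6949, 430818, -829831, -350145, 326765, -340530, 249967, 360547, -415649,
  -322701, 385125, 120000], [-28505, -80757, 339924, 169617, -191268, 173386, -237424, -145675,
  92650, 132352, -166155, 185125], [-31551, -172060, 550340, 265831, -287436, 267184, -324722,
  -239148, 184824, 214020, -267823, 202424], [-27313, 13761, 129276, 74800, -95520, 78901,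
  -143289, -51140, -1885, 54321, -71620, 168621]], [[37459, 531612, -1220024, -527911, 514133,
  -515050, 450992, 502999, -521250, -500000, 600000], [-2922, 341820, -655825, -276796, 259329,
  -265365, 196129, 283655, -330380, -256875, 300000, 100000], [-71072, -60179, 680545, 361461,
  -420517, 397156, -568541, -286723, 102285, 262120, -406250, 600000], [-118954, -227199,
  1197145, 587770, -650390, 618049, -798634, -478277, 267789, 494751, -678505, 683125], [-105713,
  -360949, 1365083, 649612, -698516, 669395, -803908, -556294, 390845, 557853, -732090, 558995],
  [-84145, -371751, 1328075, 637069, -685082, 659936, -787114, -558726, 403476, 524980, -702342,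
  542496], [-103364, -373057, 1390471, 662266, -711426, 683058, -816368, -569854, 404005, 564874,
  -745250, 565134]], [[-27237, 143476, -109137, -29408, 7736, -15469, -56789, 57639, -128570,
  -35855, 15625, 200000], [-140284, -598856, 2120676, 1007313, -1075899, 1040842, -1220594,
  -879010, 643975, 851120, -1131900, 815625], [-163482, -698785, 2440386, 1151712, -1224080,
  1186965, -1374185, -1003671, 746338, 987402, -1306860, 892270], [-130030, -594586, 2010405,
  944441, -999650, 970173, -1110723, -827916, 630320, 813346, -1068605, 691490], [-121260,
  -620237, 2026662, 951647, -1005507, 976077, -1110758, -842849, 655102, 812640, -1064544,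
  669457], [-130657, -638473, 2109838, 989577, -1045200, 1015163, -1154590, -872536, 674590,
  850428, -1114875, 700678]], [[-448693, -2505299, 7988646, 3740855, -3935431, 3835679, -4300990,
  -3331865, 2637245, 3192655, -4198825, 2514975], [-518581, -3006331, 9354844, 4354285, -4560209,
  4448150, -4930039, -3890846, 3142397, 3752764, -4889920, 2738200], [-410328, -2573927, 7793595,
  3615446, -3773672, 3683946, -4043522, -3252012, 2677140, 3118983, -4040860, 2141155], [-379346,
  -2425652, 7346252, 3414755, -3567674, 3482694, -3829942, -3075875, 2526854, 2929850, -3806452,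
  2048019], [-409912, -2551990, 7740334, 3591356, -3749212, 3659146, -4018092, -3228499, 2654880,
  3099466, -4015100, 2132912]], [[-560566, -3426253, 10485506, 4869777, -5087171, 4970235,
  -5466976, -4369403, 3570371, 4199582, -5463568, 2952569], [-436721, -2789560, 8404932, 3895528,
  -4061337, 3969509, -4341343, -3508220, 2898331, 3362687, -4358402, 2277167], [-420732,
  -2666322, 8040376, 3727174, -3887362, 3796103, -4156941, -3355184, 2770644, 3218380, -4165848,
  2182059], [-436589, -2782403, 8385882, 3886774, -4052397, 3960131, -4331385, -3499696, 2891064,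
  3355797, -4348782, 2272487]], [[-339914, -2229133, 6643170, 3073602, -3199607, 3127340,
  -3406172, -2774567, 2310463, 2657884, -3431828, 1744773], [-330018, -2187142, 6490254, 3001818,
  -3124185, 3051789, -3321734, -2712413, 2265664, 2595640, -3345390, 1687404], [-338763,
  -2233777, 6652192, 3078161, -3204262, 3132205, -3410337, -2779502, 2315698, 2660063, -3436693,
  1746762]], [[-311437, -2134464, 6299107, 2915888, -3034857, 2964961, -3225201, -2641404,
  2211692, 2510993, -3239779, 1633489], [-328848, -2184334, 6481909, 2998541, -3120886, 3048748,
  -3318009, -2709722, 2263223, 2591568, -3341862, 1687305]], [[-338864, -2239699, 6664824,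
  3083897, -3210008, 3137677, -3415205, -2785140, 2321732, 2664902, -3442593, 1747030]]]

def tauL : List ℤ :=
  [12, 120, 1099, 37527, 45622, 90213, 92044, 242870, 247622, 186050, 183138, 186314]

/-- columns -/
def VL : List (List ℤ) :=
  [[1], [-10, 1], [338995, -130062, 10500], [11415570690613, -5180708980507, 232205562630,
  6115711782], [1060931776245610640585, -71169201652711641157, -26724215817966407087,
  -2159356377526554863, 2328113691788220047], [-56703096621785869169222483,
  6729109750501610383423957, 862218428108693808607841, 89196102362932367814863,
  -179881026652458494332733, 41952224196894917027694], [613481202849921023703702660778,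
  -48133249481257177853262924673, 8895401464783372274172200028, 2419705877627639242902794011,
  -1908587733301013743946701992, -4510446207507634389603201109, 4256750468369122759504462434],
  [2478716625952454094971574340310402, 1403325622142083778034054290199577,
  -99976680213497449327563717698424, -90294589100367616675737971935987,
  70558863917761296606318013926132, 92116800174298975235424921848569,
  -594474911021669952544744248447810, 191414728327311316879973964218520],
  [-735246195828062084864129695678144642, -1453229168894150730559093161115094201,
  1294054755436835649807033591762790608, 643998095595919534056198482290707059,
  -647061723362837102362917036236869584, 773955598661004443743998318275465071,
  -739579965102051062497121880783455046, -1135872988350307468979681387450719944,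
  1123633975392778523261764124669915844], [-412566336335644278465288551774,
  737441544698048983114807217489, -556153610181296553722610422208,
  -337629060019127465127042038075, 346174600267658285027373740160,
  -429502957312877646873807863527, 383750382560223152445604256598,
  633040167591989023612085357544, -765395365040360684998852465188,
  196784705212789398334076442816], [69857760477990813840619, 364619340222961717926091,
  -916675524884095458460177, -392330442936600162228175, 392406734966021973761665,
  -360379893421356368728038, 359871235096951976719212, 350328237008951517920136,
  -351528514562660731271172, -413130732084494813147796, 414962210105523835515000],
  [-8240993597285, -69951634582979, 172035913392851, 75791977972727, -76232476583807,
  72976550738076, -72419029185060, -70497276270408, 69029497839204, 71641704600396,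
  -80625694618440, 10737261575280]]

def T1 (i j : ℕ) : List ℤ := ((TL.getD i []).getD (j - i) [])
def TQ (i j : ℕ) : List ℤ := if i ≤ j then T1 i j else T1 j i

def MM (i j : ℕ) : ℤ := ∑ k ∈ Finset.range 12, (TQ i j).getD k 0 * tauL.getD k 0
def VV (j c : ℕ) : ℤ := (VL.getD c []).getD j 0

def comb : List ℤ → List (List ℤ) → List ℤ
  | t :: ts, w :: ws => ladd (lsm t w) (comb ts ws)
  | _, _ => []

theorem ev_comb {R : Type*} [CommRing R] (x : R) (ts : List ℤ) (ws : List (List ℤ)) :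
    ev x (comb ts ws) =
      ∑ k ∈ Finset.range ws.length, ((ts.getD k 0 : ℤ) : R) * ev x (ws.getD k []) := by
  induction ws generalizing ts with
  | nil => cases ts <;> simp [comb]
  | cons w ws ih =>
    cases ts with
    | nil => simp [comb]
    | cons t ts =>
      rw [comb, ev_ladd, ev_lsm, ih, List.length_cons, Finset.sum_range_succ']
      simp [add_comm]

theorem mul_cert : ((List.range 12).all fun i => (List.range 12).all fun j =>
    (ladd (lred 12 gN (lmul (WL.getD i []) (WL.getD j []))) (lsm (-DD) (comb (TQ i j) WL))).all
      (· == 0)) = true := by decide +kernel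

theorem tau_cert : ∀ k < 12, ∑ j ∈ Finset.range 12, (TQ k j).getD j 0 = tauL.getD k 0 := by
  decide +kernel

theorem tri_cert : ∀ c < 12, ∀ i < c,
    ∑ j ∈ Finset.range 12, MM i j * VV j c = 0 := by decide +kernel

theorem V_tri : ∀ c < 12, ∀ j < 12, c < j → VV j c = 0 := by decide +kernel

theorem V_ne : ∀ c < 12, VV c c ≠ 0 := by decide +kernel

theorem det_cert : ∏ c ∈ Finset.range 12, (∑ j ∈ Finset.range 12, MM c j * VV j c) =
    45513961 ^ 4 * ∏ c ∈ Finset.range 12, VV c c := by decide +kernel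

theorem det_MM : (Matrix.of fun i j : Fin 12 => MM i j).det = 45513961 ^ 4 := by
  set M : Matrix (Fin 12) (Fin 12) ℤ := Matrix.of fun i j => MM i j
  set V : Matrix (Fin 12) (Fin 12) ℤ := Matrix.of fun i j => VV i j
  have hV : V.det = ∏ c ∈ Finset.range 12, VV c c := by
    rw [Matrix.det_of_isUpperTriangular, Finset.prod_range]
    · rfl
    · intro i j hij
      exact V_tri j j.2 i i.2 hij
  have hMV (i c : Fin 12) : (M * V) i c = ∑ j ∈ Finset.range 12, MM i j * VV j c := by
    rw [Matrix.mul_apply, Finset.sum_range]; rfl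
  have hP : (M * V).det = ∏ c ∈ Finset.range 12, (∑ j ∈ Finset.range 12, MM c j * VV j c) := by
    rw [Matrix.det_of_isLowerTriangular, Finset.prod_range]
    · exact Finset.prod_congr rfl fun i _ => hMV i i
    · intro i j hij
      rw [hMV]
      exact tri_cert j j.2 i hij
  rw [Matrix.det_mul, det_cert, ← hV] at hP
  refine mul_right_cancel₀ ?_ hP
  rw [hV, Finset.prod_ne_zero_iff]
  intro c hc
  exact V_ne c (Finset.mem_range.mp hc)

end disc
end M11

namespace M11
section field
variable {K : Type*} [Field K] [NumberField K]

theorem minpoly_int {y : K} (hy : ev y gL = 0) (hf : Module.finrank ℚ K = 12)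
    (hg : Algebra.adjoin ℚ {y} = ⊤) : minpoly ℤ y = lpol ℤ gL := by
  have hi : IsIntegral ℤ y := integral_gL hy
  have hiQ : IsIntegral ℚ y := Algebra.IsIntegral.isIntegral y
  have h1 : (minpoly ℚ y).natDegree = 12 := by
    rw [← hf]
    apply (Field.primitive_element_iff_minpoly_natDegree_eq ℚ y).mp
    rw [← IntermediateField.toSubalgebra_inj, IntermediateField.adjoin_simple_toSubalgebra_of_isAlgebraic
      hiQ.isAlgebraic, hg, IntermediateField.top_toSubalgebra]
  have h2 : (minpoly ℤ y).natDegree = 12 := by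
    rw [minpoly.isIntegrallyClosed_eq_field_fractions' ℚ hi,
      (minpoly.monic hi).natDegree_map] at h1
    exact h1
  have hd : minpoly ℤ y ∣ lpol ℤ gL := by
    apply minpoly.isIntegrallyClosed_dvd hi
    rw [aeval_def, eval₂_eq_eval_map, map_lpol, eval_lpol, hy]
  exact (Polynomial.eq_of_monic_of_dvd_of_natDegree_le (minpoly.monic hi) (monic_gL ℤ) hd
    (by rw [h2, deg_gL])).symm

noncomputable def bb (y : K) (i : ℕ) : K := ev y (WL.getD i []) / DD

theorem DD_ne : (DD : K) ≠ 0 := by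
  rw [Int.cast_ne_zero]; decide

theorem DD_bb (y : K) (i : ℕ) : ev y (WL.getD i []) = DD * bb y i := by
  rw [bb]; field_simp [DD_ne (K := K)]

theorem bb_mul {y : K} (hy : ev y gL = 0) {i j : ℕ} (hi : i < 12) (hj : j < 12) :
    bb y i * bb y j = ∑ k ∈ Finset.range 12, (((TQ i j).getD k 0 : ℤ) : K) * bb y k := by
  have h := mul_cert
  rw [List.all_eq_true] at h
  have h := h i (List.mem_range.mpr hi)
  rw [List.all_eq_true] at h
  have h := ev_zero y _ (h j (List.mem_range.mpr hj))
  rw [ev_ladd, ev_lred y (by norm_num) (gN_of_gL hy), ev_lmul, ev_lsm, ev_comb,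
    show WL.length = 12 from rfl] at h
  simp only [DD_bb] at h
  have hD := DD_ne (K := K)
  have h2 : ∑ k ∈ Finset.range 12, (((TQ i j).getD k 0 : ℤ) : K) * (DD * bb y k)
      = DD * ∑ k ∈ Finset.range 12, (((TQ i j).getD k 0 : ℤ) : K) * bb y k := by
    rw [Finset.mul_sum]; exact Finset.sum_congr rfl fun k _ => by ring
  rw [h2] at h
  push_cast at h
  apply mul_left_cancel₀ hD
  apply mul_left_cancel₀ hD
  linear_combination h

theorem bb_zero (y : K) : bb y 0 = 1 := by
  have : ev y (WL.getD 0 []) = DD := by simp [WL, DD]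
  rw [bb, this, div_self DD_ne]

theorem bb_one (y : K) : bb y 1 = y := by
  have : ev y (WL.getD 1 []) = DD * y := by simp [WL, DD]; ring
  rw [bb, this, mul_div_cancel_left₀ _ DD_ne]

noncomputable def bf (y : K) (i : Fin 12) : K := bb y i

theorem bf_mul {y : K} (hy : ev y gL = 0) (i j : Fin 12) :
    bf y i * bf y j = ∑ k : Fin 12, (((TQ i j).getD k 0 : ℤ) : K) * bf y k := by
  rw [bf, bf, bb_mul hy i.2 j.2, Finset.sum_range]; rfl

theorem bf_integral {y : K} (hy : ev y gL = 0) (i : Fin 12) : IsIntegral ℤ (bf y i) := by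
  apply isIntegral_of_smul_mem_submodule (Submodule.span ℤ (Set.range (bf y)))
  · intro h
    have : (1 : K) ∈ Submodule.span ℤ (Set.range (bf y)) :=
      Submodule.subset_span ⟨0, bb_zero y⟩
    rw [h] at this
    simp at this
  · exact Submodule.fg_span (Set.finite_range _)
  · intro n hn
    induction hn using Submodule.span_induction with
    | mem x hx =>
      obtain ⟨j, rfl⟩ := hx
      rw [smul_eq_mul, bf_mul hy]
      refine Submodule.sum_mem _ fun k _ => ?_
      rw [← zsmul_eq_mul]
      exact Submodule.smul_mem _ _ (Submodule.subset_span ⟨k, rfl⟩)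
    | zero => rw [smul_zero]; exact Submodule.zero_mem _
    | add a b _ _ h1 h2 => rw [smul_add]; exact Submodule.add_mem _ h1 h2
    | smul c a _ h1 => rw [smul_comm]; exact Submodule.smul_mem _ _ h1

theorem bf_span {y : K} (hy : ev y gL = 0) (hg : Algebra.adjoin ℚ {y} = ⊤) :
    ⊤ ≤ Submodule.span ℚ (Set.range (bf y)) := by
  intro z _
  have hz : z ∈ Algebra.adjoin ℚ {y} := by rw [hg]; trivial
  have h1 : (1 : K) ∈ Submodule.span ℚ (Set.range (bf y)) :=
      Submodule.subset_span ⟨0, bb_zero y⟩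
  have hsm (i : Fin 12) (a : K) (ha : a ∈ Submodule.span ℚ (Set.range (bf y))) :
      bf y i * a ∈ Submodule.span ℚ (Set.range (bf y)) := by
    induction ha using Submodule.span_induction with
    | mem x hx =>
      obtain ⟨j, rfl⟩ := hx
      rw [bf_mul hy]
      refine Submodule.sum_mem _ fun k _ => ?_
      rw [← zsmul_eq_mul]
      exact zsmul_mem (Submodule.subset_span (Set.mem_range_self k)) _
    | zero => rw [mul_zero]; exact Submodule.zero_mem _
    | add a b _ _ h1 h2 => rw [mul_add]; exact Submodule.add_mem _ h1 h2
    | smul c a _ h1 => rw [mul_smul_comm]; exact Submodule.smul_mem _ _ h1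
  have hmm (a b : K) (hb : b ∈ Submodule.span ℚ (Set.range (bf y)))
      (ha : a ∈ Submodule.span ℚ (Set.range (bf y))) :
      a * b ∈ Submodule.span ℚ (Set.range (bf y)) := by
    induction ha using Submodule.span_induction with
    | mem x hx => obtain ⟨j, rfl⟩ := hx; exact hsm _ _ hb
    | zero => rw [zero_mul]; exact Submodule.zero_mem _
    | add a b _ _ h1 h2 => rw [add_mul]; exact Submodule.add_mem _ h1 h2
    | smul c a _ h1 => rw [smul_mul_assoc]; exact Submodule.smul_mem _ _ h1
  induction hz using Algebra.adjoin_induction with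
  | mem x hx => rw [Set.mem_singleton_iff.mp hx]; exact Submodule.subset_span ⟨1, bb_one y⟩
  | algebraMap r => rw [Algebra.algebraMap_eq_smul_one]; exact Submodule.smul_mem _ _ h1
  | add a b _ _ h2 h3 => exact Submodule.add_mem _ (h2 trivial) (h3 trivial)
  | mul a b _ _ h2 h3 =>
    exact hmm _ _ (h3 trivial) (h2 trivial)

theorem bf_discr {y : K} (hy : ev y gL = 0) (hf : Module.finrank ℚ K = 12)
    (hg : Algebra.adjoin ℚ {y} = ⊤) : Algebra.discr ℚ (bf y) = 45513961 ^ 4 := by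
  set B := basisOfTopLeSpanOfCardEqFinrank (bf y) (bf_span hy hg) (by rw [hf]; simp) with hB
  have hBf : ⇑B = bf y := coe_basisOfTopLeSpanOfCardEqFinrank _ _ _
  have hBi (i) : bf y i = B i := by rw [hBf]
  have htr (k : Fin 12) : Algebra.trace ℚ K (bf y k) = (tauL.getD k 0 : ℤ) := by
    rw [Algebra.trace_eq_matrix_trace B, Matrix.trace, ← tau_cert k k.2, Finset.sum_range]
    push_cast
    refine Finset.sum_congr rfl fun j _ => ?_
    rw [Matrix.diag_apply, Algebra.leftMulMatrix_eq_repr_mul, ← hBi, bf_mul hy]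
    simp only [hBi, ← zsmul_eq_mul, map_sum, map_zsmul, B.repr_self, Finsupp.coe_finsetSum,
      Finset.sum_apply, Finsupp.smul_apply]
    rw [Finset.sum_eq_single j]
    · simp
    · intro k _ hk; simp [hk]
    · simp
  have hM : Algebra.traceMatrix ℚ (bf y) =
      (Matrix.of fun i j : Fin 12 => MM i j).map (Int.castRingHom ℚ) := by
    ext i j
    rw [Algebra.traceMatrix_apply, Algebra.traceForm_apply, bf_mul hy]
    simp only [← zsmul_eq_mul, map_sum, map_zsmul, htr]
    simp [MM, Finset.sum_range]
  rw [Algebra.discr_def, hM, ← RingHom.mapMatrix_apply, ← RingHom.map_det, det_MM]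
  norm_num

end field
end M11

namespace M11
section dedekind

def uL : List ℤ :=
  [16995823, 11946606, 600, -20154906, 1]

def vL : List ℤ :=
  [-9427016, -11974606, -6346387, -5204269, 1]

def tL : List ℤ :=
  [-59829317833224, -160107553118590, -176682915846355, 14689031200567, 213650224934625,
  205908826877488, 61352760856454, -51807802786550, -56639875343250, -46449025276302, 13534382,
  -1]

def beA : List ℤ :=
  [-20811562, -12315529, 3036379, -7869866, 6626610, -6020081, -8373602, -13920885]

def beB : List ℤ :=
  [16156514, 9791310, -22384728, -17471239, 15187019, 14456341, 20339158]

def beC : List ℤ :=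
  [18803994, 1133018, -7083535, -8183593]

def beE : List ℤ :=
  [-17312486, -20288565, -6535184, 10136634, 9490152, -17347439, 4253311, -11667147, 2299231,
  20970834, -1962151, -12670001, 14671383, -22447022, -8183593]

theorem prime_q : Nat.Prime 45513961 := by norm_num

instance fact_q : Fact (Nat.Prime 45513961) := ⟨prime_q⟩

theorem uuv_cert : lmul (lmul uL uL) vL = ladd gL (lsm 45513961 tL) := by decide +kernel

theorem sep_cert : (lmod 45513961 (ladd (ladd (lmul beA (lder (lmul uL vL)))
    (lmul beB (lmul uL vL))) [-1])).all (· == 0) = true := by decide +kernel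

theorem cop_cert : (lmod 45513961 (ladd (ladd (lmul beC (lmul tL vL)) (lmul beE uL)) [-1])).all
    (· == 0) = true := by decide +kernel

theorem castq : (((45513961 : ℤ)) : (ZMod 45513961)[X]) = 0 := by
  have : (((45513961 : ℕ)) : (ZMod 45513961)[X]) = 0 := CharP.cast_eq_zero _ _
  exact_mod_cast this

theorem lpol_lmul (R : Type*) [CommRing R] (a b : List ℤ) :
    lpol R (lmul a b) = lpol R a * lpol R b := ev_lmul _ _ _

theorem uv_sep : (lpol (ZMod 45513961) (lmul uL vL)).Separable := by
  have h := ev_zero (X : (ZMod 45513961)[X]) _ sep_cert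
  rw [ev_lmod _ castq] at h
  simp only [ev_ladd, ev_lmul X beA, ev_lmul X beB] at h
  refine ⟨ev X beB, ev X beA, ?_⟩
  rw [derivative_lpol, lpol, lpol]
  simp at h ⊢
  linear_combination h

theorem u_cop : IsCoprime (lpol (ZMod 45513961) uL)
    (lpol (ZMod 45513961) tL * lpol (ZMod 45513961) vL) := by
  have h := ev_zero (X : (ZMod 45513961)[X]) _ cop_cert
  rw [ev_lmod _ castq] at h
  refine ⟨ev X beE, ev X beC, ?_⟩
  rw [lpol, lpol, lpol]
  simp at h ⊢
  linear_combination h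

theorem uuv_eq (R : Type*) [CommRing R] : lpol R uL * lpol R uL * lpol R vL =
    lpol R gL + 45513961 * lpol R tL := by
  have h := congrArg (ev (X : R[X])) uuv_cert
  simpa [lpol] using h

variable {K : Type*} [Field K] [NumberField K]

theorem lemA {y θ : K} (hi : IsIntegral ℤ y) (hm : minpoly ℤ y = lpol ℤ gL)
    (hθ : IsIntegral ℤ θ) (F : ℤ[X]) (h : (45513961 : K) * θ = aeval y F) :
    ∃ m, m ≠ 0 ∧ lpol (ZMod 45513961) gL ∣ (F.map (Int.castRingHom (ZMod 45513961))) ^ m := by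
  set s := (minpoly ℤ θ).scaleRoots 45513961 with hs
  have h1 : aeval (aeval y F) s = 0 := by
    rw [← h]
    simpa using scaleRoots_aeval_eq_zero (r := (45513961 : ℤ)) (minpoly.aeval ℤ θ)
  rw [← aeval_comp] at h1
  have h2 := minpoly.isIntegrallyClosed_dvd hi h1
  rw [hm] at h2
  have h3 := Polynomial.map_dvd (Int.castRingHom (ZMod 45513961)) h2
  have h0 : (Int.castRingHom (ZMod 45513961)) 45513961 = 0 := by
    have : (((45513961 : ℕ)) : (ZMod 45513961)) = 0 := CharP.cast_eq_zero _ _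
    rw [← this]; simp
  rw [map_lpol, Polynomial.map_comp, hs, map_scaleRoots _ _ _
    (by rw [(minpoly.monic hθ).leadingCoeff]; simp), h0, scaleRoots_zero,
    ((minpoly.monic hθ).map _).leadingCoeff, one_smul, X_pow_comp] at h3
  refine ⟨_, Nat.succ_ne_zero _, h3.trans (pow_dvd_pow _ (Nat.le_succ _))⟩

theorem exists_div {P : ℤ[X]} (h : P.map (Int.castRingHom (ZMod 45513961)) = 0) :
    ∃ H : ℤ[X], P = C 45513961 * H := by
  change (C (45513961 : ℤ)) ∣ P
  rw [C_dvd_iff_dvd_coeff]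
  intro i
  have h1 := congrArg (fun p => coeff p i) h
  simp only [coeff_map, coeff_zero, eq_intCast] at h1
  exact_mod_cast (ZMod.intCast_zmod_eq_zero_iff_dvd _ _).mp h1

theorem lemB {y θ : K} (hi : IsIntegral ℤ y) (hm : minpoly ℤ y = lpol ℤ gL)
    (hθ : IsIntegral ℤ θ) (F : ℤ[X]) (h : (45513961 : K) * θ = aeval y F) :
    lpol (ZMod 45513961) gL ∣ F.map (Int.castRingHom (ZMod 45513961)) := by
  have hq0 : (45513961 : (ZMod 45513961)[X]) = 0 := by
    have := castq; simpa using this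
  have hg : lpol (ZMod 45513961) gL =
      lpol (ZMod 45513961) uL * lpol (ZMod 45513961) uL * lpol (ZMod 45513961) vL := by
    rw [uuv_eq, hq0]; ring
  have hsq : Squarefree (lpol (ZMod 45513961) uL * lpol (ZMod 45513961) vL) := by
    rw [← lpol_lmul]; exact uv_sep.squarefree
  obtain ⟨m, hm0, h1⟩ := lemA hi hm hθ F h
  have h2 : lpol (ZMod 45513961) uL * lpol (ZMod 45513961) vL ∣
      F.map (Int.castRingHom (ZMod 45513961)) := by
    rw [← hsq.dvd_pow_iff_dvd hm0]
    refine dvd_trans ⟨lpol (ZMod 45513961) uL, ?_⟩ h1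
    rw [hg]; ring
  obtain ⟨s, hs⟩ := h2
  obtain ⟨S, rfl⟩ := Polynomial.map_surjective (Int.castRingHom (ZMod 45513961))
    (ZMod.ringHom_surjective _) s
  obtain ⟨H, hH⟩ := exists_div (P := F - lpol ℤ uL * lpol ℤ vL * S) (by
    rw [Polynomial.map_sub, hs, Polynomial.map_mul, Polynomial.map_mul, map_lpol, map_lpol, sub_self])
  have hy : aeval y (lpol ℤ gL) = 0 := by rw [← hm, minpoly.aeval]
  have h3 := congrArg (aeval y) hH
  have h4 := congrArg (aeval y) (uuv_eq ℤ)
  simp only [map_sub, map_mul, map_add, hy, map_ofNat, ← h] at h3 h4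
  have hH' : IsIntegral ℤ (aeval y H) := by
    have hle : Algebra.adjoin ℤ {y} ≤ integralClosure ℤ K :=
      Algebra.adjoin_le (Set.singleton_subset_iff.mpr hi)
    exact hle (aeval_mem_adjoin_singleton ℤ y)
  have h5 : (45513961 : K) * (θ - aeval y H) ^ 2 = aeval y (lpol ℤ tL * lpol ℤ vL * S ^ 2) := by
    have hq : (45513961 : K) ≠ 0 := by norm_num
    apply mul_left_cancel₀ hq
    simp only [map_mul, map_pow]
    have h6 : (45513961 : K) * (θ - aeval y H) =
      aeval y (lpol ℤ uL) * aeval y (lpol ℤ vL) * aeval y S := by linear_combination h3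
    calc _ = ((45513961 : K) * (θ - aeval y H)) ^ 2 := by ring
      _ = _ := by rw [h6]; linear_combination h4 * (aeval y (lpol ℤ vL) * aeval y S ^ 2)
  obtain ⟨k, hk0, h6⟩ := lemA hi hm ((hθ.sub hH').pow 2) _ h5
  have h7 : lpol (ZMod 45513961) uL ∣ S.map (Int.castRingHom (ZMod 45513961)) := by
    have hu : Squarefree (lpol (ZMod 45513961) uL) := hsq.of_mul_left
    rw [← hu.dvd_pow_iff_dvd (two_ne_zero)]
    apply u_cop.dvd_of_dvd_mul_left
    rw [← hu.dvd_pow_iff_dvd hk0]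
    refine dvd_trans ?_ (h6.trans ?_)
    · rw [hg, mul_assoc]; exact dvd_mul_right _ _
    · rw [Polynomial.map_mul, Polynomial.map_mul, Polynomial.map_pow, map_lpol, map_lpol]
  obtain ⟨w, hw⟩ := h7
  refine ⟨w, ?_⟩
  rw [hs, hw, hg]; ring

end dedekind
end M11

namespace M11
section final
variable {K : Type*} [Field K] [NumberField K]

def WW (i j : ℕ) : ℤ := (WL.getD i []).getD j 0

theorem W_tri : ∀ i < 12, ∀ j < 12, i < j → WW i j = 0 := by decide +kernel

theorem W_det : (∏ i ∈ Finset.range 12, WW i i) % 45513961 ≠ 0 := by decide +kernel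

theorem W_len : ∀ i < 12, (WL.getD i []).length ≤ 12 := by decide +kernel

theorem W_inj (v : Fin 12 → ZMod 45513961)
    (h : ∀ j : Fin 12, ∑ i : Fin 12, v i * (WW i j : ZMod 45513961) = 0) : v = 0 := by
  by_contra hv
  set M : Matrix (Fin 12) (Fin 12) ℤ := Matrix.of fun i j => WW i j
  have h1 : (M.map (Int.castRingHom (ZMod 45513961))).det = 0 := by
    refine Matrix.exists_vecMul_eq_zero_iff.mp ⟨v, hv, ?_⟩
    ext j
    exact h j
  have hM : M.IsLowerTriangular := fun i j hij => W_tri i i.2 j j.2 hij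
  rw [← RingHom.mapMatrix_apply, ← RingHom.map_det, Matrix.det_of_isLowerTriangular _ hM, eq_intCast,
    ZMod.intCast_zmod_eq_zero_iff_dvd] at h1
  apply W_det
  rw [Finset.prod_range]
  exact Int.emod_eq_zero_of_dvd (by exact_mod_cast h1)

theorem no_rel {y θ : K} (hi : IsIntegral ℤ y) (hm : minpoly ℤ y = lpol ℤ gL)
    (hθ : IsIntegral ℤ θ) (c : Fin 12 → ℤ) (h : ∑ i, (c i : K) * bf y i = 45513961 * θ) (i : Fin 12) :
    (c i : ZMod 45513961) = 0 := by
  set F : ℤ[X] := ∑ i : Fin 12, C (c i) * lpol ℤ (WL.getD i []) with hF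
  have h1 : (45513961 : K) * (DD * θ) = aeval y F := by
    have h2 (l : List ℤ) : aeval y (lpol ℤ l) = ev y l := by
      rw [aeval_def, eval₂_eq_eval_map, map_lpol, eval_lpol]
    rw [hF, map_sum]
    simp only [map_mul, h2, DD_bb, aeval_C]
    rw [mul_left_comm, ← h, Finset.mul_sum]
    refine Finset.sum_congr rfl fun i _ => ?_
    rw [bf, eq_intCast]; ring
  have h2 := lemB hi hm ((isIntegral_algebraMap (x := DD)).mul hθ) F (by simpa using h1)
  have hd : F.natDegree ≤ 11 := by
    apply natDegree_sum_le_of_forall_le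
    intro i _
    refine (natDegree_C_mul_le _ _).trans (natDegree_lpol _ _ (W_len i i.2))
  have h3 : F.map (Int.castRingHom (ZMod 45513961)) = 0 := by
    apply eq_zero_of_dvd_of_natDegree_lt h2
    rw [deg_gL]
    exact lt_of_le_of_lt (natDegree_map_le.trans hd) (by norm_num)
  have h4 := W_inj (fun i => (c i : ZMod 45513961)) (fun j => by
    have h5 := congrArg (fun p => coeff p (j : ℕ)) h3
    simp only [hF, Polynomial.map_sum, Polynomial.map_mul, Polynomial.map_C, map_lpol,
      finsetSum_coeff, coeff_C_mul, coeff_lpol, coeff_zero] at h5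
    simpa only [eq_intCast, WW] using h5)
  exact congrFun h4 i

theorem discr_eq {y : K} (hy : ev y gL = 0) (hf : Module.finrank ℚ K = 12)
    (hg : Algebra.adjoin ℚ {y} = ⊤) : NumberField.discr K = 45513961 ^ 4 := by
  have hi : IsIntegral ℤ y := integral_gL hy
  have hm := minpoly_int hy hf hg
  have hcard : Fintype.card (Module.Free.ChooseBasisIndex ℤ (NumberField.RingOfIntegers K)) = 12 := by
    rw [← hf, Module.finrank_eq_card_basis (NumberField.integralBasis K)]
  let e := Fintype.equivFinOfCardEq hcard
  let β := (NumberField.RingOfIntegers.basis K).reindex e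
  let w : Fin 12 → K := fun i => NumberField.integralBasis K (e.symm i)
  have hβ (i) : algebraMap (NumberField.RingOfIntegers K) K (β i) = w i := by
    simp only [β, w, Module.Basis.reindex_apply, NumberField.integralBasis_apply]
  let bI : Fin 12 → NumberField.RingOfIntegers K := fun i => ⟨bf y i, bf_integral hy i⟩
  have hbI (i) : algebraMap (NumberField.RingOfIntegers K) K (bI i) = bf y i := rfl
  let P : Matrix (Fin 12) (Fin 12) ℤ := Matrix.of fun i j => β.repr (bI j) i
  have hP (j) : bI j = ∑ i, P i j • β i := (β.sum_repr (bI j)).symm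
  have hP2 (j) : bf y j = ∑ i, (P i j : K) * w i := by
    rw [← hbI, hP, map_sum]
    refine Finset.sum_congr rfl fun i _ => ?_
    rw [map_zsmul, hβ, zsmul_eq_mul]
  have hdw : Algebra.discr ℚ w = NumberField.discr K := by
    rw [NumberField.coe_discr, ← Algebra.discr_reindex ℚ (NumberField.integralBasis K) e]
    rfl
  have hd1 : ((45513961 ^ 4 : ℤ) : ℚ) = ((P.det ^ 2 * NumberField.discr K : ℤ) : ℚ) := by
    rw [Int.cast_mul, Int.cast_pow, Int.cast_pow, ← hdw,
      show ((45513961 : ℤ) : ℚ) = 45513961 by norm_num, ← bf_discr hy hf hg]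
    have h1 : bf y = Matrix.vecMul w
        ((P.map (Int.castRingHom ℚ)).map (algebraMap ℚ K)) := by
      ext j
      rw [hP2]
      simp [Matrix.vecMul, dotProduct, mul_comm]
    rw [h1, Algebra.discr_of_matrix_vecMul, ← RingHom.mapMatrix_apply, ← RingHom.map_det, eq_intCast]
  have hd : (45513961 ^ 4 : ℤ) = P.det ^ 2 * NumberField.discr K := by exact_mod_cast hd1
  have hq : ¬ (45513961 : ℤ) ∣ P.det := by
    intro hq
    have h0 : (P.map (Int.castRingHom (ZMod 45513961))).det = 0 := by
      rw [← RingHom.mapMatrix_apply, ← RingHom.map_det, eq_intCast,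
        ZMod.intCast_zmod_eq_zero_iff_dvd]
      exact_mod_cast hq
    obtain ⟨v, hv, hv0⟩ := Matrix.exists_mulVec_eq_zero_iff.mpr h0
    choose c hc using fun i => ZMod.intCast_surjective (v i)
    have h1 (i) : ∃ t : ℤ, ∑ j, P i j * c j = 45513961 * t := by
      have h2 := congrFun hv0 i
      simp only [Matrix.mulVec, dotProduct, Matrix.map_apply, ← hc, eq_intCast, Pi.zero_apply] at h2
      have h3 : ((∑ j, P i j * c j : ℤ) : ZMod 45513961) = 0 := by push_cast; exact h2
      rw [ZMod.intCast_zmod_eq_zero_iff_dvd] at h3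
      exact_mod_cast h3
    choose t ht using h1
    apply hv
    ext j
    rw [← hc]
    refine no_rel (θ := ∑ i, (t i : K) * w i) hi hm ?_ c ?_ j
    · refine IsIntegral.sum _ fun i _ => IsIntegral.mul ?_ ?_
      · simpa using isIntegral_algebraMap (R := ℤ) (A := K) (x := t i)
      · rw [← hβ]; exact NumberField.RingOfIntegers.isIntegral_coe _
    · simp only [hP2, Finset.mul_sum]
      rw [Finset.sum_comm]
      refine Finset.sum_congr rfl fun i _ => ?_
      have := congrArg (Int.cast (R := K)) (ht i)
      push_cast at this
      rw [← mul_assoc, ← this, Finset.sum_mul]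
      exact Finset.sum_congr rfl fun j _ => by ring
  have hpr : Prime (45513961 : ℤ) := by exact_mod_cast Nat.prime_iff_prime_int.mp prime_q
  have hcop : IsCoprime (P.det) (45513961 : ℤ) := ((Prime.coprime_iff_not_dvd hpr).mpr hq).symm
  have hu : IsUnit (P.det ^ 2) := by
    have h1 : IsCoprime (P.det ^ 2) ((45513961 : ℤ) ^ 4) := hcop.pow
    exact h1.isUnit_of_dvd' dvd_rfl ⟨_, hd⟩
  have h1 : P.det ^ 2 = 1 := by
    rcases Int.isUnit_iff.mp hu with h | h
    · exact h
    · nlinarith [sq_nonneg P.det]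
  rw [h1, one_mul] at hd
  exact hd.symm

theorem setup (K : Type*) [Field K] [NumberField K] (φ : AdjoinRoot f3 ≃ₐ[ℚ] K) :
    ∃ y : K, ev y gL = 0 ∧ Algebra.adjoin ℚ {y} = ⊤ ∧ Module.finrank ℚ K = 12 := by
  set x := φ (AdjoinRoot.root f3) with hx
  have hx0 : aeval x f3 = 0 := by
    rw [hx, show aeval (φ (AdjoinRoot.root f3)) f3 = φ (aeval (AdjoinRoot.root f3) f3) from
      aeval_algHom_apply φ.toAlgHom _ _]
    simp
  refine ⟨20 * x, (ev_iff x).mp hx0, ?_, ?_⟩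
  · have h1 : Algebra.adjoin ℚ {x} = ⊤ := by
      have := congrArg (Subalgebra.map φ.toAlgHom) (AdjoinRoot.adjoinRoot_eq_top (f := f3))
      rw [AlgHom.map_adjoin, Set.image_singleton, Algebra.map_top] at this
      refine this.trans ?_
      exact (AlgHom.range_eq_top _).mpr φ.surjective
    rw [eq_top_iff, ← h1]
    apply Algebra.adjoin_le
    rw [Set.singleton_subset_iff]
    have h2 : x = (1 / 20 : ℚ) • (20 * x) := by
      rw [Algebra.smul_def]; simp
    have h3 := Subalgebra.smul_mem (Algebra.adjoin ℚ {20 * x}) (Algebra.self_mem_adjoin_singleton ℚ (20 * x)) (1 / 20 : ℚ)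
    rw [← h2] at h3
    exact h3
  · rw [← LinearEquiv.finrank_eq φ.toLinearEquiv, (AdjoinRoot.powerBasis f3_ne).finrank,
      AdjoinRoot.powerBasis_dim, f3_deg]

end final
end M11

theorem m11_field_one_ramified_prime :
    Irreducible f3 ∧
    IsSimpleGroup f3.Gal ∧ Nat.card f3.Gal = 7920 ∧
    Nat.Prime 45513961 ∧
    ∀ (K : Type) [Field K] [NumberField K],
      Nonempty (AdjoinRoot f3 ≃ₐ[ℚ] K) →
      Module.finrank ℚ K = 12 ∧
      NumberField.discr K = 45513961 ^ 4 ∧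
      ∀ p : ℕ, p.Prime → (p : ℤ) ∣ NumberField.discr K → p = 45513961 := by
  refine ⟨M11.f3_irred, (M11.f3_group M11.gal_bound).2, (M11.f3_group M11.gal_bound).1,
    M11.prime_q, ?_⟩
  intro K _ _ ⟨φ⟩
  obtain ⟨y, hy, hg, hf⟩ := M11.setup K φ
  have hd := M11.discr_eq hy hf hg
  refine ⟨hf, hd, ?_⟩
  intro p hp hpd
  rw [hd] at hpd
  have h1 : p ∣ 45513961 ^ 4 := by exact_mod_cast hpd
  exact (Nat.prime_dvd_prime_iff_eq hp M11.prime_q).mp (hp.dvd_of_dvd_pow h1)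
end

section
/- Let g₀(x) = (x⁴ + (4/3)x³ + (2/3)x² − 1/11)²·(x⁴ + (22/3)x³ − (8/3)x² − 2x + 13/11) − (440/27)·(x² − 3/11)³·(x³ + x² + (1/11)x − 1/11) ∈ ℚ[x]. Then g₀ is irreducible over ℚ, and the root field K = ℚ[x]/(g₀) is a degree-12 number field with discriminant 5⁴·11¹²·37⁴. -/
open Polynomial

/-- `g₀(x) = (x⁴ + (4/3)x³ + (2/3)x² − 1/11)² (x⁴ + (22/3)x³ − (8/3)x² − 2x + 13/11)
  − (440/27)(x² − 3/11)³(x³ + x² + (1/11)x − 1/11)` over `ℚ`. -/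
noncomputable def g0 : Polynomial ℚ :=
  (X ^ 4 + C (4 / 3 : ℚ) * X ^ 3 + C (2 / 3 : ℚ) * X ^ 2 - C (1 / 11 : ℚ)) ^ 2 *
      (X ^ 4 + C (22 / 3 : ℚ) * X ^ 3 - C (8 / 3 : ℚ) * X ^ 2 - 2 * X + C (13 / 11 : ℚ)) -
    C (440 / 27 : ℚ) * ((X ^ 2 - C (3 / 11 : ℚ)) ^ 3 *
      (X ^ 3 + X ^ 2 + C (1 / 11 : ℚ) * X - C (1 / 11 : ℚ)))



lemma phi_zero_of_integral {K : Type*} [Field K] (θ : K) (F : ℤ[X])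
    (hmin : ∀ a : ℤ[X], aeval θ a = 0 → F ∣ a) {S : Type*} [CommRing S] [IsReduced S]
    (φ : ℤ[X] →+* S) (hF : φ F = 0) (s b : ℤ[X]) (hs : φ s = 0) (y : K) (hy : IsIntegral ℤ y)
    (h : aeval θ s * y = aeval θ b) : φ b = 0 := by
  obtain ⟨q, hq, hqy⟩ := hy
  have hqy' : aeval y q = 0 := hqy
  set n := q.natDegree with hn
  let Q : ℤ[X] := ∑ i ∈ Finset.range (n + 1), C (q.coeff i) * s ^ (n - i) * b ^ i
  have h1 : aeval θ Q = 0 := by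
    have : aeval θ Q = (aeval θ s) ^ n * aeval y q := by
      rw [aeval_eq_sum_range (p := q), Finset.mul_sum, map_sum]
      apply Finset.sum_congr rfl
      intro i hi
      have hi' : i ≤ n := by
        have := Finset.mem_range.mp hi
        omega
      rw [map_mul, map_mul, map_pow, map_pow, ← h, mul_pow, aeval_C, Algebra.smul_def]
      have : aeval θ s ^ n = aeval θ s ^ (n - i) * aeval θ s ^ i := by
        rw [← pow_add]; congr 1; omega
      rw [this]; ring
    rw [this, hqy', mul_zero]
  obtain ⟨w, hw⟩ := hmin Q h1
  have h2 : φ Q = φ b ^ n := by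
    simp only [Q, map_sum, map_mul, map_pow, hs]
    rw [Finset.sum_range_succ, Finset.sum_eq_zero]
    · have : q.coeff n = 1 := hq
      simp [this]
    · intro i hi
      have := Finset.mem_range.mp hi
      rw [zero_pow (by omega)]
      simp
  rw [hw, map_mul, hF, zero_mul] at h2
  exact eq_zero_of_pow_eq_zero h2.symm

lemma lift_dvd (p : ℕ) (g b : ℤ[X])
    (h : g.map (Int.castRingHom (ZMod p)) ∣ b.map (Int.castRingHom (ZMod p))) :
    ∃ u v : ℤ[X], b = g * u + C (p : ℤ) * v := by
  obtain ⟨u', hu⟩ := h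
  obtain ⟨u, rfl⟩ := Polynomial.map_surjective (Int.castRingHom (ZMod p)) (ZMod.ringHom_surjective _) u'
  have : C (p : ℤ) ∣ b - g * u := by
    rw [Polynomial.C_dvd_iff_dvd_coeff]
    intro i
    rw [← ZMod.intCast_zmod_eq_zero_iff_dvd]
    have h2 : (b - g * u).map (Int.castRingHom (ZMod p)) = 0 := by
      rw [Polynomial.map_sub, Polynomial.map_mul, hu, sub_self]
    have h3 : ((b - g * u).map (Int.castRingHom (ZMod p))).coeff i = 0 := by rw [h2, coeff_zero]
    rwa [coeff_map, eq_intCast] at h3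
  obtain ⟨v, hv⟩ := this
  exact ⟨u, v, by rw [← hv]; ring⟩

lemma map_eq_of_lift (p : ℕ) (g b u v : ℤ[X]) (h : b = g * u + C (p : ℤ) * v) :
    b.map (Int.castRingHom (ZMod p)) =
      g.map (Int.castRingHom (ZMod p)) * u.map (Int.castRingHom (ZMod p)) := by
  rw [h]; simp

/-- Dedekind's criterion (sufficiency). -/
lemma dedekind_crit {K : Type*} [Field K] [CharZero K] (θ : K) (F g h F1 : ℤ[X]) (p k : ℕ)
    [Fact p.Prime]
    (hθ : IsIntegral ℤ θ) (hF0 : aeval θ F = 0) (hmin : ∀ a : ℤ[X], aeval θ a = 0 → F ∣ a)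
    (hfac : F = g * h + C (p : ℤ) * F1)
    (a1 b1 e1 : ℤ[X]) (hsep : a1 * g + b1 * derivative g = 1 + C (p : ℤ) * e1)
    (u1 v1 : ℤ[X]) (hnil : g ^ k = F * u1 + C (p : ℤ) * v1)
    (A B D E : ℤ[X]) (hbez : A * g + B * h + D * F1 = 1 + C (p : ℤ) * E)
    (x : K) (hx : IsIntegral ℤ x) (a : ℤ[X]) (hpx : (p : K) * x = aeval θ a) :
    ∃ b : ℤ[X], x = aeval θ b := by
  set m := Polynomial.mapRingHom (Int.castRingHom (ZMod p)) with hm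
  have hp0 : (p : K) ≠ 0 := by
    exact_mod_cast (Fact.out : p.Prime).ne_zero
  have mp : m (C (p : ℤ)) = 0 := by simp [hm]
  have hg_sep : (m g).Separable := by
    refine ⟨m a1, m b1, ?_⟩
    have := congrArg m hsep
    simp only [map_add, map_mul, map_one, mp, zero_mul, add_zero] at this
    rw [hm] at this ⊢
    simp only [coe_mapRingHom, derivative_map] at this ⊢
    exact this
  have hg0 : m g ≠ 0 := hg_sep.ne_zero
  have hrad : (Ideal.span {m g}).IsRadical :=
    (isRadical_iff_span_singleton).mp hg_sep.squarefree.isRadical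
  have : IsReduced ((ZMod p)[X] ⧸ Ideal.span {m g}) :=
    (Ideal.isRadical_iff_quotient_reduced _).mp hrad
  let φ : ℤ[X] →+* ((ZMod p)[X] ⧸ Ideal.span {m g}) := (Ideal.Quotient.mk _).comp m
  have hφ : ∀ b, φ b = 0 ↔ m g ∣ m b := by
    intro b
    simp only [φ, RingHom.comp_apply, Ideal.Quotient.eq_zero_iff_mem, Ideal.mem_span_singleton]
  have mF : m F = m g * m h := by
    rw [hfac]; simp only [map_add, map_mul, mp, zero_mul, add_zero]
  have hφF : φ F = 0 := by rw [hφ, mF]; exact dvd_mul_right _ _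
  have hφg : φ g = 0 := by rw [hφ]
  have hφp : φ (C (p : ℤ)) = 0 := by rw [hφ, mp]; exact dvd_zero _
  have aC : aeval θ (C (p : ℤ)) = (p : K) := by simp
  have hF' : aeval θ g * aeval θ h = - ((p : K) * aeval θ F1) := by
    rw [hfac, map_add, map_mul, map_mul, aC] at hF0
    linear_combination hF0
  -- main step
  have S3 : ∀ y : K, IsIntegral ℤ y → (∃ a : ℤ[X], (p : K) * y = aeval θ a) →
      (∃ b : ℤ[X], aeval θ g * y = aeval θ b) → ∃ b : ℤ[X], y = aeval θ b := by
    rintro y hy ⟨a, ha⟩ ⟨b, hb⟩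
    have h1 : m g ∣ m a := by
      rw [← hφ]
      exact phi_zero_of_integral θ F hmin φ hφF (C (p : ℤ)) a hφp y hy (by rw [aC, ha])
    have h2 : F ∣ g * a - C (p : ℤ) * b := by
      apply hmin
      rw [map_sub, map_mul, map_mul, aC, ← ha, ← hb]; ring
    have h3 : m h ∣ m a := by
      have := map_dvd m h2
      rw [mF, map_sub, map_mul, map_mul, mp, zero_mul, sub_zero] at this
      exact (mul_dvd_mul_iff_left hg0).mp this
    obtain ⟨c, d, hcd⟩ := lift_dvd p h a h3
    have hb' : aeval θ g * y = aeval θ (g * d - F1 * c) := by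
      have : (p : K) * (aeval θ g * y) = (p : K) * aeval θ (g * d - F1 * c) := by
        rw [map_sub, map_mul, map_mul]
        rw [hcd, map_add, map_mul, map_mul, aC] at ha
        linear_combination (aeval θ g) * ha + aeval θ c * hF'
      exact mul_left_cancel₀ hp0 this
    have h4 : m g ∣ m (g * d - F1 * c) := by
      rw [← hφ]
      exact phi_zero_of_integral θ F hmin φ hφF g _ hφg y hy hb'
    have h5 : m g ∣ m F1 * m c := by
      rw [map_sub, map_mul, map_mul] at h4
      exact (dvd_sub_right (dvd_mul_right _ _)).mp h4
    have h6 : m g ∣ m h * m c := by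
      have : m a = m h * m c := by
        rw [hcd]; simp only [map_add, map_mul, mp, zero_mul, add_zero]
      rwa [this] at h1
    have h7 : m g ∣ m c := by
      have hB := congrArg m hbez
      simp only [map_add, map_mul, map_one, mp, zero_mul, add_zero] at hB
      have : m c = m g * (m A * m c) + m B * (m h * m c) + m D * (m F1 * m c) := by
        linear_combination - (m c) * hB
      rw [this]
      exact dvd_add (dvd_add (dvd_mul_right _ _) (Dvd.dvd.mul_left h6 _)) (Dvd.dvd.mul_left h5 _)
    obtain ⟨e, e', he⟩ := lift_dvd p g c h7
    refine ⟨h * e' - F1 * e + d, ?_⟩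
    apply mul_left_cancel₀ hp0
    rw [ha, hcd, he]
    simp only [map_add, map_sub, map_mul, aC]
    linear_combination (aeval θ e) * hF'
  have S4 : ∀ (j : ℕ) (y : K), IsIntegral ℤ y → (∃ a : ℤ[X], (p : K) * y = aeval θ a) →
      (∃ b : ℤ[X], aeval θ g ^ j * y = aeval θ b) → ∃ b : ℤ[X], y = aeval θ b := by
    intro j
    induction j with
    | zero =>
      rintro y - - ⟨b, hb⟩
      exact ⟨b, by simpa using hb⟩
    | succ j ih =>
      rintro y hy ⟨a, ha⟩ ⟨b, hb⟩
      apply S3 y hy ⟨a, ha⟩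
      have hgy : IsIntegral ℤ (aeval θ g * y) := by
        exact (IsIntegral.of_mem_of_fg _ hθ.fg_adjoin_singleton _ (aeval_mem_adjoin_singleton ℤ θ)).mul hy
      apply ih _ hgy ⟨g * a, by rw [map_mul, ← ha]; ring⟩ ⟨b, by rw [← hb]; ring⟩
  apply S4 k x hx ⟨a, hpx⟩
  refine ⟨v1 * a, ?_⟩
  rw [← map_pow, hnil, map_add, map_mul, map_mul, hF0, aC, map_mul, ← hpx]
  ring

lemma index_lemma {K : Type*} [Field K] [NumberField K] (θ : K) (hθ : IsIntegral ℤ θ) (n : ℕ)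
    (F : ℤ[X]) (hFm : F.Monic) (hFd : F.natDegree = n)
    (hmin : ∀ a : ℤ[X], aeval θ a = 0 → F ∣ a)
    (b : Module.Basis (Fin n) ℚ K) (hb : ∀ i, b i = θ ^ (i : ℕ)) :
    ∃ m : ℤ, (NumberField.discr K : ℚ) * (m : ℚ) ^ 2 = Algebra.discr ℚ b ∧
      ∀ p : ℕ, p.Prime → (∀ (x : K) (_ : IsIntegral ℤ x) (a : ℤ[X]),
        (p : K) * x = aeval θ a → ∃ b : ℤ[X], x = aeval θ b) → ¬ ((p : ℤ) ∣ m) := by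
  classical
  have hcard : Fintype.card (Module.Free.ChooseBasisIndex ℤ (NumberField.RingOfIntegers K)) =
      Fintype.card (Fin n) := by
    rw [← Module.finrank_eq_card_basis (NumberField.integralBasis K),
      Module.finrank_eq_card_basis b]
  let e := Fintype.equivOfCardEq hcard
  let w := (NumberField.RingOfIntegers.basis K).reindex e
  let t : Fin n → NumberField.RingOfIntegers K := fun i => ⟨θ, hθ⟩ ^ (i : ℕ)
  let P : Matrix (Fin n) (Fin n) ℤ := fun j i => w.repr (t i) j
  have hPsum : ∀ i, (b i : K) = ∑ j, (P j i : K) * (w j : K) := by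
    intro i
    have h1 : (algebraMap (NumberField.RingOfIntegers K) K) (∑ j, w.repr (t i) j • w j) =
        (algebraMap (NumberField.RingOfIntegers K) K) (t i) := by rw [w.sum_repr]
    rw [hb, map_sum] at *
    simp only [zsmul_eq_mul, map_mul, map_intCast] at h1
    rw [show θ ^ (i : ℕ) = (algebraMap (NumberField.RingOfIntegers K) K) (t i) from by
      simp only [t]; rfl, ← h1]
  refine ⟨P.det, ?_, ?_⟩
  · have h1 : (NumberField.discr K : ℚ) =
        Algebra.discr ℚ ((NumberField.integralBasis K).reindex e) := by
      rw [NumberField.coe_discr, ← Algebra.discr_reindex ℚ (NumberField.integralBasis K) e]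
      congr 1
      ext i
      simp
    have h2 : (b : Fin n → K) = Matrix.vecMul ((NumberField.integralBasis K).reindex e : Fin n → K)
        ((P.map (Int.cast : ℤ → ℚ)).map (algebraMap ℚ K)) := by
      funext i
      rw [hPsum, Matrix.vecMul, dotProduct]
      apply Finset.sum_congr rfl
      intro j _
      simp only [Matrix.map_apply, w, Module.Basis.reindex_apply, NumberField.integralBasis_apply]
      rw [mul_comm]
      simp
    rw [h2, Algebra.discr_of_matrix_vecMul, h1]
    have : (P.map (Int.cast : ℤ → ℚ)).det = (P.det : ℚ) := by
      have := (Int.castRingHom ℚ).map_det P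
      simpa using this.symm
    rw [this]; ring
  · intro p hp hcond hdvd
    have : Fact p.Prime := ⟨hp⟩
    have hdet : (P.map (Int.cast : ℤ → ZMod p)).det = 0 := by
      have h1 := (Int.castRingHom (ZMod p)).map_det P
      have h2 : ((P.det : ℤ) : ZMod p) = 0 := (ZMod.intCast_zmod_eq_zero_iff_dvd _ _).mpr hdvd
      simp only [eq_intCast, h2] at h1
      exact h1.symm
    obtain ⟨v, hv0, hv⟩ := Matrix.exists_mulVec_eq_zero_iff.mpr hdet
    choose c hc using fun i => ZMod.intCast_surjective (v i)
    have hd : ∀ j, (p : ℤ) ∣ ∑ i, P j i * c i := by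
      intro j
      rw [← ZMod.intCast_zmod_eq_zero_iff_dvd]
      have := congrFun hv j
      simp only [Matrix.mulVec, dotProduct, Matrix.map_apply, Pi.zero_apply] at this
      push_cast
      simpa [hc] using this
    choose d hd using hd
    let a : ℤ[X] := ∑ i : Fin n, C (c i) * X ^ (i : ℕ)
    let x : K := ∑ j, (d j : K) * (w j : K)
    have hx : IsIntegral ℤ x :=
      IsIntegral.sum _ fun j _ => (isIntegral_algebraMap (R := ℤ) (x := d j)).mul (w j).2
    have hpx : (p : K) * x = aeval θ a := by
      have h1 : aeval θ a = ∑ i, (c i : K) * b i := by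
        simp only [a, map_sum, map_mul, aeval_C, map_pow, aeval_X, hb]
        simp
      rw [h1]
      simp only [x, hPsum, Finset.mul_sum]
      rw [Finset.sum_comm]
      apply Finset.sum_congr rfl
      intro j _
      have := congrArg (Int.cast : ℤ → K) (hd j)
      push_cast at this
      rw [← mul_assoc, ← this, Finset.sum_mul]
      exact Finset.sum_congr rfl fun i _ => by ring
    obtain ⟨b', hb'⟩ := hcond x hx a hpx
    have h1 : F ∣ a - C (p : ℤ) * b' := by
      apply hmin
      rw [map_sub, map_mul, ← hb', ← hpx]; simp
    have h2 := Polynomial.map_dvd (Int.castRingHom (ZMod p)) h1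
    have h3 : (a - C (p : ℤ) * b').map (Int.castRingHom (ZMod p)) =
        a.map (Int.castRingHom (ZMod p)) := by simp
    rw [h3] at h2
    have hadeg : a.degree < n := by
      apply lt_of_le_of_lt (Polynomial.degree_sum_le _ _)
      rw [Finset.sup_lt_iff (by exact_mod_cast WithBot.bot_lt_coe n)]
      intro i _
      exact lt_of_le_of_lt (degree_C_mul_X_pow_le _ _) (by exact_mod_cast i.2)
    have h4 : a.map (Int.castRingHom (ZMod p)) = 0 := by
      apply Polynomial.eq_zero_of_dvd_of_degree_lt h2
      apply lt_of_le_of_lt degree_map_le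
      rw [hFm.degree_map, Polynomial.degree_eq_natDegree hFm.ne_zero, hFd]
      exact hadeg
    apply hv0
    funext i
    have h5 : (a.map (Int.castRingHom (ZMod p))).coeff i = 0 := by rw [h4, coeff_zero]
    rw [coeff_map] at h5
    have h6 : a.coeff i = c i := by
      simp only [a, finsetSum_coeff, coeff_C_mul, coeff_X_pow]
      rw [Finset.sum_eq_single i]
      · simp
      · intro j _ hj
        have : (i : ℕ) ≠ (j : ℕ) := fun h => hj (Fin.ext h.symm)
        simp [this]
      · simp
    rw [h6, eq_intCast, hc] at h5
    exact h5

/-- A small defining polynomial of the field. -/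
noncomputable def FF : ℤ[X] :=
  X ^ 12 + 3 * X ^ 11 - 11 * X ^ 10 - 99 * X ^ 9 - 561 * X ^ 8 - 1969 * X ^ 7 - 3696 * X ^ 6
    - 4466 * X ^ 5 - 3850 * X ^ 4 - 2013 * X ^ 3 - 517 * X ^ 2 + 55 * X + 165

lemma FF_natDegree : FF.natDegree = 12 := by
  unfold FF; compute_degree!

lemma FF_monic : FF.Monic := by
  unfold FF; monicity!

lemma FF_map11 : FF.map (Int.castRingHom (ZMod 11)) = X ^ 11 * (X + 3) := by
  have h : FF = X ^ 11 * (X + 3) + 11 * (- X ^ 10 - 9 * X ^ 9 - 51 * X ^ 8 - 179 * X ^ 7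
    - 336 * X ^ 6 - 406 * X ^ 5 - 350 * X ^ 4 - 183 * X ^ 3 - 47 * X ^ 2 + 5 * X + 15) := by
    unfold FF; ring
  have h11 : (11 : (ZMod 11)[X]) = 0 := by
    have : ((11 : ℕ) : (ZMod 11)[X]) = 0 := CharP.cast_eq_zero _ 11
    exact_mod_cast this
  rw [h]
  simp [Polynomial.map_mul, Polynomial.map_add, h11]

lemma FF_aux (A B : ℤ[X]) (hB : B.Monic) (h : A * B = FF) (h0 : ¬ (11 : ℤ) ∣ B.coeff 0) :
    B.natDegree ≤ 1 := by
  have hm := FF_map11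
  rw [← h, Polynomial.map_mul] at hm
  have hd : B.map (Int.castRingHom (ZMod 11)) ∣ X ^ 11 * (X + 3) := ⟨_, by rw [← hm, mul_comm]⟩
  have : Fact (Nat.Prime 11) := ⟨by norm_num⟩
  have hX : ¬ (X : (ZMod 11)[X]) ∣ B.map (Int.castRingHom (ZMod 11)) := by
    rw [X_dvd_iff, coeff_map, eq_intCast]
    intro h1
    exact h0 ((ZMod.intCast_zmod_eq_zero_iff_dvd _ _).mp h1)
  have hc : IsCoprime (B.map (Int.castRingHom (ZMod 11))) (X ^ 11) :=
    (((Polynomial.irreducible_X).coprime_iff_not_dvd.mpr hX).symm).pow_right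
  have h2 := hc.dvd_of_dvd_mul_left hd
  have h3 : (X + 3 : (ZMod 11)[X]).natDegree = 1 := by
    rw [show (3 : (ZMod 11)[X]) = C 3 from rfl]
    exact natDegree_X_add_C 3
  have h4 : (X + 3 : (ZMod 11)[X]) ≠ 0 := by
    intro h; rw [h] at h3; simp at h3
  have h5 := natDegree_le_of_dvd h2 h4
  rwa [h3, hB.natDegree_map] at h5

lemma FF_noroot (z : ℤ) : eval z FF ≠ 0 := by
  intro h
  have h1 : ((eval z FF : ℤ) : ZMod 13) = 0 := by rw [h]; rfl
  unfold FF at h1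
  simp only [eval_add, eval_sub, eval_mul, eval_pow, eval_X, eval_ofNat] at h1
  push_cast at h1
  revert h1
  generalize (z : ZMod 13) = y
  revert y
  decide

lemma FF_irreducible : Irreducible FF := by
  rw [Polynomial.Monic.irreducible_iff_natDegree' FF_monic]
  refine ⟨fun h => ?_, ?_⟩
  · have := FF_natDegree
    rw [h] at this; simp at this
  · intro A B hA hB h hmem
    rw [FF_natDegree, Finset.mem_Ioc] at hmem
    have hdeg : A.natDegree + B.natDegree = 12 := by
      rw [← hA.natDegree_mul hB, h, FF_natDegree]
    have h0 : A.coeff 0 * B.coeff 0 = 165 := by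
      rw [← mul_coeff_zero, h]; unfold FF; simp
    by_cases hB0 : (11 : ℤ) ∣ B.coeff 0
    · by_cases hA0 : (11 : ℤ) ∣ A.coeff 0
      · have := mul_dvd_mul hA0 hB0
        rw [h0] at this
        norm_num at this
      · have := FF_aux B A hA (by rw [mul_comm]; exact h) hA0
        omega
    · have h1 := FF_aux A B hB h hB0
      have h2 : B.natDegree = 1 := by omega
      have h3 := hB.eq_X_add_C h2
      apply FF_noroot (- B.coeff 0)
      rw [← h, h3]
      simp

lemma FF_irreducible_rat : Irreducible (FF.map (Int.castRingHom ℚ)) :=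
  (Polynomial.Monic.irreducible_iff_irreducible_map_fraction_map (K := ℚ) FF_monic).mp
    FF_irreducible

/-- If `f` is monic integral, with `f` irreducible over `ℚ` and `f(θ) = 0`. -/
lemma pow_basis_exists {K : Type*} [Field K] [NumberField K] (θ : K) (n : ℕ) (f : ℤ[X])
    (hf : f.Monic) (hd : f.natDegree = n) (hn : Module.finrank ℚ K = n)
    (hirr : Irreducible (f.map (Int.castRingHom ℚ))) (h0 : aeval θ f = 0) :
    ∃ b : Module.Basis (Fin n) ℚ K, (∀ i, b i = θ ^ (i : ℕ)) ∧
      Algebra.discr ℚ b = (-1) ^ (n * (n - 1) / 2) *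
        Algebra.norm ℚ (aeval θ (derivative f)) ∧
      IsIntegral ℤ θ ∧ (∀ a : ℤ[X], aeval θ a = 0 → f ∣ a) := by
  have hint : IsIntegral ℤ θ := ⟨f, hf, h0⟩
  have h0' : aeval θ (f.map (Int.castRingHom ℚ)) = 0 := by
    have := aeval_map_algebraMap ℚ θ f
    rw [h0] at this
    exact this
  have hmp : minpoly ℚ θ = f.map (Int.castRingHom ℚ) :=
    (minpoly.eq_of_irreducible_of_monic hirr h0' (hf.map _)).symm
  have hli := linearIndependent_pow (K := ℚ) θ
  have hnd : (minpoly ℚ θ).natDegree = n := by rw [hmp, hf.natDegree_map, hd]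
  rw [hnd] at hli
  have : NeZero n := ⟨by
    rintro rfl
    have := Module.finrank_pos (R := ℚ) (M := K)
    omega⟩
  let b := basisOfLinearIndependentOfCardEqFinrank hli (by simp [hn])
  have hb : ∀ i, b i = θ ^ (i : ℕ) := by intro i; simp [b]
  let pb : PowerBasis ℚ K := ⟨θ, n, b, hb⟩
  refine ⟨b, hb, ?_, hint, ?_⟩
  · have h := Algebra.discr_powerBasis_eq_norm ℚ pb
    have h1 : pb.gen = θ := rfl
    have h2 : (pb.basis : Fin n → K) = b := rfl
    rw [h1, hn, hmp, derivative_map] at h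
    have h3 := aeval_map_algebraMap ℚ θ (derivative f)
    rw [← h3]
    exact h
  · intro a ha
    have h1 := minpoly.isIntegrallyClosed_dvd hint ha
    have h2 := minpoly.isIntegrallyClosed_eq_field_fractions' ℚ hint
    rw [hmp] at h2
    have h3 : f = minpoly ℤ θ :=
      Polynomial.map_injective (algebraMap ℤ ℚ) (RingHom.injective_int _) h2
    rw [h3]; exact h1

/-- Multiplication by `FF'(θ)` on the power basis. -/
def matR : Matrix (Fin 12) (Fin 12) ℤ :=
  !![55, -1034, -6039, -15400, -22330, -22176, -13783, -4488, -891, -110, 33, 12;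
    -1980, -605, 5170, 18117, 30800, 31262, 22176, 9845, 2244, 297, 22, -3;
    495, -1815, -2156, -869, 6567, 17402, 20174, 16269, 8162, 1947, 264, 31;
    -5115, -1210, 14212, 60247, 118481, 145013, 131978, 81213, 33660, 11231, 2288, 171;
    -28215, -14520, 87197, 358435, 718597, 882167, 777029, 468677, 177144, 50589, 13112, 1775;
    -292875, -125840, 903155, 3660272, 7192185, 8645747, 7442567, 4272004, 1464452, 352869, 70114, 7787;
    -1284855, -721160, 3900039, 16578386, 33640222, 41968927, 37426499, 22775170, 8640511, 2235365, 438526, 46753;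
    -7714245, -3856270, 23450141, 98013828, 196577436, 242439120, 214768015, 129483156, 49003603, 13269058, 2749648, 298267;
    -49214055, -24118930, 150347769, 623861612, 1246341778, 1528637858, 1344833952, 802055738, 296810943, 78532036, 16549995, 1854847;
    -306049755, -151230640, 934836969, 3884154780, 7765022562, 9530088480, 8384152370, 4997027695, 1842624905, 480440796, 98935353, 10985454;
    -1812599910, -910249725, 5528249078, 23048555871, 46178152680, 56826060126, 50132326464, 30014511296, 11159867389, 2930184851, 601280790, 65978991;
    -10886533515, -5441444415, 33200888622, 138343957961, 277067671221, 340840326486, 300684410862, 180044959743, 67028725247, 17691787498, 3655953752, 403343817]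

/-- Triangularising multiplier. -/
def matV : Matrix (Fin 12) (Fin 12) ℤ :=
  !![1, 0, 0, 0, 0, 0, 0, 0, 0, 0, 0, 0;
    36, 1, 0, 0, 0, 0, 0, 0, 0, 0, 0, 0;
    -6435, 681, 3439, 0, 0, 0, 0, 0, 0, 0, 0, 0;
    410190, -8112775, 351347, 3178841, 0, 0, 0, 0, 0, 0, 0, 0;
    8756012595, -23792655095, -17058499491, -11359325807, 3446749319, 0, 0, 0, 0, 0, 0, 0;
    57347579406480, -141326455496545, -41608396991139, -120660260174047, -54321566523035, 8236430465139, 0, 0, 0, 0, 0, 0;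
    796414665352045245, -734422374593362015, -3815799695324398991, -3587286949117589575, -2665353171962586435, 70079010603782315, 56532963268370161, 0, 0, 0, 0, 0;
    1885138840601656212540, -3407586602815764501605, -3673787968401344532497, -10561789430680023040945, -4734385231288878841225, -189751504106399858645, -150820150968959271203, 57295549744994837035, 0, 0, 0, 0;
    25952407863700977652983165, -36395244816044468765267670, -74031086914850391176016122, -151627947430634304977195838, -129611566136693336268662826, -24830465470699066823919824, -4081908109794294159425408, -810569622394105736677989, 472207119381775650024698, 0, 0, 0;
    -9673483676421332250187792065, 21625137115106399072148214440, 17929452403303782570800581692, 29876762838346165038795355792, 255955236888216697713614084, -41025306593826819420213487430, -9648317442112888354595211498, -1277692717920576846183884765, -676715228255320544778253054, 220153074607511724462291012, 0, 0;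
    4274013444887522847914997135795, -3256496480785834048471400097450, -15689054362771826394409872332226, -32443329140140643525967292285302, -40430491505249689584449540965738, -19678281571587940289075731145612, -8407456170696726226866274394716, -1902149881575069020174750473311, -106488393818455089573335063278, -48842954843860223954168485844, 29093016924284915243651130204, 0;
    964566498418240145650654611375570, -502457837496493254364537504955285, -2595294233823270024890152144186031, -9559671420816389201955083735071069, -14318937947069283802840787216013909, -13826279577905079142874621195905105, -9705983236820586723713928636658299, -3144934991266488222173427103576683, -567152206875880359131521599148002, -89087539013292963017721853568210, 12540627198229814544885520281440, 6767954290877674103952060792586]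

/-- Triangular result. -/
def matT : Matrix (Fin 12) (Fin 12) ℤ :=
  !![55, -1034, -6039, -15400, -22330, -22176, -13783, -4488, -891, -110, 33, 12;
    0, -37829, -212234, -536283, -773080, -767074, -474012, -151723, -29832, -3663, 1210, 429;
    0, 0, 34967251, 108448186, 187252263, 223837460, 173173847, 91533816, 35330867, 7605840, 710523, 27346;
    0, 0, 0, 37914242509, 119906543570, 204369464937, 241062604706, 182168075881, 91296935884, 33931020805, 7200999036, 583734173;
    0, 0, 0, 0, 90600735116529, 158527266214790, 186594865521966, 141826801661358, 27792256600449, 5548534702832, 14465705762233, 3823171960432;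
    0, 0, 0, 0, 0, -621862595952071771, -1597631718389700114, -2398048551424293306, -2330147865708292410, -1326121869004339979, -423047298601669456, -53094311023469683;
    0, 0, 0, 0, 0, 0, -11344518849508977732930, -26482343457513695521154, -35300569170413850816986, -31760944578048165352422, -14448376058505669631593, -2262166608721987455048;
    0, 0, 0, 0, 0, 0, 0, -5194278313199532150271678, -6846279880013650370440542, -10337092794647463191646134, -9125471434740108593413686, -1730160524246731843532211;
    0, 0, 0, 0, 0, 0, 0, 0, 29867433788419090618717480628, 23779448448764744697193135024, -10621839889750627726445082265, -7953753245057539850154406809;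
    0, 0, 0, 0, 0, 0, 0, 0, 0, 19734763146973267506943349988380, 37200900625543750829444856228545, 17570944162315371708094988224935;
    0, 0, 0, 0, 0, 0, 0, 0, 0, 0, -6886393490968033400771221856456255, -5948160073579147564845703436816015;
    0, 0, 0, 0, 0, 0, 0, 0, 0, 0, 0, -14774263415766545361199586496364915]

lemma matVR : matV * matR = matT := by
  decide +kernel

lemma matV_det : matV.det = ∏ i, matV i i := by
  apply Matrix.det_of_isLowerTriangular
  have h : ∀ i j : Fin 12, i < j → (matV i j).natAbs = 0 := by decide +kernel
  intro i j hij
  exact Int.natAbs_eq_zero.mp (h i j hij)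

lemma matT_det : matT.det = ∏ i, matT i i := by
  apply Matrix.det_of_isUpperTriangular
  have h : ∀ i j : Fin 12, j < i → (matT i j).natAbs = 0 := by decide +kernel
  intro i j hij
  exact Int.natAbs_eq_zero.mp (h i j hij)

lemma matR_det : matR.det = 26689507503059722590326250525102815661581465347680625 := by
  have h1 : (∏ i, matV i i) * matR.det = ∏ i, matT i i := by
    rw [← matV_det, ← matT_det, ← matVR, Matrix.det_mul]
  have h2 : (∏ i, matT i i) = (∏ i, matV i i) * 26689507503059722590326250525102815661581465347680625 := by decide +kernel
  have h3 : (∏ i, matV i i) ≠ 0 := by decide +kernel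
  rw [h2] at h1
  exact mul_left_cancel₀ h3 h1

lemma FF_aeval {K : Type*} [Field K] (θ : K) : aeval θ FF = θ ^ 12 + 3 * θ ^ 11 - 11 * θ ^ 10 - 99 * θ ^ 9 - 561 * θ ^ 8 - 1969 * θ ^ 7 - 3696 * θ ^ 6
    - 4466 * θ ^ 5 - 3850 * θ ^ 4 - 2013 * θ ^ 3 - 517 * θ ^ 2 + 55 * θ + 165 := by
  unfold FF
  simp only [map_add, map_sub, map_mul, map_pow, aeval_X, map_ofNat]

lemma FF_deriv_aeval {K : Type*} [Field K] (θ : K) : aeval θ (derivative FF) =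
    12 * θ ^ 11 + 33 * θ ^ 10 - 110 * θ ^ 9 - 891 * θ ^ 8 - 4488 * θ ^ 7 - 13783 * θ ^ 6
    - 22176 * θ ^ 5 - 22330 * θ ^ 4 - 15400 * θ ^ 3 - 6039 * θ ^ 2 - 1034 * θ + 55 := by
  unfold FF
  simp only [derivative_add, derivative_sub, derivative_mul, derivative_X_pow, derivative_X,
    derivative_ofNat, map_add, map_sub, map_mul, map_pow, aeval_X, map_ofNat, map_natCast, map_zero,
    map_one]
  simp
  ring

lemma FF_rows {K : Type*} [Field K] [Algebra ℚ K] (θ : K) (h : aeval θ FF = 0) (j : Fin 12) :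
    aeval θ (derivative FF) * θ ^ (j : ℕ) = ∑ i : Fin 12, (matR j i : ℚ) • θ ^ (i : ℕ) := by
  rw [FF_aeval] at h
  rw [FF_deriv_aeval]
  have h0 : (12 * θ ^ 11 + 33 * θ ^ 10 - 110 * θ ^ 9 - 891 * θ ^ 8 - 4488 * θ ^ 7 - 13783 * θ ^ 6
    - 22176 * θ ^ 5 - 22330 * θ ^ 4 - 15400 * θ ^ 3 - 6039 * θ ^ 2 - 1034 * θ + 55) * θ ^ 0 =
    12 * θ ^ 11 + 33 * θ ^ 10 - 110 * θ ^ 9 - 891 * θ ^ 8 - 4488 * θ ^ 7 - 13783 * θ ^ 6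
    - 22176 * θ ^ 5 - 22330 * θ ^ 4 - 15400 * θ ^ 3 - 6039 * θ ^ 2 - 1034 * θ + 55 := by
    ring
  have h1 : (12 * θ ^ 11 + 33 * θ ^ 10 - 110 * θ ^ 9 - 891 * θ ^ 8 - 4488 * θ ^ 7 - 13783 * θ ^ 6
    - 22176 * θ ^ 5 - 22330 * θ ^ 4 - 15400 * θ ^ 3 - 6039 * θ ^ 2 - 1034 * θ + 55) * θ ^ 1 =
    -3 * θ ^ 11 + 22 * θ ^ 10 + 297 * θ ^ 9 + 2244 * θ ^ 8 + 9845 * θ ^ 7 + 22176 * θ ^ 6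
    + 31262 * θ ^ 5 + 30800 * θ ^ 4 + 18117 * θ ^ 3 + 5170 * θ ^ 2 - 605 * θ - 1980 := by
    linear_combination θ * h0 + (12) * h
  have h2 : (12 * θ ^ 11 + 33 * θ ^ 10 - 110 * θ ^ 9 - 891 * θ ^ 8 - 4488 * θ ^ 7 - 13783 * θ ^ 6
    - 22176 * θ ^ 5 - 22330 * θ ^ 4 - 15400 * θ ^ 3 - 6039 * θ ^ 2 - 1034 * θ + 55) * θ ^ 2 =
    31 * θ ^ 11 + 264 * θ ^ 10 + 1947 * θ ^ 9 + 8162 * θ ^ 8 + 16269 * θ ^ 7 + 20174 * θ ^ 6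
    + 17402 * θ ^ 5 + 6567 * θ ^ 4 - 869 * θ ^ 3 - 2156 * θ ^ 2 - 1815 * θ + 495 := by
    linear_combination θ * h1 + (-3) * h
  have h3 : (12 * θ ^ 11 + 33 * θ ^ 10 - 110 * θ ^ 9 - 891 * θ ^ 8 - 4488 * θ ^ 7 - 13783 * θ ^ 6
    - 22176 * θ ^ 5 - 22330 * θ ^ 4 - 15400 * θ ^ 3 - 6039 * θ ^ 2 - 1034 * θ + 55) * θ ^ 3 =
    171 * θ ^ 11 + 2288 * θ ^ 10 + 11231 * θ ^ 9 + 33660 * θ ^ 8 + 81213 * θ ^ 7 + 131978 * θ ^ 6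
    + 145013 * θ ^ 5 + 118481 * θ ^ 4 + 60247 * θ ^ 3 + 14212 * θ ^ 2 - 1210 * θ - 5115 := by
    linear_combination θ * h2 + (31) * h
  have h4 : (12 * θ ^ 11 + 33 * θ ^ 10 - 110 * θ ^ 9 - 891 * θ ^ 8 - 4488 * θ ^ 7 - 13783 * θ ^ 6
    - 22176 * θ ^ 5 - 22330 * θ ^ 4 - 15400 * θ ^ 3 - 6039 * θ ^ 2 - 1034 * θ + 55) * θ ^ 4 =
    1775 * θ ^ 11 + 13112 * θ ^ 10 + 50589 * θ ^ 9 + 177144 * θ ^ 8 + 468677 * θ ^ 7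
    + 777029 * θ ^ 6 + 882167 * θ ^ 5 + 718597 * θ ^ 4 + 358435 * θ ^ 3 + 87197 * θ ^ 2
    - 14520 * θ - 28215 := by
    linear_combination θ * h3 + (171) * h
  have h5 : (12 * θ ^ 11 + 33 * θ ^ 10 - 110 * θ ^ 9 - 891 * θ ^ 8 - 4488 * θ ^ 7 - 13783 * θ ^ 6
    - 22176 * θ ^ 5 - 22330 * θ ^ 4 - 15400 * θ ^ 3 - 6039 * θ ^ 2 - 1034 * θ + 55) * θ ^ 5 =
    7787 * θ ^ 11 + 70114 * θ ^ 10 + 352869 * θ ^ 9 + 1464452 * θ ^ 8 + 4272004 * θ ^ 7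
    + 7442567 * θ ^ 6 + 8645747 * θ ^ 5 + 7192185 * θ ^ 4 + 3660272 * θ ^ 3 + 903155 * θ ^ 2
    - 125840 * θ - 292875 := by
    linear_combination θ * h4 + (1775) * h
  have h6 : (12 * θ ^ 11 + 33 * θ ^ 10 - 110 * θ ^ 9 - 891 * θ ^ 8 - 4488 * θ ^ 7 - 13783 * θ ^ 6
    - 22176 * θ ^ 5 - 22330 * θ ^ 4 - 15400 * θ ^ 3 - 6039 * θ ^ 2 - 1034 * θ + 55) * θ ^ 6 =
    46753 * θ ^ 11 + 438526 * θ ^ 10 + 2235365 * θ ^ 9 + 8640511 * θ ^ 8 + 22775170 * θ ^ 7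
    + 37426499 * θ ^ 6 + 41968927 * θ ^ 5 + 33640222 * θ ^ 4 + 16578386 * θ ^ 3
    + 3900039 * θ ^ 2 - 721160 * θ - 1284855 := by
    linear_combination θ * h5 + (7787) * h
  have h7 : (12 * θ ^ 11 + 33 * θ ^ 10 - 110 * θ ^ 9 - 891 * θ ^ 8 - 4488 * θ ^ 7 - 13783 * θ ^ 6
    - 22176 * θ ^ 5 - 22330 * θ ^ 4 - 15400 * θ ^ 3 - 6039 * θ ^ 2 - 1034 * θ + 55) * θ ^ 7 =
    298267 * θ ^ 11 + 2749648 * θ ^ 10 + 13269058 * θ ^ 9 + 49003603 * θ ^ 8 + 129483156 * θ ^ 7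
    + 214768015 * θ ^ 6 + 242439120 * θ ^ 5 + 196577436 * θ ^ 4 + 98013828 * θ ^ 3
    + 23450141 * θ ^ 2 - 3856270 * θ - 7714245 := by
    linear_combination θ * h6 + (46753) * h
  have h8 : (12 * θ ^ 11 + 33 * θ ^ 10 - 110 * θ ^ 9 - 891 * θ ^ 8 - 4488 * θ ^ 7 - 13783 * θ ^ 6
    - 22176 * θ ^ 5 - 22330 * θ ^ 4 - 15400 * θ ^ 3 - 6039 * θ ^ 2 - 1034 * θ + 55) * θ ^ 8 =
    1854847 * θ ^ 11 + 16549995 * θ ^ 10 + 78532036 * θ ^ 9 + 296810943 * θ ^ 8 + 802055738 * θ ^ 7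
    + 1344833952 * θ ^ 6 + 1528637858 * θ ^ 5 + 1246341778 * θ ^ 4 + 623861612 * θ ^ 3
    + 150347769 * θ ^ 2 - 24118930 * θ - 49214055 := by
    linear_combination θ * h7 + (298267) * h
  have h9 : (12 * θ ^ 11 + 33 * θ ^ 10 - 110 * θ ^ 9 - 891 * θ ^ 8 - 4488 * θ ^ 7 - 13783 * θ ^ 6
    - 22176 * θ ^ 5 - 22330 * θ ^ 4 - 15400 * θ ^ 3 - 6039 * θ ^ 2 - 1034 * θ + 55) * θ ^ 9 =
    10985454 * θ ^ 11 + 98935353 * θ ^ 10 + 480440796 * θ ^ 9 + 1842624905 * θ ^ 8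
    + 4997027695 * θ ^ 7 + 8384152370 * θ ^ 6 + 9530088480 * θ ^ 5 + 7765022562 * θ ^ 4
    + 3884154780 * θ ^ 3 + 934836969 * θ ^ 2 - 151230640 * θ - 306049755 := by
    linear_combination θ * h8 + (1854847) * h
  have h10 : (12 * θ ^ 11 + 33 * θ ^ 10 - 110 * θ ^ 9 - 891 * θ ^ 8 - 4488 * θ ^ 7 - 13783 * θ ^ 6
    - 22176 * θ ^ 5 - 22330 * θ ^ 4 - 15400 * θ ^ 3 - 6039 * θ ^ 2 - 1034 * θ + 55) * θ ^ 10 =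
    65978991 * θ ^ 11 + 601280790 * θ ^ 10 + 2930184851 * θ ^ 9 + 11159867389 * θ ^ 8
    + 30014511296 * θ ^ 7 + 50132326464 * θ ^ 6 + 56826060126 * θ ^ 5 + 46178152680 * θ ^ 4
    + 23048555871 * θ ^ 3 + 5528249078 * θ ^ 2 - 910249725 * θ - 1812599910 := by
    linear_combination θ * h9 + (10985454) * h
  have h11 : (12 * θ ^ 11 + 33 * θ ^ 10 - 110 * θ ^ 9 - 891 * θ ^ 8 - 4488 * θ ^ 7 - 13783 * θ ^ 6
    - 22176 * θ ^ 5 - 22330 * θ ^ 4 - 15400 * θ ^ 3 - 6039 * θ ^ 2 - 1034 * θ + 55) * θ ^ 11 =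
    403343817 * θ ^ 11 + 3655953752 * θ ^ 10 + 17691787498 * θ ^ 9 + 67028725247 * θ ^ 8
    + 180044959743 * θ ^ 7 + 300684410862 * θ ^ 6 + 340840326486 * θ ^ 5 + 277067671221 * θ ^ 4
    + 138343957961 * θ ^ 3 + 33200888622 * θ ^ 2 - 5441444415 * θ - 10886533515 := by
    linear_combination θ * h10 + (65978991) * h
  fin_cases j
  · simp only [Fin.sum_univ_succ, Algebra.smul_def, matR]
    simp
    linear_combination h0
  · simp only [Fin.sum_univ_succ, Algebra.smul_def, matR]
    simp
    linear_combination h1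
  · simp only [Fin.sum_univ_succ, Algebra.smul_def, matR]
    simp
    linear_combination h2
  · simp only [Fin.sum_univ_succ, Algebra.smul_def, matR]
    simp
    linear_combination h3
  · simp only [Fin.sum_univ_succ, Algebra.smul_def, matR]
    simp
    linear_combination h4
  · simp only [Fin.sum_univ_succ, Algebra.smul_def, matR]
    simp
    linear_combination h5
  · simp only [Fin.sum_univ_succ, Algebra.smul_def, matR]
    simp
    linear_combination h6
  · simp only [Fin.sum_univ_succ, Algebra.smul_def, matR]
    simp
    linear_combination h7
  · simp only [Fin.sum_univ_succ, Algebra.smul_def, matR]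
    simp
    linear_combination h8
  · simp only [Fin.sum_univ_succ, Algebra.smul_def, matR]
    simp
    linear_combination h9
  · simp only [Fin.sum_univ_succ, Algebra.smul_def, matR]
    simp
    linear_combination h10
  · simp only [Fin.sum_univ_succ, Algebra.smul_def, matR]
    simp
    linear_combination h11

lemma FF_norm {K : Type*} [Field K] [Algebra ℚ K] (θ : K) (h : aeval θ FF = 0)
    (b : Module.Basis (Fin 12) ℚ K) (hb : ∀ i, b i = θ ^ (i : ℕ)) :
    Algebra.norm ℚ (aeval θ (derivative FF)) = (26689507503059722590326250525102815661581465347680625 : ℤ) := by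
  rw [Algebra.norm_eq_matrix_det b, ← matR_det]
  have h1 : Algebra.leftMulMatrix b (aeval θ (derivative FF)) =
      (matR.map (Int.castRingHom ℚ)).transpose := by
    ext i j
    rw [Algebra.leftMulMatrix_eq_repr_mul, hb, FF_rows θ h j]
    simp only [← hb, map_sum, map_smul, Module.Basis.repr_self]
    simp [Finsupp.single_apply]
  rw [h1, Matrix.det_transpose]
  exact ((Int.castRingHom ℚ).map_det matR).symm

lemma theta_root {K : Type*} [Field K] [CharZero K] (δ θ : K)
    (hM : δ ^ 12 + 5 * δ ^ 11 - 44 * δ ^ 10 - 264 * δ ^ 9 + 308 * δ ^ 8 + 3278 * δ ^ 7 + 253 * δ ^ 6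
    - 17413 * δ ^ 5 - 12859 * δ ^ 4 + 13662 * δ ^ 3 - 37125 * δ ^ 2 - 91283 * δ - 40769 = 0)
    (e1 : 2381643 * θ =
    4243 * δ ^ 11 + 6300 * δ ^ 10 - 211550 * δ ^ 9 - 376457 * δ ^ 8 + 2763132 * δ ^ 7
    + 4235531 * δ ^ 6 - 15545802 * δ ^ 5 - 19266754 * δ ^ 4 + 22429927 * δ ^ 3
    - 22373681 * δ ^ 2 - 91695899 * δ - 43136443) :
    aeval θ FF = 0 := by
  rw [FF_aeval]
  have e2 : 2381643 * θ ^ 2 =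
    -21445 * δ ^ 11 - 46314 * δ ^ 10 + 1077626 * δ ^ 9 + 2601227 * δ ^ 8 - 14112249 * δ ^ 7
    - 30268145 * δ ^ 6 + 81971616 * δ ^ 5 + 140496811 * δ ^ 4 - 130290034 * δ ^ 3
    + 80507162 * δ ^ 2 + 575484965 * δ + 302455993 := by
    linear_combination (2381643 / 2381643 * θ ^ 1) * e1 + ((2381643 / 2381643 / 2381643) *
    (4243 * δ ^ 11 + 6300 * δ ^ 10 - 211550 * δ ^ 9 - 376457 * δ ^ 8 + 2763132 * δ ^ 7
    + 4235531 * δ ^ 6 - 15545802 * δ ^ 5 - 19266754 * δ ^ 4 + 22429927 * δ ^ 3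
    - 22373681 * δ ^ 2 - 91695899 * δ - 43136443)) * e1 +
    2381643 * ((18003049 * δ ^ 10 - 36553445 * δ ^ 9 - 780621919 * δ ^ 8 + 1187418849 * δ ^ 7
    + 7978475199 * δ ^ 6 - 11448530851 * δ ^ 5 - 28442150011 * δ ^ 4 + 28852891567 * δ ^ 3
    - 4451188072 * δ ^ 2 - 97791389001 * δ - 27972491750) / 5672223379449) * hM
  have e3 : 2381643 * θ ^ 3 =
    -5614 * δ ^ 11 + 9306 * δ ^ 10 + 266501 * δ ^ 9 - 356668 * δ ^ 8 - 3305904 * δ ^ 7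
    + 5312932 * δ ^ 6 + 13998846 * δ ^ 5 - 25474304 * δ ^ 4 + 2443757 * δ ^ 3 + 49487303 * δ ^ 2
    - 14547565 * δ - 26130263 := by
    linear_combination (2381643 / 2381643 * θ ^ 2) * e1 + ((2381643 / 2381643 / 2381643) *
    (4243 * δ ^ 11 + 6300 * δ ^ 10 - 211550 * δ ^ 9 - 376457 * δ ^ 8 + 2763132 * δ ^ 7
    + 4235531 * δ ^ 6 - 15545802 * δ ^ 5 - 19266754 * δ ^ 4 + 22429927 * δ ^ 3
    - 22373681 * δ ^ 2 - 91695899 * δ - 43136443)) * e2 +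
    2381643 * ((-90991135 * δ ^ 10 + 123341873 * δ ^ 9 + 4196959363 * δ ^ 8 - 3882517017 * δ ^ 7
    - 48616137840 * δ ^ 6 + 48419867320 * δ ^ 5 + 197999361796 * δ ^ 4 - 158188862818 * δ ^ 3
    - 29521227854 * δ ^ 2 + 575209137033 * δ + 318493039910) / 5672223379449) * hM
  have e4 : 2381643 * θ ^ 4 =
    253324 * δ ^ 11 + 555264 * δ ^ 10 - 12724748 * δ ^ 9 - 31115033 * δ ^ 8 + 166377147 * δ ^ 7
    + 362229713 * δ ^ 6 - 966829638 * δ ^ 5 - 1685589634 * δ ^ 4 + 1541380012 * δ ^ 3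
    - 909608687 * δ ^ 2 - 6873840293 * δ - 3637112344 := by
    linear_combination (2381643 / 2381643 * θ ^ 2) * e2 + ((2381643 / 2381643 / 2381643) *
    (-21445 * δ ^ 11 - 46314 * δ ^ 10 + 1077626 * δ ^ 9 + 2601227 * δ ^ 8 - 14112249 * δ ^ 7
    - 30268145 * δ ^ 6 + 81971616 * δ ^ 5 + 140496811 * δ ^ 4 - 130290034 * δ ^ 3
    + 80507162 * δ ^ 2 + 575484965 * δ + 302455993)) * e2 +
    2381643 * ((459888025 * δ ^ 10 - 313032665 * δ ^ 9 - 22274156119 * δ ^ 8 + 7622814777 * δ ^ 7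
    + 283142622549 * δ ^ 6 - 160095529477 * δ ^ 5 - 1319770220533 * δ ^ 4 + 785803031725 * δ ^ 3
    + 569214674189 * δ ^ 2 - 3440556153558 * δ - 2456325415289) / 5672223379449) * hM
  have w2 : 793881 * (θ ^ 4 + 3 * θ ^ 3 - 11 * θ ^ 2 - 99 * θ - 561) =
    17440 * δ ^ 11 + 156312 * δ ^ 10 - 945227 * δ ^ 9 - 7843097 * δ ^ 8 + 12714702 * δ ^ 7
    + 97266845 * δ ^ 6 - 95828826 * δ ^ 5 - 466689607 * δ ^ 4 + 253779628 * δ ^ 3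
    + 189422953 * δ ^ 2 - 1389974534 * δ - 1369370974 := by
    linear_combination 793881 * ((-99 / 2381643) * e1 + (-11 / 2381643) * e2 + (3 / 2381643) * e3 + (1 / 2381643) * e4)
  have w1 : 2381643 * ((θ ^ 4 + 3 * θ ^ 3 - 11 * θ ^ 2 - 99 * θ - 561) * θ ^ 4 + (-1969 * θ ^ 3 - 3696 * θ ^ 2 - 4466 * θ - 3850)) =
    -5549263 * δ ^ 11 - 8886114 * δ ^ 10 + 277916510 * δ ^ 9 + 523563473 * δ ^ 8
    - 3668008236 * δ ^ 7 - 5931736040 * δ ^ 6 + 21234976086 * δ ^ 5 + 26589475168 * δ ^ 4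
    - 34140044506 * δ ^ 3 + 32274215444 * δ ^ 2 + 126046999475 * δ + 44723071885 := by
    linear_combination (2381643 / 793881 * θ ^ 4) * w2 + (2381643 / 793881 / 2381643) *
    (17440 * δ ^ 11 + 156312 * δ ^ 10 - 945227 * δ ^ 9 - 7843097 * δ ^ 8 + 12714702 * δ ^ 7
    + 97266845 * δ ^ 6 - 95828826 * δ ^ 5 - 466689607 * δ ^ 4 + 253779628 * δ ^ 3
    + 189422953 * δ ^ 2 - 1389974534 * δ - 1369370974) * e4 + 2381643 * ((-4466 / 2381643) * e1 + (-3696 / 2381643) * e2 + (-1969 / 2381643) * e3) +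
    2381643 * ((4417970560 * δ ^ 10 + 27191532448 * δ ^ 9 - 316140820900 * δ ^ 8 - 1099896454200 * δ ^ 7
    + 6338805325212 * δ ^ 6 + 6828528674615 * δ ^ 5 - 44013040530643 * δ ^ 4
    + 6519848682895 * δ ^ 3 + 46746975372179 * δ ^ 2 - 86459725695744 * δ - 104101031990402) / 1890741126483) * hM
  linear_combination (1 / 2381643 * θ ^ 4) * w1 + (1 / 2381643 / 2381643) *
    (-5549263 * δ ^ 11 - 8886114 * δ ^ 10 + 277916510 * δ ^ 9 + 523563473 * δ ^ 8
    - 3668008236 * δ ^ 7 - 5931736040 * δ ^ 6 + 21234976086 * δ ^ 5 + 26589475168 * δ ^ 4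
    - 34140044506 * δ ^ 3 + 32274215444 * δ ^ 2 + 126046999475 * δ + 44723071885) * e4 + ((55 / 2381643) * e1 + (-517 / 2381643) * e2 + (-2013 / 2381643) * e3) +
    ((-1405761500212 * δ ^ 10 + 1696435587692 * δ ^ 9 + 65746072088080 * δ ^ 8
    - 52520941675077 * δ ^ 7 - 785409522968082 * δ ^ 6 + 721160348411767 * δ ^ 5
    + 3370371023174554 * δ ^ 4 - 2855244599804347 * δ ^ 3 - 565220838011594 * δ ^ 2
    + 9854212475284632 * δ + 3996043398865664) / 5672223379449) * hM

/-- Minimal polynomial of `δ`. -/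
noncomputable def MM : ℤ[X] :=
  X ^ 12 + 5 * X ^ 11 - 44 * X ^ 10 - 264 * X ^ 9 + 308 * X ^ 8 + 3278 * X ^ 7 + 253 * X ^ 6
    - 17413 * X ^ 5 - 12859 * X ^ 4 + 13662 * X ^ 3 - 37125 * X ^ 2 - 91283 * X - 40769

lemma MM_natDegree : MM.natDegree = 12 := by
  unfold MM; compute_degree!

lemma MM_monic : MM.Monic := by
  unfold MM; monicity!

lemma MM_aeval {K : Type*} [Field K] (δ : K) : aeval δ MM = δ ^ 12 + 5 * δ ^ 11 - 44 * δ ^ 10 - 264 * δ ^ 9 + 308 * δ ^ 8 + 3278 * δ ^ 7 + 253 * δ ^ 6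
    - 17413 * δ ^ 5 - 12859 * δ ^ 4 + 13662 * δ ^ 3 - 37125 * δ ^ 2 - 91283 * δ - 40769 := by
  unfold MM
  simp only [map_add, map_sub, map_mul, map_pow, aeval_X, map_ofNat]

lemma MM_deriv : derivative MM = 12 * X ^ 11 + 55 * X ^ 10 - 440 * X ^ 9 - 2376 * X ^ 8 + 2464 * X ^ 7 + 22946 * X ^ 6
    + 1518 * X ^ 5 - 87065 * X ^ 4 - 51436 * X ^ 3 + 40986 * X ^ 2 - 74250 * X - 91283 := by
  unfold MM
  simp only [derivative_add, derivative_sub, derivative_mul, derivative_X_pow, derivative_X,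
    derivative_ofNat]
  simp
  ring

lemma MM_bez : ∃ A B : ℤ[X], A * MM + B * derivative MM = 11542974577178715 := by
  refine ⟨252851909640 * X ^ 10 + 376590068678 * X ^ 9 - 10443713620577 * X ^ 8 - 17749954709678 * X ^ 7
    + 107125413981246 * X ^ 6 + 152072223523522 * X ^ 5 - 441332528139959 * X ^ 4
    - 469146383693070 * X ^ 3 + 378511008654193 * X ^ 2 - 308356150127696 * X - 617193055471649,
    -21070992470 * X ^ 11 - 40162085919 * X ^ 10 + 1051993778341 * X ^ 9 + 2307978021460 * X ^ 8
    - 13660447432008 * X ^ 7 - 26820789081547 * X ^ 6 + 78038852319969 * X ^ 5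
    + 125601191408273 * X ^ 4 - 119792239600319 * X ^ 3 + 82275916011106 * X ^ 2
    + 530797978980277 * X + 275525571069602, ?_⟩
  rw [MM_deriv, MM]
  ring

set_option maxHeartbeats 2000000 in
lemma FF_max_5 {K : Type*} [Field K] [CharZero K] (θ : K) (hθ : IsIntegral ℤ θ)
    (h0 : aeval θ FF = 0) (hmin : ∀ a : ℤ[X], aeval θ a = 0 → FF ∣ a)
    (x : K) (hx : IsIntegral ℤ x) (a : ℤ[X]) (hpx : ((5 : ℕ) : K) * x = aeval θ a) :
    ∃ b : ℤ[X], x = aeval θ b := by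
  have : Fact (Nat.Prime 5) := ⟨by norm_num⟩
  have hC : (C (((5 : ℕ) : ℤ)) : ℤ[X]) = 5 := rfl
  refine dedekind_crit θ FF (X ^ 8 - 2 * X ^ 7 + X ^ 5 + 2 * X ^ 3 + X ^ 2 + X)
    (X ^ 4 - X ^ 2 - 2 * X)
    (X ^ 11 - 2 * X ^ 10 - 20 * X ^ 9 - 113 * X ^ 8 - 394 * X ^ 7 - 739 * X ^ 6 - 893 * X ^ 5
    - 769 * X ^ 4 - 402 * X ^ 3 - 103 * X ^ 2 + 11 * X + 33) 5 2
    hθ h0 hmin ?_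
    (X ^ 6 - X ^ 5 + X ^ 3 + X ^ 2 + 2 * X + 2) (-2 * X ^ 7 + X ^ 5 - X ^ 4 + X ^ 3 - 2 * X ^ 2 + X + 1)
    (-3 * X ^ 14 + 5 * X ^ 13 + 2 * X ^ 12 - 6 * X ^ 11 + 4 * X ^ 10 - 7 * X ^ 9 + 5 * X ^ 8
    - 5 * X ^ 6 + 3 * X ^ 5 + 2 * X ^ 3 + 2 * X ^ 2 + X) ?_
    (X ^ 4 - 2 * X ^ 3 + X ^ 2 + X + 2)
    (-X ^ 15 + 4 * X ^ 14 + 15 * X ^ 13 + 73 * X ^ 12 + 191 * X ^ 11 + 87 * X ^ 10 - 40 * X ^ 9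
    + 341 * X ^ 8 + 1283 * X ^ 7 + 2441 * X ^ 6 + 2742 * X ^ 5 + 2036 * X ^ 4 + 964 * X ^ 3
    + 163 * X ^ 2 - 55 * X - 66) ?_
    (0)
    (2 * X ^ 10 - X ^ 9 + X ^ 8 + X ^ 6 + 2 * X ^ 5 - X ^ 4 + 2 * X + 1)
    (-2 * X ^ 3 + 2 * X ^ 2 + 2)
    (X ^ 13 + 7 * X ^ 12 + 37 * X ^ 11 + 112 * X ^ 10 + 130 * X ^ 9 + 16 * X ^ 8 - 208 * X ^ 7
    - 443 * X ^ 6 - 476 * X ^ 5 - 353 * X ^ 4 - 170 * X ^ 3 - 29 * X ^ 2 + 4 * X + 13) ?_ x hx a hpx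
  · rw [hC, FF]; ring
  · rw [hC]
    simp only [derivative_add, derivative_sub, derivative_mul, derivative_X_pow, derivative_X,
      derivative_ofNat]
    simp
    ring
  · rw [hC, FF]; ring
  · rw [hC]; ring

set_option maxHeartbeats 2000000 in
lemma FF_max_37 {K : Type*} [Field K] [CharZero K] (θ : K) (hθ : IsIntegral ℤ θ)
    (h0 : aeval θ FF = 0) (hmin : ∀ a : ℤ[X], aeval θ a = 0 → FF ∣ a)
    (x : K) (hx : IsIntegral ℤ x) (a : ℤ[X]) (hpx : ((37 : ℕ) : K) * x = aeval θ a) :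
    ∃ b : ℤ[X], x = aeval θ b := by
  have : Fact (Nat.Prime 37) := ⟨by norm_num⟩
  have hC : (C (((37 : ℕ) : ℤ)) : ℤ[X]) = 37 := rfl
  refine dedekind_crit θ FF (X ^ 8 - 14 * X ^ 7 - 15 * X ^ 5 - 7 * X ^ 4 - 10 * X ^ 3 - X ^ 2 - 8 * X + 12)
    (X ^ 4 + 17 * X ^ 3 + 5 * X ^ 2 - 14 * X - 14)
    (6 * X ^ 10 - 13 * X ^ 8 - 53 * X ^ 7 - 100 * X ^ 6 - 127 * X ^ 5 - 107 * X ^ 4 - 63 * X ^ 3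
    - 19 * X ^ 2 + 3 * X + 9) 37 2
    hθ h0 hmin ?_
    (17 * X ^ 6 - 13 * X ^ 5 + 6 * X ^ 4 + 15 * X ^ 3 + 6 * X ^ 2 - 13 * X - 16) (-16 * X ^ 7 - 12 * X ^ 6 - 4 * X ^ 5 + 8 * X ^ 4 + X ^ 3 + 17 * X ^ 2 + 6 * X - 1)
    (-3 * X ^ 14 + 33 * X ^ 13 + 36 * X ^ 12 + 36 * X ^ 11 + 12 * X ^ 10 + 24 * X ^ 9 - 46 * X ^ 8
    - 21 * X ^ 7 - 28 * X ^ 6 - 24 * X ^ 5 - 13 * X ^ 4 + 3 * X ^ 3 + 2 * X ^ 2 - 2 * X - 5) ?_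
    (X ^ 4 + 6 * X ^ 3 + 4 * X ^ 2 + 12 * X + 15)
    (-X ^ 15 + 5 * X ^ 14 + 3 * X ^ 13 + 42 * X ^ 12 + 162 * X ^ 11 + 530 * X ^ 10 + 1161 * X ^ 9
    + 2110 * X ^ 8 + 3154 * X ^ 7 + 3713 * X ^ 6 + 3353 * X ^ 5 + 2256 * X ^ 4 + 945 * X ^ 3
    + 175 * X ^ 2 - 81 * X - 63) ?_
    (0)
    (7 * X ^ 9 + 6 * X ^ 8 - 10 * X ^ 7 + 13 * X ^ 6 - 6 * X ^ 5 - 18 * X ^ 4 - 9 * X ^ 3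
    + 17 * X ^ 2 + 2 * X - 5)
    (5 * X ^ 3 + 10 * X ^ 2 + 2 * X + 17)
    (X ^ 13 + 5 * X ^ 12 + 2 * X ^ 11 - 14 * X ^ 10 - 29 * X ^ 9 - 53 * X ^ 8 - 89 * X ^ 7
    - 99 * X ^ 6 - 68 * X ^ 5 - 44 * X ^ 4 - 33 * X ^ 3 - 14 * X ^ 2 + 3 * X + 6) ?_ x hx a hpx
  · rw [hC, FF]; ring
  · rw [hC]
    simp only [derivative_add, derivative_sub, derivative_mul, derivative_X_pow, derivative_X,
      derivative_ofNat]
    simp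
    ring
  · rw [hC, FF]; ring
  · rw [hC]; ring

set_option maxHeartbeats 2000000 in
lemma FF_max_11 {K : Type*} [Field K] [CharZero K] (θ : K) (hθ : IsIntegral ℤ θ)
    (h0 : aeval θ FF = 0) (hmin : ∀ a : ℤ[X], aeval θ a = 0 → FF ∣ a)
    (x : K) (hx : IsIntegral ℤ x) (a : ℤ[X]) (hpx : ((11 : ℕ) : K) * x = aeval θ a) :
    ∃ b : ℤ[X], x = aeval θ b := by
  have : Fact (Nat.Prime 11) := ⟨by norm_num⟩
  have hC : (C (((11 : ℕ) : ℤ)) : ℤ[X]) = 11 := rfl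
  refine dedekind_crit θ FF (X ^ 2 + 3 * X)
    (X ^ 10)
    (-X ^ 10 - 9 * X ^ 9 - 51 * X ^ 8 - 179 * X ^ 7 - 336 * X ^ 6 - 406 * X ^ 5 - 350 * X ^ 4
    - 183 * X ^ 3 - 47 * X ^ 2 + 5 * X + 15) 11 11
    hθ h0 hmin ?_
    (2) (-X + 4)
    (X + 1) ?_
    (X ^ 10 - 3 * X ^ 9 - 2 * X ^ 8 - 5 * X ^ 7 + 4 * X ^ 6 - X ^ 5 + 3 * X ^ 4 + 2 * X ^ 3
    + 5 * X ^ 2 - 4 * X + 1)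
    (3 * X ^ 21 + 47 * X ^ 20 + 412 * X ^ 19 + 2453 * X ^ 18 + 10208 * X ^ 17 + 30274 * X ^ 16
    + 64429 * X ^ 15 + 96177 * X ^ 14 + 95749 * X ^ 13 + 57159 * X ^ 12 + 15810 * X ^ 11
    + 1571 * X ^ 10 + 2792 * X ^ 9 + 2937 * X ^ 8 + 2122 * X ^ 7 + 914 * X ^ 6 + 15 * X ^ 5
    - 202 * X ^ 4 - 60 * X ^ 3 - 8 * X ^ 2 + 55 * X - 15) ?_
    (-2 * X ^ 17 - X ^ 16 + 5 * X ^ 14 - 5 * X ^ 13 - 5 * X ^ 12 - 3 * X ^ 11 - 5 * X ^ 10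
    - 2 * X ^ 9 - 3 * X ^ 8 + 3 * X ^ 7 + X ^ 6 - 5 * X ^ 5 - 3 * X ^ 3 + 3 * X ^ 2 + X - 5)
    (2 * X ^ 9 - 4 * X ^ 8 + 3 * X ^ 7 - 5 * X ^ 6 + X ^ 5 - 2 * X ^ 4 - 4 * X ^ 3 + 3 * X ^ 2
    - 5 * X + 1)
    (3)
    (-X ^ 18 + X ^ 15 - 2 * X ^ 14 - 2 * X ^ 13 - X ^ 12 - 2 * X ^ 11 - X ^ 10 - 3 * X ^ 9
    - 13 * X ^ 8 - 49 * X ^ 7 - 93 * X ^ 6 - 111 * X ^ 5 - 96 * X ^ 4 - 49 * X ^ 3 - 13 * X ^ 2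
    + 4) ?_ x hx a hpx
  · rw [hC, FF]; ring
  · rw [hC]
    simp only [derivative_add, derivative_sub, derivative_mul, derivative_X_pow, derivative_X,
      derivative_ofNat]
    simp
    ring
  · rw [hC, FF]; ring
  · rw [hC]; ring

lemma g0_to_delta {L : Type*} [Field L] [CharZero L] [Algebra ℚ L] (α : L) (h : aeval α g0 = 0) :
    ∃ δ : L, aeval δ MM = 0 := by
  have hα : α ≠ 0 := by
    rintro rfl
    unfold g0 at h
    simp at h
    norm_num at h
  refine ⟨(3 - α) / (2 * α), ?_⟩
  have h1 : aeval ((3 - α) / (2 * α)) MM * (2 * α) ^ 12 = -26198073 * aeval α g0 := by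
    rw [MM_aeval]
    unfold g0
    simp only [map_add, map_sub, map_mul, map_pow, aeval_X, aeval_C, map_ofNat, map_div₀, map_one]
    field_simp
    ring
  rw [h, mul_zero] at h1
  exact (mul_eq_zero.mp h1).resolve_right (pow_ne_zero _ (mul_ne_zero two_ne_zero hα))

lemma delta_to_theta {L : Type*} [Field L] [CharZero L] (δ : L) (h : aeval δ MM = 0) :
    ∃ θ : L, aeval θ FF = 0 := by
  rw [MM_aeval] at h
  exact ⟨_, theta_root δ ((4243 * δ ^ 11 + 6300 * δ ^ 10 - 211550 * δ ^ 9 - 376457 * δ ^ 8 + 2763132 * δ ^ 7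
    + 4235531 * δ ^ 6 - 15545802 * δ ^ 5 - 19266754 * δ ^ 4 + 22429927 * δ ^ 3
    - 22373681 * δ ^ 2 - 91695899 * δ - 43136443) / 2381643) h
    (mul_div_cancel₀ _ (by norm_num))⟩

lemma deg_of_theta {L : Type*} [Field L] [CharZero L] [Algebra ℚ L] [FiniteDimensional ℚ L] (θ : L)
    (hθ : aeval θ FF = 0) : 12 ≤ Module.finrank ℚ L := by
  have h0' : aeval θ (FF.map (Int.castRingHom ℚ)) = 0 := by
    have := aeval_map_algebraMap ℚ θ FF
    rw [hθ] at this
    exact this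
  have hmp : minpoly ℚ θ = FF.map (Int.castRingHom ℚ) :=
    (minpoly.eq_of_irreducible_of_monic FF_irreducible_rat h0' (FF_monic.map _)).symm
  have h1 := minpoly.natDegree_le (A := ℚ) θ
  rwa [hmp, FF_monic.natDegree_map, FF_natDegree] at h1

lemma exists_root_field (f : ℚ[X]) (hf : Irreducible f) :
    ∃ (L : Type) (_ : Field L) (_ : Algebra ℚ L) (α : L), aeval α f = 0 ∧
      FiniteDimensional ℚ L ∧ Module.finrank ℚ L = f.natDegree := by
  have : Fact (Irreducible f) := ⟨hf⟩
  refine ⟨AdjoinRoot f, inferInstance, AdjoinRoot.instAlgebra f, AdjoinRoot.root f, ?_, ?_, ?_⟩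
  · exact (AdjoinRoot.aeval_eq f).trans AdjoinRoot.mk_self
  · exact (AdjoinRoot.powerBasis hf.ne_zero).finite
  · exact (AdjoinRoot.powerBasis hf.ne_zero).finrank.trans (AdjoinRoot.powerBasis_dim _)

lemma irr_of_theta (q : ℚ[X]) (hq : q.natDegree = 12)
    (H : ∀ (L : Type) [Field L] [CharZero L] [Algebra ℚ L] (α : L), aeval α q = 0 →
      ∃ θ : L, aeval θ FF = 0) : Irreducible q := by
  obtain ⟨f, hf, hfq⟩ := Polynomial.exists_irreducible_of_natDegree_ne_zero (f := q) (by omega)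
  have hq0 : q ≠ 0 := by rintro rfl; simp at hq
  obtain ⟨L, _, _, α, hα, _, hdeg⟩ := exists_root_field f hf
  have : CharZero L := algebraRat.charZero _
  have hroot : aeval α q = 0 := by
    obtain ⟨c, hc⟩ := hfq
    rw [hc, map_mul, hα, zero_mul]
  obtain ⟨θ, hθ⟩ := H L α hroot
  have h1 := deg_of_theta θ hθ
  have h2 : Associated f q :=
    Polynomial.associated_of_dvd_of_natDegree_le hfq hq0 (by omega)
  exact h2.irreducible hf

lemma g0_natDegree : g0.natDegree = 12 := by
  unfold g0
  compute_degree!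

lemma g0_irreducible : Irreducible g0 := by
  apply irr_of_theta _ g0_natDegree
  intro L _ _ _ α h
  obtain ⟨δ, hδ⟩ := g0_to_delta α h
  exact delta_to_theta δ hδ

lemma MM_irreducible_rat : Irreducible (MM.map (Int.castRingHom ℚ)) := by
  apply irr_of_theta _ (by rw [MM_monic.natDegree_map, MM_natDegree])
  intro L _ _ _ α h
  have := aeval_map_algebraMap ℚ α MM
  apply delta_to_theta α
  rw [← this]
  exact h

lemma norm_int {K : Type*} [Field K] [NumberField K] (x : K) (hx : IsIntegral ℤ x) :
    ∃ z : ℤ, Algebra.norm ℚ x = z := by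
  have h := Algebra.isIntegral_norm ℚ hx
  obtain ⟨z, hz⟩ := IsIntegrallyClosed.isIntegral_iff.mp h
  exact ⟨z, by rw [← hz]; simp⟩

lemma arith (D m : ℤ) (h1 : D * m ^ 2 = 26689507503059722590326250525102815661581465347680625)
    (h2 : D ∣ 11542974577178715 ^ 12) (h5 : ¬ (5 : ℤ) ∣ m) (h11 : ¬ (11 : ℤ) ∣ m)
    (h37 : ¬ (37 : ℤ) ∣ m) : D = 5 ^ 4 * 11 ^ 12 * 37 ^ 4 := by
  have hfac : (26689507503059722590326250525102815661581465347680625 : ℤ) =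
      (5 ^ 4 * 11 ^ 12 * 37 ^ 4) * 2694453618563137 ^ 2 := by norm_num
  rw [hfac] at h1
  have hDpos : 0 < D := by
    by_contra hneg
    push Not at hneg
    have := mul_nonpos_of_nonpos_of_nonneg hneg (sq_nonneg m)
    rw [h1] at this
    norm_num at this
  have c1 : IsCoprime (11542974577178715 ^ 12 : ℤ) (2694453618563137 ^ 2) := by
    apply IsCoprime.pow
    rw [Int.isCoprime_iff_gcd_eq_one]
    norm_num
  have c2 : IsCoprime D (2694453618563137 ^ 2) := IsCoprime.of_isCoprime_of_dvd_left c1 h2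
  have d1 : D ∣ 5 ^ 4 * 11 ^ 12 * 37 ^ 4 := c2.dvd_of_dvd_mul_right ⟨m ^ 2, h1.symm⟩
  have p5 : Prime (5 : ℤ) := Int.prime_iff_natAbs_prime.mpr (by norm_num)
  have p11 : Prime (11 : ℤ) := Int.prime_iff_natAbs_prime.mpr (by norm_num)
  have p37 : Prime (37 : ℤ) := Int.prime_iff_natAbs_prime.mpr (by norm_num)
  have q5 : IsCoprime (5 : ℤ) m := p5.coprime_iff_not_dvd.mpr h5
  have q11 : IsCoprime (11 : ℤ) m := p11.coprime_iff_not_dvd.mpr h11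
  have q37 : IsCoprime (37 : ℤ) m := p37.coprime_iff_not_dvd.mpr h37
  have c3 : IsCoprime (5 ^ 4 * 11 ^ 12 * 37 ^ 4 : ℤ) (m ^ 2) :=
    (((q5.pow_left).mul_left (q11.pow_left)).mul_left (q37.pow_left)).pow_right
  have d2 : (5 ^ 4 * 11 ^ 12 * 37 ^ 4 : ℤ) ∣ D := c3.dvd_of_dvd_mul_right ⟨_, h1⟩
  exact Int.dvd_antisymm hDpos.le (by norm_num) d1 d2

theorem g0_root_field_disc :
    Irreducible g0 ∧
    ∀ (K : Type) [Field K] [NumberField K],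
      Nonempty (AdjoinRoot g0 ≃ₐ[ℚ] K) →
      Module.finrank ℚ K = 12 ∧
      NumberField.discr K = 5 ^ 4 * 11 ^ 12 * 37 ^ 4 := by
  refine ⟨g0_irreducible, ?_⟩
  rintro K _ _ ⟨e⟩
  have hrank : Module.finrank ℚ K = 12 := by
    rw [← e.toLinearEquiv.finrank_eq, (AdjoinRoot.powerBasis g0_irreducible.ne_zero).finrank,
      AdjoinRoot.powerBasis_dim, g0_natDegree]
  refine ⟨hrank, ?_⟩
  have hα : aeval (e (AdjoinRoot.root g0)) g0 = 0 := by
    have h := Polynomial.aeval_algHom_apply (e : AdjoinRoot g0 →ₐ[ℚ] K) (AdjoinRoot.root g0) g0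
    rw [AdjoinRoot.aeval_eq, AdjoinRoot.mk_self, map_zero] at h
    exact h
  obtain ⟨δ, hδ⟩ := g0_to_delta _ hα
  obtain ⟨θ, hθ⟩ := delta_to_theta δ hδ
  obtain ⟨b, hb, hdis, hint, hmin⟩ :=
    pow_basis_exists θ 12 FF FF_monic FF_natDegree hrank FF_irreducible_rat hθ
  obtain ⟨b', hb', hdis', hint', hmin'⟩ :=
    pow_basis_exists δ 12 MM MM_monic MM_natDegree hrank MM_irreducible_rat hδ
  obtain ⟨m, hm, hmp⟩ := index_lemma θ hint 12 FF FF_monic FF_natDegree hmin b hb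
  obtain ⟨m', hm', -⟩ := index_lemma δ hint' 12 MM MM_monic MM_natDegree hmin' b' hb'
  rw [hdis, FF_norm θ hθ b hb] at hm
  have h1 : NumberField.discr K * m ^ 2 = 26689507503059722590326250525102815661581465347680625 := by
    have h : ((NumberField.discr K * m ^ 2 : ℤ) : ℚ) =
        ((26689507503059722590326250525102815661581465347680625 : ℤ) : ℚ) := by
      push_cast
      rw [hm]
      norm_num
    exact_mod_cast h
  obtain ⟨A, B, hAB⟩ := MM_bez
  have hBint : IsIntegral ℤ (aeval δ B) :=
    IsIntegral.of_mem_of_fg _ hint'.fg_adjoin_singleton _ (aeval_mem_adjoin_singleton ℤ δ)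
  obtain ⟨z, hz⟩ := norm_int _ hBint
  have h2 : NumberField.discr K ∣ 11542974577178715 ^ 12 := by
    have h3 := congrArg (aeval δ) hAB
    rw [map_add, map_mul, map_mul, hδ, mul_zero, zero_add, map_ofNat] at h3
    have h4 := congrArg (Algebra.norm ℚ) h3
    have h5 : Algebra.norm ℚ (11542974577178715 : K) = 11542974577178715 ^ 12 := by
      have := Algebra.norm_algebraMap (S := K) (11542974577178715 : ℚ)
      rw [hrank, map_ofNat] at this
      exact this
    rw [map_mul, hz, h5] at h4
    refine ⟨m' ^ 2 * z, ?_⟩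
    have h6 : Algebra.norm ℚ (aeval δ (derivative MM)) = NumberField.discr K * (m' : ℚ) ^ 2 := by
      rw [hm', hdis']; norm_num
    rw [h6] at h4
    have h7 : (((11542974577178715 : ℤ) ^ 12 : ℤ) : ℚ) = ((NumberField.discr K * (m' ^ 2 * z) : ℤ) : ℚ) := by
      rw [show (((11542974577178715 : ℤ) ^ 12 : ℤ) : ℚ) = (11542974577178715 : ℚ) ^ 12 by norm_num, ← h4,
        Int.cast_mul, Int.cast_mul, Int.cast_pow]
      ring
    exact_mod_cast h7
  apply arith _ m h1 h2
  · exact_mod_cast hmp 5 (by norm_num) (FF_max_5 θ hint hθ hmin)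
  · exact_mod_cast hmp 11 (by norm_num) (FF_max_11 θ hint hθ hmin)
  · exact_mod_cast hmp 37 (by norm_num) (FF_max_37 θ hint hθ hmin)
end
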